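/- arXiv:1308.0519 — 10 statements merged into one kernel-verified Lean document; each statement's English description precedes it below -/
import Mathlib

section
/- Let B₁ be the open unit ball in ℝ². For every Lipschitz function η : ℝ² → ℝ, not identically zero, whose support is a compact subset of B₁ \ {0}, both ∫_{B₁} |∇η(x)|² dx > 0 and ∫_{B₁} η(x)²/|x|² dx > 0 hold; moreover, for every ε > 0 there exists such a function η with ∫_{B₁} |∇η(x)|² dx < ε · ∫_{B₁} η(x)²/|x|² dx. Consequently the infimum over all such η of the quotient (∫_{B₁} |∇η|² dx)/(∫_{B₁} η²/|x|² dx) equals 0 and is not attained. -/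
open Set MeasureTheory
open scoped ENNReal

noncomputable section

/-- Admissible test functions: Lipschitz, not identically zero, compactly supported
in `B₁ \ {0}`. -/
def Adm (η : EuclideanSpace ℝ (Fin 2) → ℝ) : Prop :=
  (∃ K, LipschitzWith K η) ∧ η ≠ 0 ∧ IsCompact (tsupport η) ∧
    tsupport η ⊆ Metric.ball 0 1 \ {0}

/-- Dirichlet energy of `η` over the unit ball. -/
def dirEnergy (η : EuclideanSpace ℝ (Fin 2) → ℝ) : ℝ :=
  ∫ x in Metric.ball (0 : EuclideanSpace ℝ (Fin 2)) 1, ‖fderiv ℝ η x‖ ^ 2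

/-- Hardy term `∫_{B₁} η² / |x|²`. -/
def hardyTerm (η : EuclideanSpace ℝ (Fin 2) → ℝ) : ℝ :=
  ∫ x in Metric.ball (0 : EuclideanSpace ℝ (Fin 2)) 1, (η x) ^ 2 / ‖x‖ ^ 2

local notation "E2" => EuclideanSpace ℝ (Fin 2)

lemma dirEnergy_eq {η : E2 → ℝ} (h : Adm η) : dirEnergy η = ∫ x, ‖fderiv ℝ η x‖ ^ 2 := by
  unfold dirEnergy
  apply setIntegral_eq_integral_of_forall_compl_eq_zero
  intro x hx
  have : x ∉ tsupport η := fun hx' => hx (h.2.2.2 hx').1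
  rw [fderiv_of_notMem_tsupport _ this]
  simp

lemma hardyTerm_eq {η : E2 → ℝ} (h : Adm η) : hardyTerm η = ∫ x, (η x) ^ 2 / ‖x‖ ^ 2 := by
  unfold hardyTerm
  apply setIntegral_eq_integral_of_forall_compl_eq_zero
  intro x hx
  have : x ∉ tsupport η := fun hx' => hx (h.2.2.2 hx').1
  rw [image_eq_zero_of_notMem_tsupport this]
  simp

lemma hardy_cont {η : E2 → ℝ} (h : Adm η) : Continuous (fun x => (η x) ^ 2 / ‖x‖ ^ 2) := by
  obtain ⟨⟨K, hK⟩, h0, hc, hs⟩ := h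
  rw [continuous_iff_continuousAt]
  intro x
  by_cases hx : x = 0
  · have hx' : x ∉ tsupport η := fun h' => (hs h').2 hx
    have h1 : η =ᶠ[nhds x] 0 := notMem_tsupport_iff_eventuallyEq.mp hx'
    have h2 : (fun x => (η x) ^ 2 / ‖x‖ ^ 2) =ᶠ[nhds x] fun _ => 0 := by
      filter_upwards [h1] with y hy
      simp [hy]
    exact (continuousAt_const (y := (0:ℝ))).congr h2.symm
  · have : ‖x‖ ^ 2 ≠ 0 := by simpa using hx
    exact ((hK.continuous.continuousAt).pow 2).div (continuous_norm.continuousAt.pow 2) this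

lemma hardy_supp {η : E2 → ℝ} (h : Adm η) :
    HasCompactSupport (fun x => (η x) ^ 2 / ‖x‖ ^ 2) := by
  have h1 : HasCompactSupport η := h.2.2.1
  refine h1.mono ?_
  intro x hx hx'
  apply hx
  simp [hx']

lemma hardy_pos {η : E2 → ℝ} (h : Adm η) : 0 < hardyTerm η := by
  rw [hardyTerm_eq h]
  obtain ⟨x, hx⟩ := Function.ne_iff.mp h.2.1
  refine (hardy_cont h).integral_pos_of_hasCompactSupport_nonneg_nonzero (x := x)
    (hardy_supp h) (fun x => by positivity) ?_
  have hx0 : x ≠ 0 := (h.2.2.2 (subset_tsupport _ hx)).2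
  have : ‖x‖ ≠ 0 := by simpa using hx0
  have hx' : η x ≠ 0 := hx
  positivity

lemma dir_integrable {η : E2 → ℝ} (h : Adm η) :
    Integrable (fun x => ‖fderiv ℝ η x‖ ^ 2) := by
  obtain ⟨⟨K, hK⟩, h0, hc, hs⟩ := h
  have hm : Measurable (fun x => ‖fderiv ℝ η x‖ ^ 2) :=
    ((measurable_fderiv ℝ η).norm).pow_const 2
  have : IntegrableOn (fun x => ‖fderiv ℝ η x‖ ^ 2) (tsupport η) := by
    refine Measure.integrableOn_of_bounded (M := (K:ℝ)^2) hc.measure_lt_top.ne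
      hm.aestronglyMeasurable ?_
    refine Filter.Eventually.of_forall fun x => ?_
    rw [Real.norm_of_nonneg (by positivity)]
    have := norm_fderiv_le_of_lipschitz ℝ hK (x₀ := x)
    gcongr
  refine (integrableOn_iff_integrable_of_support_subset ?_).mp this
  intro x hx
  by_contra hx'
  apply hx
  simp [fderiv_of_notMem_tsupport ℝ hx']

lemma dir_pos {η : E2 → ℝ} (h : Adm η) : 0 < dirEnergy η := by
  rw [dirEnergy_eq h]
  have hint := dir_integrable h
  obtain ⟨⟨K, hK⟩, h0, hc, hs⟩ := h
  have hnn : 0 ≤ ∫ x, ‖fderiv ℝ η x‖ ^ 2 := integral_nonneg fun x => by positivity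
  refine lt_of_le_of_ne hnn fun heq => ?_
  have hz := (integral_eq_zero_iff_of_nonneg (fun x => by positivity) hint).mp heq.symm
  have hlip : LipschitzWith (1 * K) (fun x => |η x|) := 
    (lipschitzWith_one_norm (E := ℝ)).comp hK
  have hcs : HasCompactSupport (fun x => |η x|) := 
    HasCompactSupport.comp_left (g := fun t : ℝ => |t|) hc abs_zero
  have hd : ∀ᵐ x, HasFDerivAt (fun x => |η x|) (0 : E2 →L[ℝ] ℝ) x := by
    filter_upwards [hz, hK.ae_differentiableAt (μ := volume)] with x hx hdx
    have hx' : fderiv ℝ η x = 0 := by simpa using hx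
    have h1 := hdx.hasFDerivAt
    rw [hx'] at h1
    rw [hasFDerivAt_iff_isLittleO] at h1 ⊢
    refine Asymptotics.IsBigO.trans_isLittleO ?_ h1
    refine Asymptotics.IsBigO.of_bound 1 (Filter.Eventually.of_forall fun y => ?_)
    simpa using abs_abs_sub_abs_le_abs_sub (η y) (η x)
  have hip := LipschitzWith.integral_lineDeriv_mul_eq (μ := volume)
    (EuclideanSpace.proj (𝕜 := ℝ) (0 : Fin 2)).lipschitz hlip hcs
    (EuclideanSpace.single (0 : Fin 2) (1:ℝ))
  have hr : ∫ x, lineDeriv ℝ (fun x => |η x|) x (-(EuclideanSpace.single (0 : Fin 2) (1:ℝ)))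
      * (EuclideanSpace.proj (𝕜 := ℝ) (0 : Fin 2)) x = 0 := by
    apply integral_eq_zero_of_ae
    filter_upwards [hd] with x hx
    rw [(hx.hasLineDerivAt _).lineDeriv]
    simp
  rw [hr] at hip
  have hl : ∀ x, lineDeriv ℝ (EuclideanSpace.proj (𝕜 := ℝ) (0 : Fin 2)) x
      (EuclideanSpace.single (0 : Fin 2) (1:ℝ)) = 1 := by
    intro x
    rw [((EuclideanSpace.proj (𝕜 := ℝ) (0 : Fin 2)).hasFDerivAt.hasLineDerivAt _).lineDeriv]
    simp
  simp only [hl, one_mul] at hip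
  obtain ⟨x, hx⟩ := Function.ne_iff.mp h0
  have := hlip.continuous.integral_pos_of_hasCompactSupport_nonneg_nonzero (μ := volume) (x := x)
    hcs (fun x => abs_nonneg _) (abs_ne_zero.mpr hx)
  exact this.ne' hip

/-- The radial weight `1/r²` cut off to `[a,b]`. -/
def wt (a b : ℝ) : ℝ → ℝ := (Icc a b).indicator (fun r => 1 / r ^ 2)

lemma wt_aux {a b : ℝ} (ha : 0 < a) (r : ℝ) :
    r ^ (Module.finrank ℝ E2 - 1) • wt a b r = (Icc a b).indicator (fun r => r⁻¹) r := by
  unfold wt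
  by_cases hr : r ∈ Icc a b
  · have : 0 < r := ha.trans_le hr.1
    simp [hr]
    field_simp
  · simp [hr]

lemma wt_integrable {a b : ℝ} (ha : 0 < a) : Integrable (fun x : E2 => wt a b ‖x‖) := by
  rw [integrable_fun_norm_addHaar]
  simp only [wt_aux ha]
  apply Integrable.integrableOn
  rw [integrable_indicator_iff measurableSet_Icc]
  apply ContinuousOn.integrableOn_Icc
  intro x hx
  exact (continuousAt_inv₀ (ha.trans_le hx.1).ne').continuousWithinAt

lemma wt_integral {a b : ℝ} (ha : 0 < a) (hab : a ≤ b) :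
    ∫ x : E2, wt a b ‖x‖ = 2 * volume.real (Metric.ball (0 : E2) 1) * Real.log (b / a) := by
  rw [integral_fun_norm_addHaar]
  simp only [wt_aux ha]
  rw [setIntegral_indicator measurableSet_Icc]
  have : Ioi (0:ℝ) ∩ Icc a b = Icc a b := inter_eq_right.mpr fun x hx => ha.trans_le hx.1
  rw [this, integral_Icc_eq_integral_Ioc, ← intervalIntegral.integral_of_le hab,
    integral_inv_of_pos ha (ha.trans_le hab)]
  simp
  ring

/-- Logarithmic tent. -/
def tent (L : ℝ) (x : E2) : ℝ :=
  max 0 (L - |Real.log (max (Real.exp (-(3 * L))) ‖x‖) + 2 * L|)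

lemma log_lip1 {c p q : ℝ} (hc : 0 < c) (hp : c ≤ p) (hq : c ≤ q) :
    Real.log p - Real.log q ≤ |p - q| / c := by
  have hp0 := hc.trans_le hp
  have hq0 := hc.trans_le hq
  rw [← Real.log_div hp0.ne' hq0.ne']
  have h1 := Real.log_le_sub_one_of_pos (div_pos hp0 hq0)
  have h2 : p / q - 1 = (p - q) / q := by field_simp
  calc _ ≤ (p - q) / q := by rw [← h2]; exact h1
    _ ≤ |p - q| / q := by gcongr; exact le_abs_self _
    _ ≤ |p - q| / c := by gcongr

lemma tent_lip {L c : ℝ} {x y : E2} (hc : 0 < c)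
    (hx : c ≤ max (Real.exp (-(3 * L))) ‖x‖) (hy : c ≤ max (Real.exp (-(3 * L))) ‖y‖) :
    |tent L x - tent L y| ≤ c⁻¹ * ‖x - y‖ := by
  unfold tent
  set p := max (Real.exp (-(3 * L))) ‖x‖
  set q := max (Real.exp (-(3 * L))) ‖y‖
  have h1 := log_lip1 hc hx hy
  have h2 := log_lip1 hc hy hx
  rw [abs_sub_comm] at h2
  have h3 : |p - q| ≤ ‖x - y‖ := by
    have := abs_max_sub_max_le_abs ‖x‖ ‖y‖ (Real.exp (-(3 * L)))
    rw [max_comm ‖x‖, max_comm ‖y‖] at this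
    exact this.trans (abs_norm_sub_norm_le x y)
  have h4 : |p - q| / c ≤ c⁻¹ * ‖x - y‖ := by
    rw [div_eq_inv_mul]; gcongr
  have h5 := abs_max_sub_max_le_abs (L - |Real.log p + 2 * L|) (L - |Real.log q + 2 * L|) 0
  rw [max_comm _ (0:ℝ), max_comm _ (0:ℝ)] at h5
  refine h5.trans (le_trans ?_ h4)
  have h6 := abs_abs_sub_abs_le_abs_sub (Real.log q + 2 * L) (Real.log p + 2 * L)
  have h7 : |Real.log q + 2 * L - (Real.log p + 2 * L)| ≤ |p - q| / c := by
    rw [abs_le]; constructor <;> linarith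
  calc _ = |(|Real.log q + 2 * L| - |Real.log p + 2 * L|)| := by congr 1; ring
    _ ≤ _ := h6.trans h7

lemma tent_supp {L : ℝ} (hL : 0 < L) :
    tsupport (tent L) ⊆ {x | ‖x‖ ∈ Icc (Real.exp (-(3 * L))) (Real.exp (-L))} := by
  apply closure_minimal
  · intro x hx
    have h1 : 0 < L - |Real.log (max (Real.exp (-(3 * L))) ‖x‖) + 2 * L| := by
      by_contra hcon
      exact hx (max_eq_left (not_lt.mp hcon))
    have h2 := abs_lt.mp (sub_pos.mp h1)
    have hm : 0 < max (Real.exp (-(3 * L))) ‖x‖ := lt_max_of_lt_left (Real.exp_pos _)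
    constructor
    · by_contra hcon
      rw [max_eq_left (not_le.mp hcon).le, Real.log_exp] at h2
      linarith [h2.1]
    · have : Real.log (max (Real.exp (-(3 * L))) ‖x‖) ≤ -L := by linarith [h2.2]
      exact (le_max_right _ _).trans ((Real.log_le_iff_le_exp hm).mp this)
  · exact isClosed_Icc.preimage continuous_norm

lemma tent_adm {L : ℝ} (hL : 0 < L) : Adm (tent L) := by
  refine ⟨⟨⟨(Real.exp (-(3 * L)))⁻¹, by positivity⟩, ?_⟩, ?_, ?_, ?_⟩
  · apply LipschitzWith.of_dist_le_mul
    intro x y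
    rw [Real.dist_eq, dist_eq_norm]
    exact tent_lip (Real.exp_pos _) (le_max_left _ _) (le_max_left _ _)
  · intro h
    have h1 := congrFun h (EuclideanSpace.single (0 : Fin 2) (Real.exp (-(2 * L))))
    have h2 : Real.exp (-(3 * L)) ≤ Real.exp (-(2 * L)) := Real.exp_le_exp.mpr (by linarith)
    have h3 : ‖EuclideanSpace.single (0 : Fin 2) (Real.exp (-(2 * L)))‖ = Real.exp (-(2 * L)) := by
      simp
    unfold tent at h1
    rw [h3, max_eq_right h2, Real.log_exp] at h1
    simp at h1
    linarith
  · refine (isCompact_closedBall (0 : E2) (Real.exp (-L))).of_isClosed_subset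
      (isClosed_tsupport _) ?_
    intro x hx
    simpa using (tent_supp hL hx).2
  · intro x hx
    have h1 := tent_supp hL hx
    refine ⟨?_, ?_⟩
    · have : Real.exp (-L) < 1 := by simpa using hL
      simpa using h1.2.trans_lt this
    · intro h0
      have h2 := (Real.exp_pos _).trans_le h1.1
      rw [show x = 0 from h0] at h2
      simp at h2

lemma tent_dir {L : ℝ} (hL : 0 < L) :
    dirEnergy (tent L) ≤ 4 * (2 * volume.real (Metric.ball (0 : E2) 1) * (2 * L)) := by
  rw [dirEnergy_eq (tent_adm hL)]
  have hw := wt_integral (a := Real.exp (-(3 * L))) (b := Real.exp (-L)) (Real.exp_pos _)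
    (Real.exp_le_exp.mpr (by linarith))
  rw [← Real.exp_sub, Real.log_exp, show -L - -(3 * L) = 2 * L by ring] at hw
  rw [← hw, ← integral_const_mul]
  refine integral_mono (dir_integrable (tent_adm hL))
    ((wt_integrable (Real.exp_pos _)).const_mul 4) fun x => ?_
  by_cases hx : x ∈ tsupport (tent L)
  · have h1 : ‖x‖ ∈ Icc (Real.exp (-(3 * L))) (Real.exp (-L)) := tent_supp hL hx
    have hx0 : 0 < ‖x‖ := (Real.exp_pos _).trans_le h1.1
    have h2 : wt (Real.exp (-(3 * L))) (Real.exp (-L)) ‖x‖ = 1 / ‖x‖ ^ 2 :=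
      indicator_of_mem h1 _
    simp only [h2]
    have h3 : ‖fderiv ℝ (tent L) x‖ ≤ (‖x‖ / 2)⁻¹ := by
      apply norm_fderiv_le_of_lip' ℝ (by positivity)
      have : ∀ᶠ y in nhds x, ‖x‖ / 2 < ‖y‖ :=
        continuous_norm.continuousAt.eventually (lt_mem_nhds (by linarith))
      filter_upwards [this] with y hy
      rw [Real.norm_eq_abs]
      exact tent_lip (by positivity) (hy.le.trans (le_max_right _ _))
        ((by linarith : ‖x‖ / 2 ≤ ‖x‖).trans (le_max_right _ _))
    calc ‖fderiv ℝ (tent L) x‖ ^ 2 ≤ ((‖x‖ / 2)⁻¹) ^ 2 := by gcongr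
      _ = _ := by field_simp; norm_num
  · simp only [fderiv_of_notMem_tsupport _ hx]
    have : 0 ≤ wt (Real.exp (-(3 * L))) (Real.exp (-L)) ‖x‖ :=
      indicator_nonneg (fun r _ => by positivity) _
    simpa using this

lemma tent_hardy {L : ℝ} (hL : 0 < L) :
    (L ^ 2 / 4) * (2 * volume.real (Metric.ball (0 : E2) 1) * L) ≤ hardyTerm (tent L) := by
  rw [hardyTerm_eq (tent_adm hL)]
  have hw := wt_integral (a := Real.exp (-(5 / 2 * L))) (b := Real.exp (-(3 / 2 * L)))
    (Real.exp_pos _) (Real.exp_le_exp.mpr (by linarith))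
  rw [← Real.exp_sub, Real.log_exp, show -(3 / 2 * L) - -(5 / 2 * L) = L by ring] at hw
  rw [← hw, ← integral_const_mul]
  refine integral_mono ((wt_integrable (Real.exp_pos _)).const_mul _)
    ((hardy_cont (tent_adm hL)).integrable_of_hasCompactSupport (hardy_supp (tent_adm hL)))
    fun x => ?_
  by_cases hx : ‖x‖ ∈ Icc (Real.exp (-(5 / 2 * L))) (Real.exp (-(3 / 2 * L)))
  · have hx0 : 0 < ‖x‖ := (Real.exp_pos _).trans_le hx.1
    have h2 : wt (Real.exp (-(5 / 2 * L))) (Real.exp (-(3 / 2 * L))) ‖x‖ = 1 / ‖x‖ ^ 2 :=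
      indicator_of_mem hx _
    simp only [h2]
    have h3 : L / 2 ≤ tent L x := by
      have h4 : Real.exp (-(3 * L)) ≤ ‖x‖ :=
        (Real.exp_le_exp.mpr (by linarith)).trans hx.1
      unfold tent
      rw [max_eq_right h4]
      refine le_max_of_le_right ?_
      have h5 := (Real.le_log_iff_exp_le hx0).mpr hx.1
      have h6 := (Real.log_le_iff_le_exp hx0).mpr hx.2
      have : |Real.log ‖x‖ + 2 * L| ≤ L / 2 := by
        rw [abs_le]; constructor <;> linarith
      linarith
    calc L ^ 2 / 4 * (1 / ‖x‖ ^ 2) = (L / 2) ^ 2 / ‖x‖ ^ 2 := by ring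
      _ ≤ _ := by gcongr
  · have h2 : wt (Real.exp (-(5 / 2 * L))) (Real.exp (-(3 / 2 * L))) ‖x‖ = 0 :=
      indicator_of_notMem hx _
    simp only [h2, mul_zero]
    positivity

lemma hardy_fail (ε : ℝ) (hε : 0 < ε) : ∃ η, Adm η ∧ dirEnergy η < ε * hardyTerm η := by
  have hL : 0 < 1 + 32 / ε := by positivity
  refine ⟨tent (1 + 32 / ε), tent_adm hL, ?_⟩
  have h1 := tent_dir hL
  have h2 := tent_hardy hL
  have hLε : 32 < ε * (1 + 32 / ε) := by
    have : ε * (1 + 32 / ε) = ε + 32 := by field_simp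
    linarith
  have hL1 : 1 < 1 + 32 / ε := by have : 0 < 32 / ε := by positivity
                                  linarith
  generalize 1 + 32 / ε = L at *
  have hV : 0 < volume.real (Metric.ball (0 : E2) 1) :=
    ENNReal.toReal_pos (Metric.measure_ball_pos _ _ one_pos).ne' measure_ball_lt_top.ne
  generalize volume.real (Metric.ball (0 : E2) 1) = V at *
  refine h1.trans_lt (lt_of_lt_of_le ?_ (mul_le_mul_of_nonneg_left h2 hε.le))
  have h3 : 32 < ε * L * L := by nlinarith
  have h4 : 0 < V * L := by positivity
  nlinarith

/-- failure of the Hardy inequality in the plane.  For every admissible `η`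
both integrals are positive; for every `ε > 0` some admissible `η` has Hardy quotient
below `ε`; consequently the infimum of the Hardy quotients is `0` and is not attained. -/
theorem stmt_2 :
    (∀ η, Adm η → 0 < dirEnergy η ∧ 0 < hardyTerm η) ∧
    (∀ ε : ℝ, 0 < ε → ∃ η, Adm η ∧ dirEnergy η < ε * hardyTerm η) ∧
    IsGLB {q : ℝ | ∃ η, Adm η ∧ q = dirEnergy η / hardyTerm η} 0 ∧
    (0 : ℝ) ∉ {q : ℝ | ∃ η, Adm η ∧ q = dirEnergy η / hardyTerm η} := by
  have hpos : ∀ η, Adm η → 0 < dirEnergy η ∧ 0 < hardyTerm η :=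
    fun η h => ⟨dir_pos h, hardy_pos h⟩
  refine ⟨hpos, hardy_fail, ⟨?_, ?_⟩, ?_⟩
  · rintro q ⟨η, h, rfl⟩
    exact (div_pos (hpos η h).1 (hpos η h).2).le
  · intro b hb
    by_contra hcon
    obtain ⟨η, h, hlt⟩ := hardy_fail b (not_le.mp hcon)
    have h1 := hb ⟨η, h, rfl⟩
    rw [le_div_iff₀ (hpos η h).2] at h1
    linarith
  · rintro ⟨η, h, heq⟩
    exact (div_pos (hpos η h).1 (hpos η h).2).ne heq

end
end

section
/- Let β ≠ 0 be a real number and let h : (0,1) → ℝ be a bounded measurable function. Suppose ψ : (0,1] → ℝ is continuous, twice differentiable on (0,1), satisfies −ψ''(r) − (1/r)ψ'(r) + (β²/r²)ψ(r) = h(r)ψ(r) for all r ∈ (0,1), ψ(1) = 0, and ∫₀¹ (ψ'(r)² + ψ(r)²/r²)·r dr < ∞. Then there exists a constant C > 0 such that |ψ(t)| ≤ C·t^{|β|} for all t ∈ (0,1); in particular ψ is bounded on (0,1) and ψ(t) → 0 as t → 0⁺. -/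
open Set MeasureTheory Filter

lemma aux_second (u v : ℝ → ℝ) (x w : ℝ) (hm : IsLocalMax u x)
    (hu : ∀ᶠ y in nhds x, HasDerivAt u (v y) y) (hv : HasDerivAt v w x) : w ≤ 0 := by
  by_contra hw
  push Not at hw
  have h1 : deriv u =ᶠ[nhds x] v := by
    filter_upwards [hu] with y hy using hy.deriv
  have h2 : deriv (deriv u) x = w := by
    rw [h1.deriv_eq]; exact hv.deriv
  have h3 : IsLocalMin u x :=
    isLocalMin_of_deriv_deriv_pos (by rw [h2]; exact hw) hm.deriv_eq_zero
      hu.self_of_nhds.continuousAt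
  have h4 : u =ᶠ[nhds x] fun _ => u x := by
    filter_upwards [hm, h3] with y hy1 hy2 using le_antisymm hy1 hy2
  have h5 : deriv (deriv u) x = 0 := by
    rw [h4.deriv.deriv_eq]; simp
  linarith

/-- derivative of `r^b * poly`. -/
lemma aux_W1 (b A r : ℝ) (hr : 0 < r) :
    HasDerivAt (fun r : ℝ => r ^ b * (1 - A * r ^ 2))
      (r ^ b * (b / r - A * (b + 2) * r)) r := by
  have h1 := Real.hasDerivAt_rpow_const (x := r) (p := b) (Or.inl hr.ne')
  have h2 : HasDerivAt (fun r : ℝ => 1 - A * r ^ 2) (-(A * (2 * r))) r := by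
    have := ((hasDerivAt_pow 2 r).const_mul A).const_sub 1
    simpa using this
  have h3 := h1.mul h2
  refine h3.congr_deriv ?_
  rw [Real.rpow_sub_one hr.ne']
  field_simp
  ring

lemma aux_W2 (b A r : ℝ) (hr : 0 < r) :
    HasDerivAt (fun r : ℝ => r ^ b * (b / r - A * (b + 2) * r))
      (r ^ b * (b * (b - 1) / r ^ 2 - A * (b + 2) * (b + 1))) r := by
  have h1 := Real.hasDerivAt_rpow_const (x := r) (p := b) (Or.inl hr.ne')
  have h2 : HasDerivAt (fun r : ℝ => b / r - A * (b + 2) * r)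
      (b * (-(r ^ 2)⁻¹) - A * (b + 2) * 1) r := by
    have := ((hasDerivAt_inv hr.ne').const_mul b).fun_sub ((hasDerivAt_id r).const_mul (A * (b + 2)))
    simpa [div_eq_mul_inv] using this
  have h3 := h1.mul h2
  refine h3.congr_deriv ?_
  rw [Real.rpow_sub_one hr.ne']
  field_simp
  ring

lemma aux_comp (b M : ℝ) (hb : 0 < b) (hM : 0 < M) (h f g k : ℝ → ℝ)
    (hbd : ∀ r ∈ Ioo (0 : ℝ) 1, |h r| ≤ M)
    (hf : ∀ r ∈ Ioo (0 : ℝ) 1, HasDerivAt f (g r) r)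
    (hg : ∀ r ∈ Ioo (0 : ℝ) 1, HasDerivAt g (k r) r)
    (hode : ∀ r ∈ Ioo (0 : ℝ) 1, -k r - (1 / r) * g r + (b ^ 2 / r ^ 2) * f r = h r * f r)
    (R s C ε : ℝ) (hs : 0 < s) (hR : R < 1) (hMR : M * R ^ 2 ≤ 1 / 2)
    (hMb : M * R ^ 2 < b ^ 2) (hC : 0 ≤ C) (hε : 0 < ε) (hfs : f s ≤ ε)
    (hfR : f R ≤ C * (R ^ b * (1 - M * R ^ 2))) :
    ∀ t ∈ Icc s R, f t ≤ C * (t ^ b * (1 - M * t ^ 2)) + ε := by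
  intro t ht
  have hsub : Icc s R ⊆ Ioo 0 1 := fun x hx => ⟨hs.trans_le hx.1, hx.2.trans_lt hR⟩
  set u : ℝ → ℝ := fun r => f r - C * (r ^ b * (1 - M * r ^ 2)) - ε with hu
  have hud : ∀ r ∈ Ioo (0 : ℝ) 1,
      HasDerivAt u (g r - C * (r ^ b * (b / r - M * (b + 2) * r))) r := fun r hr =>
    ((hf r hr).sub ((aux_W1 b M r hr.1).const_mul C)).sub_const ε
  have hcont : ContinuousOn u (Icc s R) := fun r hr =>
    (hud r (hsub hr)).continuousAt.continuousWithinAt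
  obtain ⟨x, hx, hmax⟩ := isCompact_Icc.exists_isMaxOn ⟨t, ht⟩ hcont
  have hMx : ∀ y ∈ Icc s R, M * y ^ 2 ≤ M * R ^ 2 := by
    intro y hy
    have : 0 < y := (hsub hy).1
    have := hy.2
    gcongr
  have key : u x ≤ 0 := by
    by_contra hpos
    push Not at hpos
    have hxs : x ≠ s := by
      rintro rfl
      have h1 : 0 ≤ C * (x ^ b * (1 - M * x ^ 2)) := by
        have := hMx x hx
        have h2 : 0 ≤ 1 - M * x ^ 2 := by linarith
        positivity
      simp only [hu] at hpos
      linarith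
    have hxR : x ≠ R := by
      rintro rfl
      simp only [hu] at hpos
      linarith
    have hx01 := hsub hx
    have hx0 : 0 < x := hx01.1
    have hloc : IsLocalMax u x :=
      hmax.isLocalMax (Icc_mem_nhds (lt_of_le_of_ne hx.1 hxs.symm) (lt_of_le_of_ne hx.2 hxR))
    have hd2 : HasDerivAt (fun r => g r - C * (r ^ b * (b / r - M * (b + 2) * r)))
        (k x - C * (x ^ b * (b * (b - 1) / x ^ 2 - M * (b + 2) * (b + 1)))) x :=
      (hg x hx01).sub ((aux_W2 b M x hx0).const_mul C)
    have h2 := aux_second u _ x _ hloc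
      (by filter_upwards [isOpen_Ioo.mem_nhds hx01] with y hy using hud y hy) hd2
    have h1 := hloc.hasDerivAt_eq_zero (hud x hx01)
    have ho := hode x hx01
    have hb1 := abs_le.1 (hbd x hx01)
    have hp : 0 < x ^ b := Real.rpow_pos_of_pos hx0 b
    have hMx' := hMx x hx
    simp only [hu] at hpos
    generalize x ^ b = p at *
    generalize h x = H at *
    have ho' : x ^ 2 * k x + x * g x = (b ^ 2 - x ^ 2 * H) * f x := by
      field_simp at ho
      linarith
    have hg' : x * g x = C * p * (b - M * (b + 2) * x ^ 2) := by
      have : g x = C * (p * (b / x - M * (b + 2) * x)) := by linarith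
      rw [this]; field_simp
    have hk' : x ^ 2 * k x ≤ C * p * (b * (b - 1) - M * (b + 2) * (b + 1) * x ^ 2) := by
      have : k x ≤ C * (p * (b * (b - 1) / x ^ 2 - M * (b + 2) * (b + 1))) := by linarith
      calc x ^ 2 * k x ≤ x ^ 2 * (C * (p * (b * (b - 1) / x ^ 2 - M * (b + 2) * (b + 1)))) := by
            gcongr
        _ = _ := by field_simp
    have hq : 0 < b ^ 2 - x ^ 2 * H := by
      have : x ^ 2 * H ≤ x ^ 2 * M := by gcongr; exact hb1.2
      linarith
    have hfx : C * (p * (1 - M * x ^ 2)) < f x := by linarith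
    have h3 := mul_lt_mul_of_pos_left hfx hq
    have h4 : C * p * (b ^ 2 - M * (b + 2) ^ 2 * x ^ 2)
        ≤ (b ^ 2 - x ^ 2 * H) * (C * (p * (1 - M * x ^ 2))) := by
      have hCp : 0 ≤ C * p := by positivity
      have h5 : b ^ 2 - M * (b + 2) ^ 2 * x ^ 2 ≤ (b ^ 2 - x ^ 2 * H) * (1 - M * x ^ 2) := by
        have h6 : 0 ≤ 1 - M * x ^ 2 := by linarith
        have h7 : x ^ 2 * H * (1 - M * x ^ 2) ≤ x ^ 2 * M * 1 := by
          have : x ^ 2 * H ≤ x ^ 2 * M := by gcongr; exact hb1.2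
          have h8 : 0 ≤ M * x ^ 2 := by positivity
          calc _ ≤ x ^ 2 * M * (1 - M * x ^ 2) := by gcongr
            _ ≤ _ := by gcongr; linarith
        have h9 : 0 ≤ M * x ^ 2 * b := by positivity
        have h10 : 0 ≤ M * x ^ 2 := by positivity
        nlinarith
      calc _ ≤ C * p * ((b ^ 2 - x ^ 2 * H) * (1 - M * x ^ 2)) := by gcongr
        _ = _ := by ring
    nlinarith
  have := (hmax ht : u t ≤ u x).trans key
  simp only [hu] at this
  linarith

lemma aux_small (ψ : ℝ → ℝ)
    (hint : IntegrableOn (fun r => ((deriv ψ r) ^ 2 + (ψ r) ^ 2 / r ^ 2) * r) (Ioo 0 1))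
    (t ε : ℝ) (ht : 0 < t) (ht1 : t < 1) (hε : 0 < ε) : ∃ s, 0 < s ∧ s < t ∧ |ψ s| ≤ ε := by
  by_contra! hcon
  have h1 : IntegrableOn (fun r : ℝ => r ^ (-1 : ℝ)) (Ioo 0 t) := by
    have h2 := (hint.mono_set (Ioo_subset_Ioo_right ht1.le)).const_mul (1 / ε ^ 2)
    refine Integrable.mono' h2 ?_ ?_
    · exact (measurable_id.pow_const _).aestronglyMeasurable
    · filter_upwards [ae_restrict_mem measurableSet_Ioo] with r hr
      have hr0 : 0 < r := hr.1
      have h3 := hcon r hr.1 hr.2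
      rw [Real.rpow_neg_one, Real.norm_of_nonneg (by positivity)]
      have h4 : ε ^ 2 ≤ ψ r ^ 2 := by
        rw [← sq_abs (ψ r)]; gcongr
      calc r⁻¹ = 1 / ε ^ 2 * ((0 + ε ^ 2 / r ^ 2) * r) := by field_simp; try ring
        _ ≤ _ := by gcongr; positivity
  rw [intervalIntegral.integrableOn_Ioo_rpow_iff ht] at h1
  linarith

/-- decay at the origin for finite-energy solutions of the singular ODE
`−ψ'' − ψ'/r + β²ψ/r² = hψ` on `(0,1)` with `ψ(1) = 0`:
`|ψ(t)| ≤ C t^{|β|}`, so `ψ` is bounded and `ψ(t) → 0` as `t → 0⁺`. -/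
theorem stmt_3 (β : ℝ) (hβ : β ≠ 0) (h : ℝ → ℝ) (hmeas : Measurable h)
    (hbdd : ∃ M : ℝ, ∀ r ∈ Ioo (0 : ℝ) 1, |h r| ≤ M)
    (ψ : ℝ → ℝ) (hcont : ContinuousOn ψ (Ioc 0 1))
    (hd1 : ∀ r ∈ Ioo (0 : ℝ) 1, DifferentiableAt ℝ ψ r)
    (hd2 : ∀ r ∈ Ioo (0 : ℝ) 1, DifferentiableAt ℝ (deriv ψ) r)
    (hode : ∀ r ∈ Ioo (0 : ℝ) 1,
      -deriv (deriv ψ) r - (1 / r) * deriv ψ r + (β ^ 2 / r ^ 2) * ψ r = h r * ψ r)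
    (hbc : ψ 1 = 0)
    (hint : IntegrableOn (fun r => ((deriv ψ r) ^ 2 + (ψ r) ^ 2 / r ^ 2) * r) (Ioo 0 1)) :
    (∃ C : ℝ, 0 < C ∧ ∀ t ∈ Ioo (0 : ℝ) 1, |ψ t| ≤ C * t ^ |β|) ∧
    (∃ M : ℝ, ∀ t ∈ Ioo (0 : ℝ) 1, |ψ t| ≤ M) ∧
    Tendsto ψ (nhdsWithin 0 (Ioi 0)) (nhds 0) := by
  obtain ⟨M0, hM0⟩ := hbdd
  set b := |β| with hbdef
  have hb : 0 < b := abs_pos.2 hβ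
  set M := max M0 1
  have hM : 0 < M := lt_max_of_lt_right one_pos
  have hbd : ∀ r ∈ Ioo (0 : ℝ) 1, |h r| ≤ M := fun r hr => (hM0 r hr).trans (le_max_left _ _)
  have hb2 : b ^ 2 = β ^ 2 := sq_abs β
  obtain ⟨R, hR0, hR1, hMR, hMb⟩ :
      ∃ R : ℝ, 0 < R ∧ R < 1 ∧ M * R ^ 2 ≤ 1 / 2 ∧ M * R ^ 2 < b ^ 2 := by
    have hc : Tendsto (fun R : ℝ => M * R ^ 2) (nhdsWithin 0 (Ioi 0)) (nhds 0) := by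
      have : Continuous (fun R : ℝ => M * R ^ 2) := by fun_prop
      have := this.tendsto 0
      simp only [ne_eq, OfNat.ofNat_ne_zero, not_false_eq_true, zero_pow, mul_zero] at this
      exact this.mono_left nhdsWithin_le_nhds
    have e1 := hc.eventually (Iio_mem_nhds (show (0 : ℝ) < 1 / 2 by norm_num))
    have e2 := hc.eventually (Iio_mem_nhds (show (0 : ℝ) < b ^ 2 by positivity))
    have e3 : ∀ᶠ R : ℝ in nhdsWithin 0 (Ioi 0), R ∈ Ioo (0 : ℝ) 1 :=
      Ioo_mem_nhdsGT one_pos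
    obtain ⟨R, h1, h2, h3⟩ := (e1.and (e2.and e3)).exists
    exact ⟨R, h3.1, h3.2, le_of_lt h1, h2⟩
  have hWR : 0 < R ^ b * (1 - M * R ^ 2) :=
    mul_pos (Real.rpow_pos_of_pos hR0 b) (by linarith)
  set C := |ψ R| / (R ^ b * (1 - M * R ^ 2)) with hCdef
  have hC : 0 ≤ C := by positivity
  have hCR : C * (R ^ b * (1 - M * R ^ 2)) = |ψ R| := div_mul_cancel₀ _ hWR.ne'
  have hsmall : ∀ t, 0 < t → t ≤ R → |ψ t| ≤ C * t ^ b := by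
    intro t ht htR
    have hle : |ψ t| ≤ C * (t ^ b * (1 - M * t ^ 2)) := by
      refine le_of_forall_pos_le_add fun ε hε => ?_
      obtain ⟨s, hs0, hst, hsε⟩ := aux_small ψ hint t ε ht (htR.trans_lt hR1) hε
      have hs' := abs_le.1 hsε
      refine abs_le'.2 ⟨?_, ?_⟩
      · refine aux_comp b M hb hM h ψ (deriv ψ) (deriv (deriv ψ)) hbd
          (fun r hr => (hd1 r hr).hasDerivAt) (fun r hr => (hd2 r hr).hasDerivAt)
          (fun r hr => by rw [hb2]; exact hode r hr)
          R s C ε hs0 hR1 hMR hMb hC hε hs'.2 ?_ t ⟨hst.le, htR⟩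
        rw [hCR]; exact le_abs_self _
      · refine aux_comp b M hb hM h (fun r => -ψ r) (fun r => -deriv ψ r)
          (fun r => -deriv (deriv ψ) r) hbd
          (fun r hr => (hd1 r hr).hasDerivAt.fun_neg) (fun r hr => (hd2 r hr).hasDerivAt.fun_neg)
          (fun r hr => by rw [hb2]; linarith [hode r hr])
          R s C ε hs0 hR1 hMR hMb hC hε (by linarith [hs'.1]) ?_ t ⟨hst.le, htR⟩
        rw [hCR]; exact neg_le_abs _
    refine hle.trans ?_
    have hp : 0 < t ^ b := Real.rpow_pos_of_pos ht b
    have : 0 ≤ M * t ^ 2 := by positivity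
    exact mul_le_mul_of_nonneg_left (by nlinarith) hC
  obtain ⟨K, hK⟩ := isCompact_Icc.exists_bound_of_continuousOn
    (hcont.mono (fun x (hx : x ∈ Icc R 1) => ⟨hR0.trans_le hx.1, hx.2⟩))
  have hK0 : 0 ≤ K := (norm_nonneg _).trans (hK R ⟨le_rfl, hR1.le⟩)
  have hRb : 0 < R ^ b := Real.rpow_pos_of_pos hR0 b
  obtain ⟨D, hD, hmain⟩ : ∃ C : ℝ, 0 < C ∧ ∀ t ∈ Ioo (0 : ℝ) 1, |ψ t| ≤ C * t ^ b := by
    refine ⟨C + K / R ^ b + 1, by positivity, fun t ht => ?_⟩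
    have hp : 0 < t ^ b := Real.rpow_pos_of_pos ht.1 b
    have hq : 0 ≤ K / R ^ b := by positivity
    rcases le_total t R with htR | htR
    · refine (hsmall t ht.1 htR).trans ?_
      gcongr
      linarith
    · have h1 : |ψ t| ≤ K := hK t ⟨htR, ht.2.le⟩
      have h2 : R ^ b ≤ t ^ b := Real.rpow_le_rpow hR0.le htR hb.le
      calc |ψ t| ≤ K := h1
        _ = K / R ^ b * R ^ b := by field_simp
        _ ≤ (C + K / R ^ b + 1) * t ^ b := by
          gcongr
          linarith
  refine ⟨⟨D, hD, hmain⟩, ⟨D, fun t ht => (hmain t ht).trans ?_⟩, ?_⟩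
  · have := Real.rpow_le_one ht.1.le ht.2.le hb.le
    nlinarith
  · have hz : Tendsto (fun t : ℝ => D * t ^ b) (nhdsWithin 0 (Ioi 0)) (nhds 0) := by
      have h1 := ((Real.continuousAt_rpow_const 0 b (Or.inr hb.le)).tendsto).const_mul D
      rw [Real.zero_rpow hb.ne', mul_zero] at h1
      exact h1.mono_left nhdsWithin_le_nhds
    refine squeeze_zero_norm' ?_ hz
    filter_upwards [Ioo_mem_nhdsGT (one_pos : (0 : ℝ) < 1)] with t ht using hmain t ht
end

section
/- Let α > 0 and 0 < λ < 2, and set δ = (4 − λ ± 2√(4 − 2λ))/λ (either choice of sign). Then the function u : ℝ² → ℝ given by u(x) = log( 8δ / (λ(δ + |x|^{2+α})²) ) satisfies: u(x) > 0 for all x in the open unit ball B₁ of ℝ², u(x) = 0 for |x| = 1, and −Δu(x) = ((2+α)/2)² · λ · |x|^α · e^{u(x)} for all x ∈ B₁, where Δ denotes the Euclidean Laplacian on ℝ² (the sum of the two second partial derivatives). -/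
open Set MeasureTheory

noncomputable section

/-- The Euclidean Laplacian on `ℝ²`: the sum of the two second partial derivatives. -/
def planeLaplacian (u : EuclideanSpace ℝ (Fin 2) → ℝ) (x : EuclideanSpace ℝ (Fin 2)) : ℝ :=
  ∑ i : Fin 2,
    deriv (deriv (fun t : ℝ => u (x + t • EuclideanSpace.single i (1 : ℝ)))) 0

/-- Algebra of `δ`. -/
lemma delta_facts (lam : ℝ) (hlam : 0 < lam ∧ lam < 2) (δ : ℝ)
    (hδ : δ = (4 - lam + 2 * Real.sqrt (4 - 2 * lam)) / lam ∨
          δ = (4 - lam - 2 * Real.sqrt (4 - 2 * lam)) / lam) :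
    0 < δ ∧ lam * (δ + 1) ^ 2 = 8 * δ := by
  obtain ⟨h0, h2⟩ := hlam
  have hs := Real.sq_sqrt (show (0 : ℝ) ≤ 4 - 2 * lam by linarith)
  have hs0 := Real.sqrt_nonneg (4 - 2 * lam)
  set s := Real.sqrt (4 - 2 * lam)
  constructor
  · rcases hδ with h | h
    · rw [h]; apply div_pos _ h0; linarith
    · rw [h]; apply div_pos _ h0; nlinarith
  · rcases hδ with h | h
    · rw [h]; field_simp; nlinarith
    · rw [h]; field_simp; nlinarith

/-- Derivative of `q^(p-1) (a+t)` at zero. -/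
lemma flux_deriv (p a b : ℝ) (hp : 1 < p) :
    HasDerivAt (fun t : ℝ => ((a + t) ^ 2 + b ^ 2) ^ (p - 1) * (a + t))
      ((a ^ 2 + b ^ 2) ^ (p - 1) + 2 * (p - 1) * a ^ 2 * (a ^ 2 + b ^ 2) ^ (p - 2)) 0 := by
  by_cases hq : a ^ 2 + b ^ 2 = 0
  · have ha : a = 0 := by nlinarith [sq_nonneg a, sq_nonneg b]
    have hb : b = 0 := by nlinarith [sq_nonneg a, sq_nonneg b]
    subst ha hb
    rw [hasDerivAt_iff_tendsto_slope_zero]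
    have hc : ContinuousAt (fun t : ℝ => ((0 + t) ^ 2 + (0:ℝ) ^ 2) ^ (p - 1)) 0 := by
      apply ContinuousAt.rpow_const
      · fun_prop
      · right; linarith
    have h1 := hc.tendsto.mono_left (nhdsWithin_le_nhds (s := {0}ᶜ))
    have h2 : (0 + (0:ℝ)) ^ 2 + (0:ℝ) ^ 2 = 0 := by norm_num
    have h3 : (0:ℝ) ^ 2 + (0:ℝ) ^ 2 = 0 := by norm_num
    simp only [h2] at h1
    rw [h3]
    have h4 : (0:ℝ) ^ (p - 1) + 2 * (p - 1) * 0 ^ 2 * (0:ℝ) ^ (p - 2) = 0 ^ (p - 1) := by ring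
    rw [h4]
    refine h1.congr' ?_
    filter_upwards [self_mem_nhdsWithin] with t ht
    have ht : t ≠ 0 := ht
    simp only [zero_add, smul_eq_mul]
    field_simp
    ring
  · have hl : HasDerivAt (fun t : ℝ => a + t) 1 0 := (hasDerivAt_id (0:ℝ)).const_add a
    have hQ : HasDerivAt (fun t : ℝ => (a + t) ^ 2 + b ^ 2) (2 * a) 0 := by
      refine HasDerivAt.congr_deriv ((hl.pow 2).add_const (b ^ 2)) ?_
      simp
    have h := (hQ.rpow_const (p := p - 1) (Or.inl (by simpa using hq))).mul hl
    refine HasDerivAt.congr_deriv h ?_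
    simp only [add_zero]
    rw [show p - 1 - 1 = p - 2 by ring]
    ring

/-- Second derivative along a coordinate line. -/
lemma line_deriv2 (C δ p a b : ℝ) (hδ : 0 < δ) (hp : 1 < p) :
    deriv (deriv (fun t : ℝ => C - 2 * Real.log (δ + ((a + t) ^ 2 + b ^ 2) ^ p))) 0 =
      -4 * p * (((a ^ 2 + b ^ 2) ^ (p - 1) + 2 * (p - 1) * a ^ 2 * (a ^ 2 + b ^ 2) ^ (p - 2))
          * (δ + (a ^ 2 + b ^ 2) ^ p)
        - 2 * p * a ^ 2 * ((a ^ 2 + b ^ 2) ^ (p - 1)) ^ 2) / (δ + (a ^ 2 + b ^ 2) ^ p) ^ 2 := by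
  have hpos : ∀ t : ℝ, 0 < δ + ((a + t) ^ 2 + b ^ 2) ^ p := fun t => by positivity
  have hW : ∀ t : ℝ, HasDerivAt (fun t : ℝ => δ + ((a + t) ^ 2 + b ^ 2) ^ p)
      (2 * p * (((a + t) ^ 2 + b ^ 2) ^ (p - 1) * (a + t))) t := by
    intro t
    have hl : HasDerivAt (fun t : ℝ => a + t) 1 t := (hasDerivAt_id t).const_add a
    have hQ : HasDerivAt (fun t : ℝ => (a + t) ^ 2 + b ^ 2) (2 * (a + t)) t := by
      refine HasDerivAt.congr_deriv ((hl.pow 2).add_const (b ^ 2)) ?_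
      simp
    refine HasDerivAt.congr_deriv ((hQ.rpow_const (p := p) (Or.inr hp.le)).const_add δ) ?_
    ring
  have h1 : deriv (fun t : ℝ => C - 2 * Real.log (δ + ((a + t) ^ 2 + b ^ 2) ^ p)) =
      fun t => -4 * p * ((((a + t) ^ 2 + b ^ 2) ^ (p - 1) * (a + t)) /
        (δ + ((a + t) ^ 2 + b ^ 2) ^ p)) := by
    funext t
    have := (((hW t).log (hpos t).ne').const_mul 2).const_sub C
    rw [this.deriv]
    ring
  rw [h1]
  have h2 := (((flux_deriv p a b hp).div (hW 0) (hpos 0).ne').const_mul (-4 * p)).deriv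
  refine h2.trans ?_
  simp only [add_zero]
  ring

/-- for `0 < λ < 2` and either choice of sign of
`δ = (4 − λ ± 2√(4 − 2λ))/λ`, the function `u(x) = log(8δ/(λ(δ+|x|^{2+α})²))` is a
positive radial solution of `−Δu = ((2+α)/2)² λ |x|^α e^u` in the unit ball,
vanishing on the boundary. -/
theorem stmt_4 (α : ℝ) (hα : 0 < α) (lam : ℝ) (hlam : 0 < lam ∧ lam < 2) (δ : ℝ)
    (hδ : δ = (4 - lam + 2 * Real.sqrt (4 - 2 * lam)) / lam ∨
          δ = (4 - lam - 2 * Real.sqrt (4 - 2 * lam)) / lam)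
    (u : EuclideanSpace ℝ (Fin 2) → ℝ)
    (hu : ∀ x, u x = Real.log (8 * δ / (lam * (δ + ‖x‖ ^ (2 + α)) ^ 2))) :
    (∀ x ∈ Metric.ball (0 : EuclideanSpace ℝ (Fin 2)) 1, 0 < u x) ∧
    (∀ x : EuclideanSpace ℝ (Fin 2), ‖x‖ = 1 → u x = 0) ∧
    (∀ x ∈ Metric.ball (0 : EuclideanSpace ℝ (Fin 2)) 1,
      -planeLaplacian u x = ((2 + α) / 2) ^ 2 * lam * ‖x‖ ^ α * Real.exp (u x)) := by
  obtain ⟨hδ0, hδ1⟩ := delta_facts lam hlam δ hδ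
  obtain ⟨h0, h2⟩ := hlam
  refine ⟨?_, ?_, ?_⟩
  · intro x hx
    have hx1 : ‖x‖ < 1 := by simpa using hx
    have hr : ‖x‖ ^ (2 + α) < 1 := Real.rpow_lt_one (norm_nonneg x) hx1 (by linarith)
    have hr0 : 0 ≤ ‖x‖ ^ (2 + α) := by positivity
    rw [hu]
    apply Real.log_pos
    rw [lt_div_iff₀ (by positivity), one_mul, ← hδ1]
    gcongr
  · intro x hx
    rw [hu, hx, Real.one_rpow, hδ1, div_self (by positivity), Real.log_one]
  · intro x _
    set p : ℝ := 1 + α / 2 with hp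
    have hp1 : 1 < p := by linarith
    have hn : ∀ y : EuclideanSpace ℝ (Fin 2), ‖y‖ ^ (2 + α) = (y 0 ^ 2 + y 1 ^ 2) ^ p := by
      intro y
      have : y 0 ^ 2 + y 1 ^ 2 = ‖y‖ ^ (2:ℝ) := by
        rw [Real.rpow_two, EuclideanSpace.real_norm_sq_eq, Fin.sum_univ_two]
      rw [this, ← Real.rpow_mul (norm_nonneg y)]
      congr 1
      rw [hp]; ring
    have hna : ‖x‖ ^ α = (x 0 ^ 2 + x 1 ^ 2) ^ (p - 1) := by
      have : x 0 ^ 2 + x 1 ^ 2 = ‖x‖ ^ (2:ℝ) := by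
        rw [Real.rpow_two, EuclideanSpace.real_norm_sq_eq, Fin.sum_univ_two]
      rw [this, ← Real.rpow_mul (norm_nonneg x)]
      congr 1
      rw [hp]; ring
    have hu' : ∀ y, u y = Real.log (8 * δ / lam) -
        2 * Real.log (δ + (y 0 ^ 2 + y 1 ^ 2) ^ p) := by
      intro y
      have hy : 0 < δ + (y 0 ^ 2 + y 1 ^ 2) ^ p := by positivity
      rw [hu, hn, ← div_div, Real.log_div (by positivity) (by positivity), Real.log_pow]
      norm_num
    have e0 : (fun t : ℝ => u (x + t • EuclideanSpace.single 0 (1 : ℝ))) =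
        fun t => Real.log (8 * δ / lam) -
          2 * Real.log (δ + ((x 0 + t) ^ 2 + x 1 ^ 2) ^ p) := by
      funext t
      rw [hu']
      simp
    have e1 : (fun t : ℝ => u (x + t • EuclideanSpace.single 1 (1 : ℝ))) =
        fun t => Real.log (8 * δ / lam) -
          2 * Real.log (δ + ((x 1 + t) ^ 2 + x 0 ^ 2) ^ p) := by
      funext t
      rw [hu']
      simp [add_comm]
    have hexp : Real.exp (u x) = 8 * δ / (lam * (δ + (x 0 ^ 2 + x 1 ^ 2) ^ p) ^ 2) := by
      rw [hu, hn, Real.exp_log (by positivity)]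
    rw [hexp, hna, planeLaplacian, Fin.sum_univ_two, e0, e1, line_deriv2 _ _ _ _ _ hδ0 hp1,
      line_deriv2 _ _ _ _ _ hδ0 hp1, add_comm (x 1 ^ 2) (x 0 ^ 2),
      show (2 + α) / 2 = p by rw [hp]; ring]
    have hW : 0 < δ + (x 0 ^ 2 + x 1 ^ 2) ^ p := by positivity
    have hQ0 : 0 ≤ x 0 ^ 2 + x 1 ^ 2 := by positivity
    generalize x 0 = a at *
    generalize x 1 = b at *
    have hm : (a ^ 2 + b ^ 2) ^ p = (a ^ 2 + b ^ 2) ^ (p - 1) * (a ^ 2 + b ^ 2) := by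
      rw [← Real.rpow_add_one' hQ0 (by linarith)]; congr 1; ring
    have hR : (a ^ 2 + b ^ 2) ^ (p - 1) = (a ^ 2 + b ^ 2) ^ (p - 2) * (a ^ 2 + b ^ 2) := by
      rw [← Real.rpow_add_one' hQ0 (by linarith)]; congr 1; ring
    generalize (a ^ 2 + b ^ 2) ^ p = P at *
    generalize (a ^ 2 + b ^ 2) ^ (p - 1) = m at *
    generalize (a ^ 2 + b ^ 2) ^ (p - 2) = R at *
    clear hp
    field_simp
    rw [hm, hR]
    ring

end
end

section
/- Let λ > 0 and suppose v : [0,1] → ℝ is continuous, continuously differentiable on [0,1) with v'(0) = 0, twice differentiable on (0,1), and satisfies −v''(r) − (1/r)v'(r) = λ·e^{v(r)} for all r ∈ (0,1), v(r) > 0 for r ∈ [0,1), and v(1) = 0. Then λ ≤ 2. Moreover: if λ < 2 then v(r) = log( 8δ / (λ(δ + r²)²) ) where δ equals either (4 − λ + 2√(4 − 2λ))/λ or (4 − λ − 2√(4 − 2λ))/λ; and if λ = 2 then v(r) = log( 4/(1 + r²)² ). -/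
open Set

theorem const_aux (f : ℝ → ℝ) (a b : ℝ) (hab : a ≤ b) (hc : ContinuousOn f (Icc a b))
    (hd : ∀ x ∈ Ioo a b, HasDerivAt f 0 x) : f b = f a := by
  rcases hab.eq_or_lt with h | h
  · rw [h]
  · obtain ⟨c, _, h2⟩ := exists_hasDerivAt_eq_slope f (fun _ => 0) h hc hd
    have : b - a ≠ 0 := by linarith
    field_simp at h2
    linarith


/-- classification of positive radial solutions of the Gelfand problem
`−v'' − v'/r = λ e^v` on `(0,1)` with `v > 0` on `[0,1)`, `v(1) = 0`, `v'(0) = 0`: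
necessarily `λ ≤ 2`; if `λ < 2` then `v = log(8δ/(λ(δ+r²)²))` with
`δ = (4 − λ ± 2√(4 − 2λ))/λ`, and if `λ = 2` then `v = log(4/(1+r²)²)`. -/
theorem stmt_5 (lam : ℝ) (hlam : 0 < lam) (v : ℝ → ℝ)
    (hcont : ContinuousOn v (Icc 0 1))
    (hd1 : ∀ r ∈ Ico (0 : ℝ) 1, DifferentiableAt ℝ v r)
    (hc1 : ContinuousOn (deriv v) (Ico 0 1))
    (hd0 : deriv v 0 = 0)
    (hd2 : ∀ r ∈ Ioo (0 : ℝ) 1, DifferentiableAt ℝ (deriv v) r)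
    (hode : ∀ r ∈ Ioo (0 : ℝ) 1,
      -deriv (deriv v) r - (1 / r) * deriv v r = lam * Real.exp (v r))
    (hpos : ∀ r ∈ Ico (0 : ℝ) 1, 0 < v r)
    (hbc : v 1 = 0) :
    lam ≤ 2 ∧
    (lam < 2 → ∃ δ : ℝ,
      (δ = (4 - lam + 2 * Real.sqrt (4 - 2 * lam)) / lam ∨
       δ = (4 - lam - 2 * Real.sqrt (4 - 2 * lam)) / lam) ∧
      ∀ r ∈ Icc (0 : ℝ) 1, v r = Real.log (8 * δ / (lam * (δ + r ^ 2) ^ 2))) ∧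
    (lam = 2 → ∀ r ∈ Icc (0 : ℝ) 1, v r = Real.log (4 / (1 + r ^ 2) ^ 2)) := by
  have hv : ∀ r ∈ Ico (0 : ℝ) 1, HasDerivAt v (deriv v r) r := fun r hr => (hd1 r hr).hasDerivAt
  have hv2 : ∀ r ∈ Ioo (0 : ℝ) 1,
      HasDerivAt (deriv v) (- deriv v r / r - lam * Real.exp (v r)) r := by
    intro r hr
    have h := (hd2 r hr).hasDerivAt
    have e := hode r hr
    have : deriv (deriv v) r = - deriv v r / r - lam * Real.exp (v r) := by
      rw [← e]; ring
    rwa [this] at h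
  -- first integral
  have hE : ∀ r ∈ Ico (0 : ℝ) 1,
      (r * deriv v r) ^ 2 + 4 * (r * deriv v r) + 2 * lam * (r ^ 2 * Real.exp (v r)) = 0 := by
    intro r hr
    have h := const_aux (fun r => (r * deriv v r) ^ 2 + 4 * (r * deriv v r)
        + 2 * lam * (r ^ 2 * Real.exp (v r))) 0 r hr.1 ?_ ?_
    · simpa using h
    · have h1 : ContinuousOn (deriv v) (Icc 0 r) :=
        hc1.mono fun x hx => ⟨hx.1, hx.2.trans_lt hr.2⟩
      have h2 : ContinuousOn v (Icc 0 r) :=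
        hcont.mono fun x hx => ⟨hx.1, hx.2.trans hr.2.le⟩
      fun_prop
    · intro x hx
      have hx0 : x ≠ 0 := hx.1.ne'
      have hx1 : x < 1 := hx.2.trans hr.2
      have a1 := (hasDerivAt_id x).mul (hv2 x ⟨hx.1, hx1⟩)
      have a2 := ((hasDerivAt_id x).pow 2).mul (hv x ⟨hx.1.le, hx1⟩).exp
      have a3 := ((a1.pow 2).add (a1.const_mul 4)).add (a2.const_mul (2 * lam))
      refine HasDerivAt.congr_deriv a3 ?_
      simp
      field_simp
      ring
  have hy : ∀ r ∈ Ico (0 : ℝ) 1, HasDerivAt (fun r => Real.exp (- v r / 2))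
      (Real.exp (- v r / 2) * (- deriv v r / 2)) r := by
    intro r hr
    exact ((hv r hr).neg.div_const 2).exp
  have hPd : ∀ r ∈ Ioo (0 : ℝ) 1,
      HasDerivAt (fun r => Real.exp (- v r / 2) * (- deriv v r / 2) / r) 0 r := by
    intro x hx
    have hx0 : x ≠ 0 := hx.1.ne'
    have e := hE x ⟨hx.1.le, hx.2⟩
    have a := ((hy x ⟨hx.1.le, hx.2⟩).mul ((hv2 x hx).neg.div_const 2)).div (hasDerivAt_id x) hx0
    refine HasDerivAt.congr_deriv a ?_
    simp only [Pi.neg_apply, Pi.mul_apply, id]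
    have e2 : x * deriv v x ^ 2 + 4 * deriv v x + 2 * lam * (x * Real.exp (v x)) = 0 := by
      apply mul_left_cancel₀ hx0
      linear_combination e
    generalize Real.exp (- v x / 2) = Y
    field_simp
    linear_combination Y * e2
  have hPab : ∀ a b : ℝ, 0 < a → a ≤ b → b < 1 →
      Real.exp (- v b / 2) * (- deriv v b / 2) / b
        = Real.exp (- v a / 2) * (- deriv v a / 2) / a := by
    intro a b ha hab hb
    refine const_aux (fun r => Real.exp (- v r / 2) * (- deriv v r / 2) / r) a b hab ?_ ?_
    · intro x hx
      exact (hPd x ⟨ha.trans_le hx.1, hx.2.trans_lt hb⟩).continuousAt.continuousWithinAt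
    · intro x hx
      exact hPd x ⟨ha.trans hx.1, hx.2.trans hb⟩
  obtain ⟨C, hC⟩ : ∃ C : ℝ, ∀ r ∈ Ioo (0 : ℝ) 1,
      Real.exp (- v r / 2) * (- deriv v r / 2) = 2 * C * r := by
    refine ⟨Real.exp (- v (1/2) / 2) * (- deriv v (1/2) / 2) / (1/2) / 2, fun r hr => ?_⟩
    have hr0 : r ≠ 0 := hr.1.ne'
    have key : Real.exp (- v r / 2) * (- deriv v r / 2) / r
        = Real.exp (- v (1/2) / 2) * (- deriv v (1/2) / 2) / (1/2) := by
      rcases le_total r (1/2) with h | h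
      · exact (hPab r (1/2) hr.1 h (by norm_num)).symm
      · exact hPab (1/2) r (by norm_num) h hr.2
    rw [← key]
    field_simp
  have hyr : ∀ r ∈ Icc (0 : ℝ) 1,
      Real.exp (- v r / 2) = Real.exp (- v 0 / 2) + C * r ^ 2 := by
    intro r hr
    have h := const_aux (fun r => Real.exp (- v r / 2) - C * r ^ 2) 0 r hr.1 ?_ ?_
    · simp at h
      linarith
    · have h2 : ContinuousOn v (Icc 0 r) :=
        hcont.mono fun x hx => ⟨hx.1, hx.2.trans hr.2⟩
      fun_prop
    · intro x hx
      have hx1 : x < 1 := hx.2.trans_le hr.2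
      have a := (hy x ⟨hx.1.le, hx1⟩).sub ((hasDerivAt_pow 2 x).const_mul C)
      refine HasDerivAt.congr_deriv a ?_
      rw [hC x ⟨hx.1, hx1⟩]
      simp
      ring
  obtain ⟨A, hA⟩ : ∃ A, A = Real.exp (- v 0 / 2) := ⟨_, rfl⟩
  have hA0 : 0 < A := hA ▸ Real.exp_pos _
  rw [← hA] at hyr
  have hAC : A + C = 1 := by
    have := hyr 1 (by simp)
    simp [hbc] at this
    linarith
  have hl : lam = 8 * A * C := by
    have e := hE (1/2) (by norm_num)
    have c := hC (1/2) (by norm_num)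
    have y := hyr (1/2) (by norm_num)
    have hexp : Real.exp (v (1/2)) * Real.exp (- v (1/2) / 2) ^ 2 = 1 := by
      rw [← Real.exp_nat_mul, ← Real.exp_add, Real.exp_eq_one_iff]
      push_cast; ring
    generalize Real.exp (- v (1/2) / 2) = Y at *
    generalize Real.exp (v (1/2)) = X at *
    generalize deriv v (1/2) = d at *
    have hYd : Y * d = - 2 * C := by linarith
    have h3 : (Y * d) ^ 2 / 4 + 2 * Y * (Y * d) + lam / 2 * (X * Y ^ 2) = 0 := by
      linear_combination Y ^ 2 * e
    rw [hYd, hexp, y] at h3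
    linarith
  have hC0 : 0 < C := by
    rw [hl] at hlam
    exact pos_of_mul_pos_right hlam (by positivity)
  have hvlog : ∀ r ∈ Icc (0 : ℝ) 1, v r = Real.log (1 / (A + C * r ^ 2) ^ 2) := by
    intro r hr
    rw [← hyr r hr, ← Real.exp_nat_mul, one_div, ← Real.exp_neg, Real.log_exp]
    push_cast; ring
  have hCA : C = 1 - A := by linarith
  refine ⟨?_, fun hlt => ⟨A / C, ?_, ?_⟩, ?_⟩
  · rw [hl, hCA]; nlinarith [sq_nonneg (2 * A - 1)]
  · have hs : Real.sqrt (4 - 2 * lam) = 2 * |A - C| := by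
      have : 4 - 2 * lam = (2 * (A - C)) ^ 2 := by rw [hl, hCA]; ring
      rw [this, Real.sqrt_sq_eq_abs, abs_mul]; simp
    rw [hs, hl]
    rcases le_total C A with h | h
    · left
      rw [abs_of_nonneg (by linarith)]
      field_simp
      rw [hCA]; ring
    · right
      rw [abs_of_nonpos (by linarith)]
      field_simp
      rw [hCA]; ring
  · intro r hr
    rw [hvlog r hr, hl]
    congr 1
    have : 0 < A + C * r ^ 2 := by positivity
    have : 0 < A / C + r ^ 2 := by positivity
    have e : A / C + r ^ 2 = (A + C * r ^ 2) / C := by field_simp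
    rw [e]
    field_simp
  · intro h2 r hr
    have hA2 : A = 1 / 2 := by
      rw [hl, hCA] at h2
      have : (2 * A - 1) ^ 2 = 0 := by linarith
      have := pow_eq_zero_iff (two_ne_zero) |>.1 this
      linarith
    have hC2 : C = 1 / 2 := by linarith
    rw [hvlog r hr, hA2, hC2]
    congr 1
    have : 0 < 1 + r ^ 2 := by positivity
    field_simp
    ring
end

section
/- Let 0 < λ < 2 and set δ_λ = (4 − λ − 2√(4 − 2λ))/λ. For a smooth, compactly supported, not identically zero function η on the open interval (0,1), define Q(η) = ( ∫₀¹ r·η'(r)² dr − ∫₀¹ r·(8δ_λ/(δ_λ + r²)²)·η(r)² dr ) / ( ∫₀¹ η(r)²/r dr ). Then the infimum of Q(η) over all such η equals (λ − 2)/2. -/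
open Set MeasureTheory Filter Topology

namespace Gelf

/-- logarithmic derivative (times `r`) of the ground state -/
noncomputable def w (δ κ r : ℝ) : ℝ := κ - 2 * (1 + δ) * r ^ 2 / ((r ^ 2 + δ) * (1 - r ^ 2))

/-- ground state -/
noncomputable def phi (δ κ r : ℝ) : ℝ := r ^ κ * ((1 - r ^ 2) / (r ^ 2 + δ))

/-- cut-off -/
noncomputable def psi (n : ℕ) (r : ℝ) : ℝ := Real.smoothTransition (n * (r * (1 - r)) - 1)

lemma supp_aux {K : Set ℝ} (hK : IsCompact K) (hKs : K ⊆ Ioo 0 1) {f : ℝ → ℝ}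
    (hf : ContinuousOn f (Ioo 0 1)) (h0 : ∀ x, x ∉ K → f x = 0) :
    Continuous f ∧ HasCompactSupport f ∧ Integrable f ∧
      ∫ x in Ioo (0 : ℝ) 1, f x = ∫ x, f x := by
  have ht : tsupport f ⊆ K := closure_minimal (fun x hx => by
    by_contra h
    exact hx (h0 x h)) hK.isClosed
  have hc : Continuous f := hf.continuous_of_tsupport_subset isOpen_Ioo (ht.trans hKs)
  have hs : HasCompactSupport f := HasCompactSupport.intro hK h0
  exact ⟨hc, hs, hc.integrable_of_hasCompactSupport hs,
    setIntegral_eq_integral_of_forall_compl_eq_zero fun x hx => h0 x fun h => hx (hKs h)⟩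

lemma w_deriv {δ κ r : ℝ} (hδ : 0 < δ) (hκ : κ * (1 + δ) = 1 - δ) (hr : r ∈ Ioo (0 : ℝ) 1) :
    HasDerivAt (w δ κ)
      (-(r * (8 * δ / (δ + r ^ 2) ^ 2)) + κ ^ 2 / r - (w δ κ r) ^ 2 / r) r := by
  obtain ⟨h0, h1⟩ := hr
  have a : r ^ 2 + δ ≠ 0 := by positivity
  have a' : δ + r ^ 2 ≠ 0 := by positivity
  have b : 1 - r ^ 2 ≠ 0 := by nlinarith
  have c : 1 + δ ≠ 0 := by positivity
  have hk : κ = (1 - δ) / (1 + δ) := by field_simp; linarith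
  have hsq : HasDerivAt (fun x : ℝ => x ^ 2) (2 * r) r := by simpa using hasDerivAt_pow 2 r
  have h := ((hsq.const_mul (2 * (1 + δ))).div
    ((hsq.add_const δ).mul (hsq.const_sub 1)) (mul_ne_zero a b)).const_sub κ
  refine h.congr_deriv ?_
  simp only [w, Pi.mul_apply]
  subst hk
  have : r ≠ 0 := h0.ne'
  field_simp
  ring

lemma phi_deriv {δ κ r : ℝ} (hδ : 0 < δ) (hr : r ∈ Ioo (0 : ℝ) 1) :
    HasDerivAt (phi δ κ) (w δ κ r / r * phi δ κ r) r := by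
  obtain ⟨h0, h1⟩ := hr
  have a : r ^ 2 + δ ≠ 0 := by positivity
  have b : 1 - r ^ 2 ≠ 0 := by nlinarith
  have hsq : HasDerivAt (fun x : ℝ => x ^ 2) (2 * r) r := by simpa using hasDerivAt_pow 2 r
  have h := (Real.hasDerivAt_rpow_const (p := κ) (Or.inl h0.ne')).mul
    ((hsq.const_sub 1).div (hsq.add_const δ) a)
  refine h.congr_deriv ?_
  simp only [w, phi, Pi.div_apply]
  rw [Real.rpow_sub_one h0.ne']
  have : r ≠ 0 := h0.ne'
  field_simp
  ring

lemma w_cont {δ κ : ℝ} (hδ : 0 < δ) : ContinuousOn (w δ κ) (Ioo 0 1) := by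
  unfold w
  refine ContinuousOn.sub (by fun_prop) (ContinuousOn.div (by fun_prop) (by fun_prop) ?_)
  intro r hr
  have a : r ^ 2 + δ ≠ 0 := by positivity
  have b : 1 - r ^ 2 ≠ 0 := by nlinarith [hr.1, hr.2]
  exact mul_ne_zero a b

lemma ident {δ κ : ℝ} (hδ : 0 < δ) (hκ : κ * (1 + δ) = 1 - δ) {η : ℝ → ℝ}
    (h1 : ContDiff ℝ (⊤ : ℕ∞) η) (h2 : HasCompactSupport η) (h3 : tsupport η ⊆ Ioo 0 1) :
    IntegrableOn (fun r => r * (deriv η r - w δ κ r / r * η r) ^ 2) (Ioo 0 1) ∧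
    IntegrableOn (fun r => (η r) ^ 2 / r) (Ioo 0 1) ∧
    (∫ r in Ioo (0 : ℝ) 1, r * (deriv η r) ^ 2) -
      (∫ r in Ioo (0 : ℝ) 1, r * (8 * δ / (δ + r ^ 2) ^ 2) * (η r) ^ 2) =
    (∫ r in Ioo (0 : ℝ) 1, r * (deriv η r - w δ κ r / r * η r) ^ 2) -
      κ ^ 2 * ∫ r in Ioo (0 : ℝ) 1, (η r) ^ 2 / r := by
  have e0 : ∀ x, x ∉ tsupport η → η x = 0 := fun x hx => image_eq_zero_of_notMem_tsupport hx
  have e1 : ∀ x, x ∉ tsupport η → deriv η x = 0 := fun x hx =>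
    image_eq_zero_of_notMem_tsupport (fun h => hx (tsupport_deriv_subset h))
  have cη : Continuous η := h1.continuous
  have cη' : Continuous (deriv η) := h1.continuous_deriv (by simp)
  have cw := w_cont (κ := κ) hδ
  have hr0 : ∀ r ∈ Ioo (0 : ℝ) 1, r ≠ 0 := fun r hr => hr.1.ne'
  have hd0 : ∀ r ∈ Ioo (0 : ℝ) 1, (δ + r ^ 2) ^ 2 ≠ 0 := fun r hr => by positivity
  obtain ⟨-, -, iA, -⟩ := supp_aux h2 h3 (f := fun r => r * (deriv η r) ^ 2) (by fun_prop)
    (fun x hx => by simp [e1 x hx])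
  obtain ⟨-, -, iB, -⟩ := supp_aux h2 h3
    (f := fun r => r * (8 * δ / (δ + r ^ 2) ^ 2) * (η r) ^ 2)
    (ContinuousOn.mul (ContinuousOn.mul (by fun_prop)
      (ContinuousOn.div (by fun_prop) (by fun_prop) hd0)) (by fun_prop))
    (fun x hx => by simp [e0 x hx])
  obtain ⟨-, -, iC, -⟩ := supp_aux h2 h3
    (f := fun r => r * (deriv η r - w δ κ r / r * η r) ^ 2)
    (ContinuousOn.mul (by fun_prop) (ContinuousOn.pow (ContinuousOn.sub (by fun_prop)
      (ContinuousOn.mul (cw.div (by fun_prop) hr0) (by fun_prop))) 2))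
    (fun x hx => by simp [e0 x hx, e1 x hx])
  obtain ⟨-, -, iD, -⟩ := supp_aux h2 h3
    (f := fun r => (η r) ^ 2 / r) (ContinuousOn.div (by fun_prop) (by fun_prop) hr0)
    (fun x hx => by simp [e0 x hx])
  obtain ⟨-, -, iE, -⟩ := supp_aux h2 h3
    (f := fun r => w δ κ r * (η r) ^ 2) (cw.mul (by fun_prop))
    (fun x hx => by simp [e0 x hx])
  set G : ℝ → ℝ := fun r => r * (deriv η r) ^ 2 - r * (8 * δ / (δ + r ^ 2) ^ 2) * (η r) ^ 2
    - r * (deriv η r - w δ κ r / r * η r) ^ 2 + κ ^ 2 * ((η r) ^ 2 / r) with hG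
  have iG : Integrable G := ((iA.sub iB).sub iC).add (iD.const_mul _)
  have hder : ∀ x, HasDerivAt (fun r => w δ κ r * (η r) ^ 2) (G x) x := by
    intro x
    by_cases hx : x ∈ tsupport η
    · have hx' := h3 hx
      have hη : HasDerivAt η (deriv η x) x :=
        ((h1.differentiable (by simp)) x).hasDerivAt
      refine ((w_deriv hδ hκ hx').mul (hη.pow 2)).congr_deriv ?_
      have : x ≠ 0 := hr0 x hx'
      have := hd0 x hx'
      simp only [hG, Pi.pow_apply]
      generalize w δ κ x = W
      field_simp
      push_cast
      ring
    · have : G x = 0 := by simp [hG, e0 x hx, e1 x hx]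
      rw [this]
      refine (hasDerivAt_const x (0 : ℝ)).congr_of_eventuallyEq ?_
      filter_upwards [notMem_tsupport_iff_eventuallyEq.mp hx] with y hy
      simp [hy]
  have hz := integral_eq_zero_of_hasDerivAt_of_integrable hder iG iE
  have hz' : ∫ r in Ioo (0 : ℝ) 1, G r = 0 := by
    refine Eq.trans (setIntegral_eq_integral_of_forall_compl_eq_zero fun x hx => ?_) hz
    have hx' : x ∉ tsupport η := fun h => hx (h3 h)
    simp [hG, e0 x hx', e1 x hx']
  refine ⟨iC.integrableOn, iD.integrableOn, ?_⟩
  have s : ∫ r in Ioo (0 : ℝ) 1, G r = (∫ r in Ioo (0 : ℝ) 1, r * (deriv η r) ^ 2) -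
      (∫ r in Ioo (0 : ℝ) 1, r * (8 * δ / (δ + r ^ 2) ^ 2) * (η r) ^ 2) -
      (∫ r in Ioo (0 : ℝ) 1, r * (deriv η r - w δ κ r / r * η r) ^ 2) +
      κ ^ 2 * ∫ r in Ioo (0 : ℝ) 1, (η r) ^ 2 / r := by
    have hAB := integral_sub iA.integrableOn iB.integrableOn (μ := volume.restrict (Ioo (0 : ℝ) 1))
    have hABC := integral_sub (iA.sub iB).integrableOn iC.integrableOn
      (μ := volume.restrict (Ioo (0 : ℝ) 1))
    have hABCD := integral_add ((iA.sub iB).sub iC).integrableOn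
      (iD.const_mul (κ ^ 2)).integrableOn (μ := volume.restrict (Ioo (0 : ℝ) 1))
    have hD := integral_const_mul (μ := volume.restrict (Ioo (0 : ℝ) 1)) (κ ^ 2)
      (fun r => (η r) ^ 2 / r)
    simp only [Pi.sub_apply] at hAB hABC hABCD hD
    rw [← hD, ← hAB, ← hABC, ← hABCD]
  rw [s] at hz'
  linarith

lemma denom_pos {η : ℝ → ℝ}
    (h1 : ContDiff ℝ (⊤ : ℕ∞) η) (h2 : HasCompactSupport η) (h3 : tsupport η ⊆ Ioo 0 1)
    (h4 : η ≠ 0) : 0 < ∫ r in Ioo (0 : ℝ) 1, (η r) ^ 2 / r := by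
  have e0 : ∀ x, x ∉ tsupport η → η x = 0 := fun x hx => image_eq_zero_of_notMem_tsupport hx
  have cη : Continuous η := h1.continuous
  have hr0 : ∀ r ∈ Ioo (0 : ℝ) 1, r ≠ 0 := fun r hr => hr.1.ne'
  obtain ⟨c, s, -, e⟩ := supp_aux h2 h3
    (f := fun r => (η r) ^ 2 / r) (ContinuousOn.div (by fun_prop) (by fun_prop) hr0)
    (fun x hx => by simp [e0 x hx])
  rw [e]
  obtain ⟨x, hx⟩ := Function.ne_iff.mp h4
  have hx' : x ∈ Ioo (0 : ℝ) 1 := h3 (subset_tsupport _ hx)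
  refine c.integral_pos_of_hasCompactSupport_nonneg_nonzero s (x := x) ?_ ?_
  · intro y
    by_cases hy : y ∈ tsupport η
    · have := (h3 hy).1
      simp only [Pi.zero_apply]; positivity
    · simp [e0 y hy]
  · exact div_ne_zero (pow_ne_zero 2 hx) (hr0 x hx')

lemma psi_zero {n : ℕ} {r : ℝ} (h : n * (r * (1 - r)) ≤ 1) : psi n r = 0 :=
  Real.smoothTransition.zero_of_nonpos (by linarith)

lemma psi_contDiff (n : ℕ) : ContDiff ℝ (⊤ : ℕ∞) (psi n) :=
  Real.smoothTransition.contDiff.comp (by fun_prop)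

/-- test function -/
noncomputable def eta (δ κ : ℝ) (n : ℕ) (r : ℝ) : ℝ := psi n r * phi δ κ r

lemma eta_supp (δ κ : ℝ) (n : ℕ) : HasCompactSupport (eta δ κ n) ∧
    tsupport (eta δ κ n) ⊆ Ioo 0 1 := by
  have hsub : {r : ℝ | 1 ≤ n * (r * (1 - r))} ⊆ Ioo 0 1 := by
    intro r hr
    have hr : 1 ≤ n * (r * (1 - r)) := hr
    have hn : (0 : ℝ) ≤ n := Nat.cast_nonneg n
    have : 0 < r * (1 - r) := by
      by_contra h
      push Not at h
      nlinarith
    constructor <;> nlinarith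
  have hcl : IsClosed {r : ℝ | 1 ≤ n * (r * (1 - r))} :=
    isClosed_le (by fun_prop) (by fun_prop)
  have hK : IsCompact {r : ℝ | 1 ≤ n * (r * (1 - r))} :=
    isCompact_Icc.of_isClosed_subset hcl (hsub.trans Ioo_subset_Icc_self)
  have h0 : ∀ x, x ∉ {r : ℝ | 1 ≤ n * (r * (1 - r))} → eta δ κ n x = 0 := by
    intro x hx
    have hx : ¬ (1 ≤ n * (x * (1 - x))) := hx
    rw [eta, psi_zero (by linarith), zero_mul]
  refine ⟨HasCompactSupport.intro hK h0, (closure_minimal (fun x hx => ?_) hcl).trans hsub⟩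
  by_contra h
  exact hx (h0 x h)

lemma eta_contDiff {δ : ℝ} (hδ : 0 < δ) (κ : ℝ) (n : ℕ) :
    ContDiff ℝ (⊤ : ℕ∞) (eta δ κ n) := by
  rw [contDiff_iff_contDiffAt]
  intro x
  by_cases hx : x ∈ tsupport (eta δ κ n)
  · have hx' := (eta_supp δ κ n).2 hx
    refine (psi_contDiff n).contDiffAt.mul (ContDiffAt.mul ?_ ?_)
    · exact Real.contDiffAt_rpow_const_of_ne hx'.1.ne'
    · exact ContDiffAt.div (by fun_prop) (by fun_prop) (by positivity)
  · exact contDiffAt_const.congr_of_eventuallyEq (notMem_tsupport_iff_eventuallyEq.mp hx)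

lemma eta_res {δ κ r : ℝ} (hδ : 0 < δ) (n : ℕ) (hr : r ∈ Ioo (0 : ℝ) 1) :
    deriv (eta δ κ n) r - w δ κ r / r * eta δ κ n r = deriv (psi n) r * phi δ κ r := by
  have hp : HasDerivAt (psi n) (deriv (psi n) r) r :=
    (((psi_contDiff n).differentiable (by simp)) r).hasDerivAt
  have := (hp.mul (phi_deriv (κ := κ) hδ hr)).deriv
  have e : eta δ κ n = psi n * phi δ κ := rfl
  rw [e, this, Pi.mul_apply]
  ring

lemma st_deriv_bound : ∃ C : ℝ, 0 ≤ C ∧ ∀ x, |deriv Real.smoothTransition x| ≤ C := by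
  have hc : Continuous (deriv Real.smoothTransition) :=
    (Real.smoothTransition.contDiff (n := 1)).continuous_deriv (by simp)
  obtain ⟨C, hC⟩ := (isCompact_Icc (a := (0 : ℝ)) (b := 1)).exists_bound_of_continuousOn
    hc.continuousOn
  have hC0 : 0 ≤ C := (norm_nonneg _).trans (hC 0 (by simp))
  refine ⟨C, hC0, fun x => ?_⟩
  by_cases hx : x ∈ Icc (0 : ℝ) 1
  · exact hC x hx
  · rw [mem_Icc, not_and_or, not_le, not_le] at hx
    have : deriv Real.smoothTransition x = 0 := by
      rcases hx with hx | hx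
      · have : Real.smoothTransition =ᶠ[𝓝 x] fun _ => (0 : ℝ) := by
          filter_upwards [gt_mem_nhds hx] with y hy
          exact Real.smoothTransition.zero_of_nonpos hy.le
        rw [this.deriv_eq]; simp
      · have : Real.smoothTransition =ᶠ[𝓝 x] fun _ => (1 : ℝ) := by
          filter_upwards [lt_mem_nhds hx] with y hy
          exact Real.smoothTransition.one_of_one_le hy.le
        rw [this.deriv_eq]; simp
    simpa [this] using hC0

lemma psi_deriv_zero {n : ℕ} {r : ℝ} (h : 2 < n * (r * (1 - r))) : deriv (psi n) r = 0 := by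
  have hc : Continuous fun y : ℝ => (n : ℝ) * (y * (1 - y)) := by fun_prop
  have : psi n =ᶠ[𝓝 r] fun _ => (1 : ℝ) := by
    filter_upwards [hc.continuousAt.eventually (lt_mem_nhds h)] with y hy
    exact Real.smoothTransition.one_of_one_le (by linarith)
  rw [this.deriv_eq]; simp

lemma psi_deriv_bound {C : ℝ} (hC0 : 0 ≤ C)
    (hC : ∀ x, |deriv Real.smoothTransition x| ≤ C) (n : ℕ) {r : ℝ} (hr : r ∈ Ioo (0 : ℝ) 1) :
    |deriv (psi n) r| ≤ 2 * C / (r * (1 - r)) := by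
  have hp : 0 < r * (1 - r) := mul_pos hr.1 (by linarith [hr.2])
  rcases lt_or_ge 2 (n * (r * (1 - r))) with h | h
  · rw [psi_deriv_zero h, abs_zero]; positivity
  · have hs : HasDerivAt Real.smoothTransition
        (deriv Real.smoothTransition (n * (r * (1 - r)) - 1)) (n * (r * (1 - r)) - 1) :=
      (((Real.smoothTransition.contDiff (n := 1)).differentiable (by simp)) _).hasDerivAt
    have hi : HasDerivAt (fun y : ℝ => (n : ℝ) * (y * (1 - y)) - 1) (n * (1 - 2 * r)) r := by
      have := ((((hasDerivAt_id r).mul ((hasDerivAt_id r).const_sub 1)).const_mul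
        (n : ℝ)).sub_const 1)
      refine this.congr_deriv ?_
      simp only [id]; ring
    have := (hs.comp r hi).deriv
    have e : psi n = Real.smoothTransition ∘ (fun y : ℝ => (n : ℝ) * (y * (1 - y)) - 1) := rfl
    rw [e, this, abs_mul, abs_mul, le_div_iff₀ hp]
    have h1 := hC (n * (r * (1 - r)) - 1)
    have h2 : |1 - 2 * r| ≤ 1 := abs_le.mpr ⟨by linarith [hr.2], by linarith [hr.1]⟩
    have h3 : |(n : ℝ)| = n := abs_of_nonneg (Nat.cast_nonneg n)
    rw [h3]
    calc _ ≤ C * (n * 1) * (r * (1 - r)) := by gcongr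
      _ = C * (n * (r * (1 - r))) := by ring
      _ ≤ C * 2 := by gcongr
      _ = _ := by ring

lemma phi_sq {δ κ r : ℝ} (hr : r ∈ Ioo (0 : ℝ) 1) :
    (phi δ κ r) ^ 2 = r ^ (2 * κ - 1) * r * ((1 - r ^ 2) / (r ^ 2 + δ)) ^ 2 := by
  rw [phi, mul_pow, ← Real.rpow_natCast, ← Real.rpow_mul hr.1.le, Real.rpow_sub_one hr.1.ne']
  have := hr.1.ne'
  field_simp
  norm_num [mul_comm]

lemma phi_pos {δ κ r : ℝ} (hδ : 0 < δ) (hr : r ∈ Ioo (0 : ℝ) 1) : 0 < phi δ κ r := by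
  have h0 := hr.1
  have : 0 < 1 - r ^ 2 := by nlinarith [hr.1, hr.2]
  unfold phi
  positivity

lemma phi_sq_le {δ κ r : ℝ} (hδ : 0 < δ) (hr : r ∈ Ioo (0 : ℝ) 1) :
    (phi δ κ r) ^ 2 ≤ r ^ (2 * κ - 1) * r * (2 * (1 - r) / δ) ^ 2 := by
  rw [phi_sq hr]
  have h0 := hr.1
  have h1 : 0 < 1 - r := by linarith [hr.2]
  have h2 : 0 ≤ 1 - r ^ 2 := by nlinarith [hr.1, hr.2]
  gcongr
  · nlinarith
  · nlinarith

lemma rpow_int {κ : ℝ} (hκ : 0 < κ) : IntegrableOn (fun r : ℝ => r ^ (2 * κ - 1)) (Ioo 0 1) := by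
  have := intervalIntegral.intervalIntegrable_rpow' (a := 0) (b := 1) (r := 2 * κ - 1)
    (by linarith)
  rw [intervalIntegrable_iff_integrableOn_Ioo_of_le zero_le_one] at this
  exact this

lemma eventually_gt {r : ℝ} (hr : r ∈ Ioo (0 : ℝ) 1) :
    ∀ᶠ n : ℕ in atTop, 2 < n * (r * (1 - r)) := by
  have hp : 0 < r * (1 - r) := mul_pos hr.1 (by linarith [hr.2])
  exact (tendsto_natCast_atTop_atTop.atTop_mul_const hp).eventually_gt_atTop 2

lemma num_tendsto {δ κ : ℝ} (hδ : 0 < δ) (hκ0 : 0 < κ) (hκ : κ * (1 + δ) = 1 - δ) :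
    Tendsto (fun n : ℕ => ∫ r in Ioo (0 : ℝ) 1,
      r * (deriv (eta δ κ n) r - w δ κ r / r * eta δ κ n r) ^ 2) atTop (𝓝 0) := by
  obtain ⟨C, hC0, hC⟩ := st_deriv_bound
  have := tendsto_integral_of_dominated_convergence
    (μ := volume.restrict (Ioo (0 : ℝ) 1))
    (F := fun n : ℕ => fun r => r * (deriv (eta δ κ n) r - w δ κ r / r * eta δ κ n r) ^ 2)
    (f := fun _ => (0 : ℝ)) (fun r => (4 * C / δ) ^ 2 * r ^ (2 * κ - 1))
    (fun n => (ident hδ hκ (eta_contDiff hδ κ n) (eta_supp δ κ n).1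
      (eta_supp δ κ n).2).1.aestronglyMeasurable)
    ((rpow_int hκ0).const_mul _) ?_ ?_
  · simpa using this
  · intro n
    refine (ae_restrict_mem measurableSet_Ioo).mono fun r hr => ?_
    have h0 := hr.1
    have h1 : 0 < 1 - r := by linarith [hr.2]
    rw [eta_res hδ n hr, mul_pow, ← sq_abs (deriv (psi n) r), Real.norm_of_nonneg (by positivity)]
    calc _ ≤ r * ((2 * C / (r * (1 - r))) ^ 2 * (r ^ (2 * κ - 1) * r * (2 * (1 - r) / δ) ^ 2)) := by
          gcongr
          · exact psi_deriv_bound hC0 hC n hr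
          · exact phi_sq_le hδ hr
      _ = _ := by field_simp; ring
  · refine (ae_restrict_mem measurableSet_Ioo).mono fun r hr => ?_
    refine tendsto_const_nhds.congr' ?_
    filter_upwards [eventually_gt hr] with n hn
    rw [eta_res hδ n hr, psi_deriv_zero hn]
    simp

lemma den_tendsto {δ κ : ℝ} (hδ : 0 < δ) (hκ0 : 0 < κ) (hκ : κ * (1 + δ) = 1 - δ) :
    ∃ D : ℝ, 0 < D ∧ Tendsto (fun n : ℕ => ∫ r in Ioo (0 : ℝ) 1, (eta δ κ n r) ^ 2 / r)
      atTop (𝓝 D) := by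
  have hle : ∀ r ∈ Ioo (0 : ℝ) 1, (phi δ κ r) ^ 2 / r ≤ (2 / δ) ^ 2 * r ^ (2 * κ - 1) := by
    intro r hr
    have h0 := hr.1
    have h1 : 0 < 1 - r := by linarith [hr.2]
    rw [div_le_iff₀ h0]
    refine (phi_sq_le hδ hr).trans ?_
    calc _ ≤ r ^ (2 * κ - 1) * r * (2 * 1 / δ) ^ 2 := by gcongr; linarith
      _ = _ := by ring
  have hcont : ContinuousOn (fun r => (phi δ κ r) ^ 2 / r) (Ioo 0 1) := by
    intro r hr
    exact (((phi_deriv hδ hr).continuousAt.pow 2).div continuousAt_id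
      hr.1.ne').continuousWithinAt
  have hint : IntegrableOn (fun r => (phi δ κ r) ^ 2 / r) (Ioo 0 1) := by
    refine ((rpow_int hκ0).const_mul ((2 / δ) ^ 2)).mono'
      (hcont.aestronglyMeasurable measurableSet_Ioo) ?_
    refine (ae_restrict_mem measurableSet_Ioo).mono fun r hr => ?_
    have h0 := hr.1
    rw [Real.norm_of_nonneg (by positivity)]
    exact hle r hr
  refine ⟨∫ r in Ioo (0 : ℝ) 1, (phi δ κ r) ^ 2 / r, ?_, ?_⟩
  · rw [setIntegral_pos_iff_support_of_nonneg_ae _ hint]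
    · have : Ioo (0 : ℝ) 1 ⊆ (Function.support fun r => (phi δ κ r) ^ 2 / r) ∩ Ioo 0 1 := by
        intro r hr
        have h0 := hr.1
        have := phi_pos (κ := κ) hδ hr
        refine ⟨?_, hr⟩
        rw [Function.mem_support]
        positivity
      refine lt_of_lt_of_le ?_ (measure_mono this)
      simp
    · refine (ae_restrict_mem measurableSet_Ioo).mono fun r hr => ?_
      have h0 := hr.1
      simp only [Pi.zero_apply]
      positivity
  · refine tendsto_integral_of_dominated_convergence
      (fun r => (phi δ κ r) ^ 2 / r)
      (fun n => (ident hδ hκ (eta_contDiff hδ κ n) (eta_supp δ κ n).1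
        (eta_supp δ κ n).2).2.1.aestronglyMeasurable) hint ?_ ?_
    · intro n
      refine (ae_restrict_mem measurableSet_Ioo).mono fun r hr => ?_
      have h0 := hr.1
      rw [Real.norm_of_nonneg (by positivity), eta, mul_pow]
      have a := Real.smoothTransition.nonneg (n * (r * (1 - r)) - 1)
      have b := Real.smoothTransition.le_one (n * (r * (1 - r)) - 1)
      have c : psi n r ^ 2 ≤ 1 := pow_le_one₀ a b
      gcongr
      exact mul_le_of_le_one_left (by positivity) c
    · refine (ae_restrict_mem measurableSet_Ioo).mono fun r hr => ?_
      refine tendsto_const_nhds.congr' ?_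
      filter_upwards [eventually_gt hr] with n hn
      have : psi n r = 1 := Real.smoothTransition.one_of_one_le (by linarith)
      rw [eta, this, one_mul]

end Gelf

/-- the first weighted eigenvalue of the linearization at the
Morse-index-one radial solution of the Gelfand problem equals `(λ − 2)/2`:
the infimum over smooth, compactly supported, nontrivial `η` on `(0,1)` of the
Rayleigh-type quotient
`(∫₀¹ r η'² − ∫₀¹ r (8δ_λ/(δ_λ+r²)²) η²) / ∫₀¹ η²/r` is `(λ − 2)/2`. -/
theorem stmt_6 (lam : ℝ) (hlam : 0 < lam ∧ lam < 2) (δ : ℝ)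
    (hδ : δ = (4 - lam - 2 * Real.sqrt (4 - 2 * lam)) / lam) :
    IsGLB {q : ℝ | ∃ η : ℝ → ℝ, ContDiff ℝ (⊤ : ℕ∞) η ∧ HasCompactSupport η ∧
        tsupport η ⊆ Ioo 0 1 ∧ η ≠ 0 ∧
        q = ((∫ r in Ioo (0 : ℝ) 1, r * (deriv η r) ^ 2) -
             ∫ r in Ioo (0 : ℝ) 1, r * (8 * δ / (δ + r ^ 2) ^ 2) * (η r) ^ 2) /
            ∫ r in Ioo (0 : ℝ) 1, (η r) ^ 2 / r}
      ((lam - 2) / 2) := by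
  obtain ⟨hl0, hl2⟩ := hlam
  set s := Real.sqrt (4 - 2 * lam) with hs
  have hs2 : s ^ 2 = 4 - 2 * lam := Real.sq_sqrt (by linarith)
  have hs0 : 0 < s := Real.sqrt_pos.mpr (by linarith)
  have hs4 : s < 2 := by nlinarith
  have hlam' : lam = (4 - s ^ 2) / 2 := by linarith
  have hδ' : δ = (2 - s) / (2 + s) := by
    have h4 : 2 - s ≠ 0 := by linarith
    have h5 : 2 + s ≠ 0 := by linarith
    have h6 : (4 - s ^ 2) / 2 ≠ 0 := by
      rw [← hlam']
      exact hl0.ne'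
    rw [hδ, hlam', div_eq_div_iff h6 h5]
    ring
  have hδ0 : 0 < δ := by rw [hδ']; exact div_pos (by linarith) (by linarith)
  have hκ : (s / 2) * (1 + δ) = 1 - δ := by
    have h5 : 2 + s ≠ 0 := by linarith
    rw [hδ']; field_simp; ring
  have hκ0 : 0 < s / 2 := by linarith
  have hval : (lam - 2) / 2 = -(s / 2) ^ 2 := by rw [hlam']; ring
  rw [hval]
  clear_value s
  constructor
  · rintro q ⟨η, h1, h2, h3, h4, rfl⟩
    have hD := Gelf.denom_pos h1 h2 h3 h4
    rw [(Gelf.ident hδ0 hκ h1 h2 h3).2.2, le_div_iff₀ hD]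
    have : 0 ≤ ∫ r in Ioo (0 : ℝ) 1, r * (deriv η r - Gelf.w δ (s / 2) r / r * η r) ^ 2 :=
      setIntegral_nonneg measurableSet_Ioo fun r hr => mul_nonneg hr.1.le (sq_nonneg _)
    linarith
  · intro b hb
    obtain ⟨D, hD, hDt⟩ := Gelf.den_tendsto hδ0 hκ0 hκ
    have hN := Gelf.num_tendsto hδ0 hκ0 hκ
    have ht := (hN.div hDt hD.ne').sub_const ((s / 2) ^ 2)
    rw [zero_div, zero_sub] at ht
    refine ge_of_tendsto ht ?_
    filter_upwards [hDt.eventually (lt_mem_nhds hD)] with n hn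
    have h1 := Gelf.eta_contDiff hδ0 (s / 2) n
    obtain ⟨h2, h3⟩ := Gelf.eta_supp δ (s / 2) n
    refine hb ⟨Gelf.eta δ (s / 2) n, h1, h2, h3, ?_, ?_⟩
    · intro h
      rw [h] at hn
      simp at hn
    · rw [(Gelf.ident hδ0 hκ h1 h2 h3).2.2, sub_div, mul_div_cancel_right₀ _ hn.ne']
      rfl
end

section
/- Let 0 < λ < 2 and set δ_λ = (4 − λ − 2√(4 − 2λ))/λ and γ = √(4 − 2λ)/2. Then the function ψ : (0,1] → ℝ defined by ψ(r) = r^γ · ( 2(1 − r⁴) + √(4 − 2λ)·(1 − r²)² ) / ( λ(1 − r²)² + 8r² ) satisfies: ψ(r) > 0 for all r ∈ (0,1), ψ(1) = 0, ∫₀¹ ( r·ψ'(r)² + ψ(r)²/r ) dr < ∞, and −ψ''(r) − (1/r)ψ'(r) − (8δ_λ/(δ_λ + r²)²)·ψ(r) = ((λ − 2)/2)·ψ(r)/r² for all r ∈ (0,1). -/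
open Set MeasureTheory

lemma aux_d1 (δ γ c r : ℝ) (hδ : 0 < δ) (hr : 0 < r) :
    HasDerivAt (fun x : ℝ => c * (x ^ γ * ((1 - x ^ 2) / (δ + x ^ 2))))
      (c * (r ^ (γ - 1) * (γ * (1 - r ^ 2) / (δ + r ^ 2)
        - 2 * (1 + δ) * r ^ 2 / (δ + r ^ 2) ^ 2))) r := by
  have hD : δ + r ^ 2 ≠ 0 := by positivity
  have h1 := Real.hasDerivAt_rpow_const (x := r) (p := γ) (Or.inl hr.ne')
  have h2 := (((hasDerivAt_id r).pow 2).const_sub 1).div (((hasDerivAt_id r).pow 2).const_add δ) hD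
  have h := (h1.mul h2).const_mul c
  refine h.congr_deriv ?_
  have e : r ^ γ = r ^ (γ - 1) * r := by
    rw [Real.rpow_sub_one hr.ne']; field_simp
  simp only [id, e, Pi.pow_apply, Pi.div_apply]
  field_simp
  push_cast
  ring

lemma aux_d2 (δ γ c r : ℝ) (hδ : 0 < δ) (hr : 0 < r) :
    HasDerivAt (fun x : ℝ => c * (x ^ (γ - 1) * (γ * (1 - x ^ 2) / (δ + x ^ 2)
        - 2 * (1 + δ) * x ^ 2 / (δ + x ^ 2) ^ 2)))
      (c * (r ^ (γ - 1 - 1) * ((γ - 1) * (γ * (1 - r ^ 2) / (δ + r ^ 2)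
        - 2 * (1 + δ) * r ^ 2 / (δ + r ^ 2) ^ 2)
        + (- (2 * γ * (1 + δ) * r ^ 2 / (δ + r ^ 2) ^ 2)
          - 4 * (1 + δ) * r ^ 2 * (δ - r ^ 2) / (δ + r ^ 2) ^ 3)))) r := by
  have hD : δ + r ^ 2 ≠ 0 := by positivity
  have hD2 : (δ + r ^ 2) ^ 2 ≠ 0 := by positivity
  have h1 := Real.hasDerivAt_rpow_const (x := r) (p := γ - 1) (Or.inl hr.ne')
  have hs := (hasDerivAt_id r).pow 2
  have h2 := ((hs.const_sub 1).const_mul γ).div (hs.const_add δ) hD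
  have h3 := (hs.const_mul (2 * (1 + δ))).div ((hs.const_add δ).pow 2) hD2
  have h := (h1.mul (h2.sub h3)).const_mul c
  refine h.congr_deriv ?_
  have e : r ^ (γ - 1) = r ^ (γ - 1 - 1) * r := by
    rw [Real.rpow_sub_one hr.ne' (γ - 1)]; field_simp
  simp only [id, e, Pi.pow_apply, Pi.sub_apply, Pi.div_apply]
  field_simp
  push_cast
  ring

/-- the explicit function
`ψ(r) = r^γ (2(1−r⁴) + √(4−2λ)(1−r²)²)/(λ(1−r²)² + 8r²)`, with `γ = √(4−2λ)/2`,
is a positive finite-energy eigenfunction of the linearized operator at the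
Morse-index-one radial solution of the Gelfand problem, with eigenvalue `(λ−2)/2`. -/
theorem stmt_7 (lam : ℝ) (hlam : 0 < lam ∧ lam < 2) (δ γ : ℝ)
    (hδ : δ = (4 - lam - 2 * Real.sqrt (4 - 2 * lam)) / lam)
    (hγ : γ = Real.sqrt (4 - 2 * lam) / 2)
    (ψ : ℝ → ℝ)
    (hψ : ∀ r, ψ r = r ^ γ *
      (2 * (1 - r ^ 4) + Real.sqrt (4 - 2 * lam) * (1 - r ^ 2) ^ 2) /
      (lam * (1 - r ^ 2) ^ 2 + 8 * r ^ 2)) :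
    (∀ r ∈ Ioo (0 : ℝ) 1, 0 < ψ r) ∧
    ψ 1 = 0 ∧
    IntegrableOn (fun r => r * (deriv ψ r) ^ 2 + (ψ r) ^ 2 / r) (Ioo 0 1) ∧
    (∀ r ∈ Ioo (0 : ℝ) 1, DifferentiableAt ℝ ψ r ∧ DifferentiableAt ℝ (deriv ψ) r ∧
      -deriv (deriv ψ) r - (1 / r) * deriv ψ r - (8 * δ / (δ + r ^ 2) ^ 2) * ψ r
        = ((lam - 2) / 2) * ψ r / r ^ 2) := by
  obtain ⟨hl0, hl2⟩ := hlam
  obtain ⟨s, hs⟩ : ∃ s, s = Real.sqrt (4 - 2 * lam) := ⟨_, rfl⟩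
  rw [← hs] at hδ hγ
  simp only [← hs] at hψ
  have hs0 : 0 < s := by rw [hs]; exact Real.sqrt_pos.mpr (by linarith)
  have hss : s ^ 2 = 4 - 2 * lam := by rw [hs]; exact Real.sq_sqrt (by linarith)
  have hs2 : s < 2 := by nlinarith
  have hγ0 : 0 < γ := by rw [hγ]; positivity
  have hγ1 : γ < 1 := by rw [hγ]; linarith
  have hsγ : s = 2 * γ := by rw [hγ]; ring
  have hlγ : lam = 2 * (1 - γ ^ 2) := by rw [hsγ] at hss; linarith
  clear hγ hs
  subst hsγ
  have hg1 : (1 - γ) ≠ 0 := by linarith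
  have hδ' : δ = (1 - γ) / (1 + γ) := by
    rw [hδ, div_eq_div_iff hl0.ne' (by positivity), hlγ]; ring
  have hδ0 : 0 < δ := by rw [hδ']; exact div_pos (by linarith) (by linarith)
  have hform : ψ = fun x : ℝ => (1 / (1 + γ)) * (x ^ γ * ((1 - x ^ 2) / (δ + x ^ 2))) := by
    funext r
    rw [hψ r]
    have e1 : lam * (1 - r ^ 2) ^ 2 + 8 * r ^ 2
        = 2 * ((1 - γ) + (1 + γ) * r ^ 2) * ((1 + γ) + (1 - γ) * r ^ 2) := by rw [hlγ]; ring
    have e2 : δ + r ^ 2 = ((1 - γ) + (1 + γ) * r ^ 2) / (1 + γ) := by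
      rw [hδ']; field_simp
    have p0 : 0 < 1 - γ := by linarith
    have p1 : (1 - γ) + (1 + γ) * r ^ 2 ≠ 0 := by positivity
    have p2 : (1 + γ) + (1 - γ) * r ^ 2 ≠ 0 := by positivity
    rw [e1, e2]
    field_simp
    ring
  have hd1 : ∀ r : ℝ, 0 < r → HasDerivAt ψ _ r := fun r hr => by
    rw [hform]; exact aux_d1 δ γ (1 / (1 + γ)) r hδ0 hr
  have hd2 : ∀ r : ℝ, 0 < r → HasDerivAt (deriv ψ) _ r := fun r hr =>
    (aux_d2 δ γ (1 / (1 + γ)) r hδ0 hr).congr_of_eventuallyEq (by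
      filter_upwards [Ioi_mem_nhds hr] with x hx
      exact (hd1 x hx).deriv)
  refine ⟨?_, ?_, ?_, ?_⟩
  · rintro r ⟨h0, h1⟩
    rw [hform]
    have : 0 < 1 - r ^ 2 := by nlinarith
    positivity
  · rw [hform]; simp
  · have hi : IntegrableOn (fun r : ℝ => r ^ (2 * γ - 1)) (Icc 0 1) := by
      rw [integrableOn_Icc_iff_integrableOn_Ioc,
        ← intervalIntegrable_iff_integrableOn_Ioc_of_le zero_le_one]
      exact intervalIntegral.intervalIntegrable_rpow' (by linarith)
    have hc : ContinuousOn (fun r : ℝ => (1 / (1 + γ)) ^ 2 * ((γ * (1 - r ^ 2) / (δ + r ^ 2)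
        - 2 * (1 + δ) * r ^ 2 / (δ + r ^ 2) ^ 2) ^ 2 + ((1 - r ^ 2) / (δ + r ^ 2)) ^ 2))
        (Icc 0 1) := by
      apply Continuous.continuousOn
      have q1 : ∀ r : ℝ, δ + r ^ 2 ≠ 0 := fun r => by positivity
      have q2 : ∀ r : ℝ, (δ + r ^ 2) ^ 2 ≠ 0 := fun r => by positivity
      fun_prop (disch := assumption)
    have := (hi.mul_continuousOn hc isCompact_Icc).mono_set Ioo_subset_Icc_self
    refine this.congr_fun ?_ measurableSet_Ioo
    rintro r ⟨h0, h1⟩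
    have e1 : r ^ γ = r ^ (γ - 1) * r := by
      rw [Real.rpow_sub_one h0.ne']; field_simp
    have e2 : r ^ (2 * γ - 1) = (r ^ (γ - 1)) ^ 2 * r := by
      rw [← Real.rpow_natCast, ← Real.rpow_mul h0.le, ← Real.rpow_add_one h0.ne']
      congr 1; push_cast; ring
    simp only [(hd1 r h0).deriv]
    rw [hform]
    simp only [e1, e2]
    field_simp
  · rintro r ⟨h0, h1⟩
    refine ⟨(hd1 r h0).differentiableAt, (hd2 r h0).differentiableAt, ?_⟩
    rw [(hd2 r h0).deriv, (hd1 r h0).deriv, hform]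
    have e1 : r ^ (γ - 1) = r ^ (γ - 1 - 1) * r := by
      rw [Real.rpow_sub_one h0.ne' (γ - 1)]; field_simp
    have e2 : r ^ γ = r ^ (γ - 1) * r := by
      rw [Real.rpow_sub_one h0.ne']; field_simp
    simp only [e2, e1, hlγ]
    have hD : δ + r ^ 2 ≠ 0 := by positivity
    have hrel : γ = (1 - δ) / (1 + δ) := by
      rw [hδ']; field_simp; ring
    generalize r ^ (γ - 1 - 1) = X
    have h1δ : 1 + δ ≠ 0 := by positivity
    rw [hrel]
    field_simp
    ring
end

section
/- Let γ be a real number and define R : (−1,1) → ℝ by R(ξ) = ((1 + ξ)/(1 − ξ))^{γ/2} · (ξ − γ). Then R is twice differentiable on (−1,1) and satisfies the Legendre-type equation (1 − ξ²)·R''(ξ) − 2ξ·R'(ξ) + 2R(ξ) − (γ²/(1 − ξ²))·R(ξ) = 0 for all ξ ∈ (−1,1). -/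
open Set

lemma weight_hasDerivAt (γ x : ℝ) (hx : x ∈ Ioo (-1 : ℝ) 1) :
    HasDerivAt (fun ξ : ℝ => ((1 + ξ) / (1 - ξ)) ^ (γ / 2))
      (((1 + x) / (1 - x)) ^ (γ / 2) * (γ / (1 - x ^ 2))) x := by
  have h1 : 0 < 1 + x := by linarith [hx.1]
  have h2 : 0 < 1 - x := by linarith [hx.2]
  have hq : 0 < (1 + x) / (1 - x) := div_pos h1 h2
  have hd : HasDerivAt (fun ξ : ℝ => (1 + ξ) / (1 - ξ))
      ((1 * (1 - x) - (1 + x) * (-1)) / (1 - x) ^ 2) x :=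
    ((hasDerivAt_id x).const_add 1).div ((hasDerivAt_id x).const_sub 1) h2.ne'
  have h := hd.rpow_const (p := γ / 2) (Or.inl hq.ne')
  convert h using 1
  rw [Real.rpow_sub_one hq.ne']
  have h3 : 1 - x ^ 2 = (1 + x) * (1 - x) := by ring
  rw [h3]
  generalize ((1 + x) / (1 - x)) ^ (γ / 2) = w
  field_simp
  ring

/-- the function `R(ξ) = ((1+ξ)/(1−ξ))^{γ/2} (ξ − γ)` solves the
Legendre-type equation `(1−ξ²)R'' − 2ξR' + 2R − (γ²/(1−ξ²))R = 0` on `(−1,1)`. -/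
theorem stmt_8 (γ : ℝ) (R : ℝ → ℝ)
    (hR : ∀ ξ, R ξ = ((1 + ξ) / (1 - ξ)) ^ (γ / 2) * (ξ - γ)) :
    ∀ ξ ∈ Ioo (-1 : ℝ) 1, DifferentiableAt ℝ R ξ ∧ DifferentiableAt ℝ (deriv R) ξ ∧
      (1 - ξ ^ 2) * deriv (deriv R) ξ - 2 * ξ * deriv R ξ + 2 * R ξ
        - (γ ^ 2 / (1 - ξ ^ 2)) * R ξ = 0 := by
  obtain rfl : R = fun ξ => ((1 + ξ) / (1 - ξ)) ^ (γ / 2) * (ξ - γ) := funext hR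
  have hD : ∀ x ∈ Ioo (-1 : ℝ) 1, 1 - x ^ 2 ≠ 0 := by
    intro x hx
    have := mul_pos (show 0 < 1 + x by linarith [hx.1]) (show 0 < 1 - x by linarith [hx.2])
    nlinarith
  have d1 : ∀ x ∈ Ioo (-1 : ℝ) 1,
      HasDerivAt (fun ξ : ℝ => ((1 + ξ) / (1 - ξ)) ^ (γ / 2) * (ξ - γ))
        (((1 + x) / (1 - x)) ^ (γ / 2) * (γ * (x - γ) / (1 - x ^ 2) + 1)) x := by
    intro x hx
    have h : HasDerivAt (fun ξ : ℝ => ((1 + ξ) / (1 - ξ)) ^ (γ / 2) * (ξ - γ))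
        (((1 + x) / (1 - x)) ^ (γ / 2) * (γ / (1 - x ^ 2)) * (x - γ)
          + ((1 + x) / (1 - x)) ^ (γ / 2) * 1) x :=
      (weight_hasDerivAt γ x hx).mul ((hasDerivAt_id x).sub_const γ)
    refine h.congr_deriv ?_
    ring
  intro x hx
  have hx0 := hD x hx
  have hg : HasDerivAt (fun ξ : ℝ => γ * (ξ - γ) / (1 - ξ ^ 2) + 1)
      ((γ * 1 * (1 - x ^ 2) - γ * (x - γ) * (-(2 * x))) / (1 - x ^ 2) ^ 2) x := by
    have ha : HasDerivAt (fun ξ : ℝ => γ * (ξ - γ)) (γ * 1) x :=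
      ((hasDerivAt_id x).sub_const γ).const_mul γ
    have hb : HasDerivAt (fun ξ : ℝ => 1 - ξ ^ 2) (-(2 * x)) x := by
      simpa using (hasDerivAt_pow 2 x).const_sub 1
    exact (ha.div hb hx0).add_const 1
  have d2 := ((weight_hasDerivAt γ x hx).mul hg).congr_of_eventuallyEq
    (f₁ := deriv (fun ξ : ℝ => ((1 + ξ) / (1 - ξ)) ^ (γ / 2) * (ξ - γ)))
    (by filter_upwards [isOpen_Ioo.mem_nhds hx] with y hy
        exact (d1 y hy).deriv)
  refine ⟨(d1 x hx).differentiableAt, d2.differentiableAt, ?_⟩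
  rw [d2.deriv, (d1 x hx).deriv]
  beta_reduce
  generalize ((1 + x) / (1 - x)) ^ (γ / 2) = w
  field_simp
  ring
end

section
/- Let α > 0, let k ≥ 1 be an integer, let 0 < λ < 2, and set δ_λ = (4 − λ − 2√(4 − 2λ))/λ. Consider the boundary value problem: find w : [0,1] → ℝ continuous, twice differentiable on (0,1), not identically zero, with w(0) = 0 = w(1), ∫₀¹ ( r·w'(r)² + w(r)²/r ) dr < ∞, and −w''(r) − (1/r)w'(r) + (k²/r²)w(r) = ((2+α)/2)² · r^α · (8δ_λ/(δ_λ + r^{2+α})²) · w(r) for all r ∈ (0,1). Then this problem admits a solution if and only if (2 + α)²·(2 − λ) = 8k². -/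
open Set MeasureTheory

/-- the profile `(δ - r^β)/(δ + r^β)` -/
noncomputable def auxT (β δ r : ℝ) : ℝ := (δ - r ^ β) / (δ + r ^ β)

/-- explicit solution of the mode equation -/
noncomputable def auxg (β δ b : ℝ) (n : ℤ) (r : ℝ) : ℝ := r ^ n * (b + auxT β δ r)

/-- `r` times the derivative of `auxg` -/
noncomputable def auxG (β δ b : ℝ) (n : ℤ) (r : ℝ) : ℝ :=
  r ^ n * (n * (b + auxT β δ r) - β * (1 - auxT β δ r ^ 2) / 2)

lemma auxT_deriv {β δ r : ℝ} (hδ : 0 < δ) (hr : 0 < r) :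
    HasDerivAt (auxT β δ) (-(β * (1 - auxT β δ r ^ 2) / 2) / r) r := by
  have hs : 0 < r ^ β := Real.rpow_pos_of_pos hr β
  have h1 : HasDerivAt (fun x : ℝ => x ^ β) (β * r ^ (β - 1)) r :=
    Real.hasDerivAt_rpow_const (Or.inl hr.ne')
  rw [Real.rpow_sub_one hr.ne'] at h1
  have h2 := (h1.const_sub δ).div (h1.const_add δ) (by positivity)
  refine h2.congr_deriv ?_
  unfold auxT
  field_simp
  ring

lemma auxpow_deriv {r : ℝ} (n : ℤ) (hr : 0 < r) :
    HasDerivAt (fun x : ℝ => x ^ n) (n * r ^ n / r) r := by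
  have := hasDerivAt_zpow n r (Or.inl hr.ne')
  rw [zpow_sub_one₀ hr.ne'] at this
  refine this.congr_deriv ?_
  field_simp

lemma auxg_deriv {β δ r : ℝ} (b : ℝ) (n : ℤ) (hδ : 0 < δ) (hr : 0 < r) :
    HasDerivAt (auxg β δ b n) (auxG β δ b n r / r) r := by
  have h := (auxpow_deriv n hr).mul ((auxT_deriv (β := β) hδ hr).const_add b)
  refine h.congr_deriv ?_
  unfold auxG
  field_simp
  ring

lemma auxG_deriv {β δ r : ℝ} (b : ℝ) (n : ℤ) (hb : β * b = 2 * n) (hδ : 0 < δ) (hr : 0 < r) :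
    HasDerivAt (auxG β δ b n)
      ((n ^ 2 - β ^ 2 * (1 - auxT β δ r ^ 2) / 2) * auxg β δ b n r / r) r := by
  have hT := auxT_deriv (β := β) hδ hr
  have h := (auxpow_deriv n hr).mul
    (((hT.const_add b).const_mul (n : ℝ)).sub ((((hT.pow 2).const_sub 1).const_mul β).div_const 2))
  refine h.congr_deriv ?_
  unfold auxg
  simp only [Pi.pow_apply, Pi.sub_apply]
  generalize auxT β δ r = T
  generalize r ^ n = p
  have : (n : ℝ) = β * b / 2 := by linarith
  rw [this]
  field_simp
  ring

lemma auxT_cont {β δ : ℝ} (hβ : 0 < β) (hδ : 0 < δ) : ContinuousOn (auxT β δ) (Icc 0 1) := by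
  have h : ContinuousOn (fun r : ℝ => r ^ β) (Icc 0 1) :=
    (Real.continuous_rpow_const hβ.le).continuousOn
  refine (continuousOn_const.sub h).div (continuousOn_const.add h) ?_
  intro r hr
  have := Real.rpow_nonneg hr.1 β
  positivity

lemma auxcoef {α δ r : ℝ} (hδ : 0 < δ) (hr : 0 < r) :
    ((2 + α) / 2) ^ 2 * r ^ α * (8 * δ / (δ + r ^ (2 + α)) ^ 2)
      = (2 + α) ^ 2 * (1 - auxT (2 + α) δ r ^ 2) / 2 / r ^ 2 := by
  have hs : 0 < r ^ α := Real.rpow_pos_of_pos hr α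
  have : r ^ (2 + α) = r ^ 2 * r ^ α := by
    rw [Real.rpow_add hr]; norm_num
  unfold auxT
  rw [this]
  have : 0 < δ + r ^ 2 * r ^ α := by positivity
  field_simp
  ring

lemma const_of_deriv_zero {f : ℝ → ℝ} (h : ∀ r ∈ Ioo (0:ℝ) 1, HasDerivAt f 0 r) :
    ∃ c, ∀ r ∈ Ioo (0:ℝ) 1, f r = c := by
  refine ⟨f (1/2), fun r hr => ?_⟩
  refine isOpen_Ioo.is_const_of_deriv_eq_zero (convex_Ioo (0:ℝ) 1).isPreconnected
    (fun x hx => (h x hx).differentiableAt.differentiableWithinAt)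
    (fun x hx => (h x hx).deriv) hr ?_
  constructor <;> norm_num

/-- the equation gives a constant Wronskian -/
lemma aux_wronsk {α δ : ℝ} (b : ℝ) (n : ℤ) (k : ℕ) (hb : (2 + α) * b = 2 * n)
    (hn : (n : ℝ) ^ 2 = (k : ℝ) ^ 2) (hδ : 0 < δ) {w : ℝ → ℝ}
    (hd : ∀ r ∈ Ioo (0 : ℝ) 1, DifferentiableAt ℝ w r ∧ DifferentiableAt ℝ (deriv w) r)
    (he : ∀ r ∈ Ioo (0 : ℝ) 1,
        -deriv (deriv w) r - (1 / r) * deriv w r + ((k : ℝ) ^ 2 / r ^ 2) * w r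
          = ((2 + α) / 2) ^ 2 * r ^ α * (8 * δ / (δ + r ^ (2 + α)) ^ 2) * w r) :
    ∃ c, ∀ r ∈ Ioo (0:ℝ) 1,
      w r * auxG (2 + α) δ b n r - r * deriv w r * auxg (2 + α) δ b n r = c := by
  apply const_of_deriv_zero
  intro r hr
  have h0 := hr.1
  have h := ((hd r hr).1.hasDerivAt.mul (auxG_deriv b n hb hδ h0)).sub
    (((hasDerivAt_id r).mul (hd r hr).2.hasDerivAt).mul (auxg_deriv (β := 2 + α) b n hδ h0))
  refine h.congr_deriv ?_
  have e := he r hr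
  rw [auxcoef hδ h0, ← hn] at e
  have e2 : deriv (deriv w) r = - (1 / r) * deriv w r + ((n : ℝ) ^ 2 / r ^ 2) * w r -
    (2 + α) ^ 2 * (1 - auxT (2 + α) δ r ^ 2) / 2 / r ^ 2 * w r := by linarith
  simp only [id, Pi.mul_apply]
  rw [e2]
  field_simp
  ring

lemma aux_bdd {f : ℝ → ℝ} (hf : ContinuousOn f (Icc 0 1)) :
    ∃ C, 0 ≤ C ∧ ∀ r ∈ Icc (0:ℝ) 1, (f r) ^ 2 ≤ C := by
  obtain ⟨C, hC⟩ := isCompact_Icc.exists_bound_of_continuousOn hf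
  refine ⟨C ^ 2, sq_nonneg _, fun r hr => ?_⟩
  have := hC r hr
  rw [Real.norm_eq_abs] at this
  exact sq_le_sq' (by linarith [neg_abs_le (f r)]) (by linarith [le_abs_self (f r)])

lemma auxg_cont {β δ b : ℝ} (k : ℕ) (hβ : 0 < β) (hδ : 0 < δ) :
    ContinuousOn (auxg β δ b k) (Icc 0 1) := by
  have := auxT_cont hβ hδ
  unfold auxg
  simp only [zpow_natCast]
  fun_prop

lemma auxG_cont {β δ b : ℝ} (k : ℕ) (hβ : 0 < β) (hδ : 0 < δ) :
    ContinuousOn (auxG β δ b k) (Icc 0 1) := by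
  have := auxT_cont hβ hδ
  unfold auxG
  simp only [zpow_natCast]
  fun_prop

lemma aux_wzero {β δ b c : ℝ} (k : ℕ) (hβ : 0 < β) (hδ : 0 < δ) {w : ℝ → ℝ}
    (hi : IntegrableOn (fun r => r * (deriv w r) ^ 2 + (w r) ^ 2 / r) (Ioo 0 1))
    (hc : ∀ r ∈ Ioo (0:ℝ) 1,
      w r * auxG β δ b k r - r * deriv w r * auxg β δ b k r = c) : c = 0 := by
  by_contra hne
  obtain ⟨A, hA0, hA⟩ := aux_bdd (auxg_cont (b := b) k hβ hδ)
  obtain ⟨B, hB0, hB⟩ := aux_bdd (auxG_cont (b := b) k hβ hδ)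
  have h1 : IntegrableOn (fun r : ℝ => c ^ 2 * r⁻¹) (Ioo 0 1) := by
    refine Integrable.mono' (hi.const_mul (2 * (A + B))) (by fun_prop) ?_
    refine (ae_restrict_iff' measurableSet_Ioo).2 (Filter.Eventually.of_forall fun r hr => ?_)
    have h0 := hr.1
    have hr' : r ∈ Icc (0:ℝ) 1 := ⟨hr.1.le, hr.2.le⟩
    have a1 := hA r hr'
    have b1 := hB r hr'
    rw [Real.norm_of_nonneg (by positivity), ← hc r hr]
    generalize auxG β δ b k r = G at *
    generalize auxg β δ b k r = g at *
    have e : (2 * (A + B)) * (r * deriv w r ^ 2 + w r ^ 2 / r)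
        = (2 * (A + B)) * ((r * deriv w r) ^ 2 + w r ^ 2) * r⁻¹ := by
      field_simp
    rw [e]
    refine mul_le_mul_of_nonneg_right ?_ (by positivity)
    generalize r * deriv w r = v
    generalize w r = u
    have i1 : u ^ 2 * G ^ 2 ≤ u ^ 2 * B := mul_le_mul_of_nonneg_left b1 (sq_nonneg _)
    have i2 : v ^ 2 * g ^ 2 ≤ v ^ 2 * A := mul_le_mul_of_nonneg_left a1 (sq_nonneg _)
    have i3 := mul_nonneg (sq_nonneg u) hA0
    have i4 := mul_nonneg (sq_nonneg v) hB0
    nlinarith [sq_nonneg (u * G + v * g)]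
  have h2 : IntegrableOn (fun r : ℝ => r⁻¹) (Ioo 0 1) := by
    refine (h1.const_mul ((c ^ 2)⁻¹)).congr (Filter.Eventually.of_forall fun r => ?_)
    simp only
    field_simp
  have h3 : IntervalIntegrable (fun r : ℝ => r⁻¹) volume 0 1 := by
    rw [intervalIntegrable_iff_integrableOn_Ioo_of_le zero_le_one]
    exact h2
  rw [intervalIntegrable_inv_iff] at h3
  rcases h3 with h | h
  · norm_num at h
  · exact h (by simp)

lemma aux_delta {lam δ : ℝ} (hlam : 0 < lam ∧ lam < 2)
    (hδ : δ = (4 - lam - 2 * Real.sqrt (4 - 2 * lam)) / lam) :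
    0 < δ ∧ δ < 1 ∧ lam * (1 + δ) ^ 2 = 8 * δ := by
  obtain ⟨h0, h2⟩ := hlam
  set s := Real.sqrt (4 - 2 * lam) with hs
  have hs2 : s ^ 2 = 4 - 2 * lam := Real.sq_sqrt (by linarith)
  have hs0 : 0 < s := Real.sqrt_pos.2 (by linarith)
  have hl : lam = (4 - s ^ 2) / 2 := by linarith
  have hs3 : s < 2 := by nlinarith
  have hd : δ = (2 - s) / (2 + s) := by
    rw [hδ, div_eq_div_iff h0.ne' (by positivity), hl]; ring
  refine ⟨?_, ?_, ?_⟩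
  · rw [hd]; exact div_pos (by linarith) (by linarith)
  · rw [hd, div_lt_one (by linarith)]; linarith
  · rw [hd, hl]; field_simp; ring

theorem stmt_9 (α : ℝ) (hα : 0 < α) (k : ℕ) (hk : 1 ≤ k)
    (lam : ℝ) (hlam : 0 < lam ∧ lam < 2) (δ : ℝ)
    (hδ : δ = (4 - lam - 2 * Real.sqrt (4 - 2 * lam)) / lam) :
    (∃ w : ℝ → ℝ, ContinuousOn w (Icc 0 1) ∧
      (∀ r ∈ Ioo (0 : ℝ) 1, DifferentiableAt ℝ w r ∧ DifferentiableAt ℝ (deriv w) r) ∧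
      (∃ r ∈ Icc (0 : ℝ) 1, w r ≠ 0) ∧
      w 0 = 0 ∧ w 1 = 0 ∧
      IntegrableOn (fun r => r * (deriv w r) ^ 2 + (w r) ^ 2 / r) (Ioo 0 1) ∧
      (∀ r ∈ Ioo (0 : ℝ) 1,
        -deriv (deriv w) r - (1 / r) * deriv w r + ((k : ℝ) ^ 2 / r ^ 2) * w r
          = ((2 + α) / 2) ^ 2 * r ^ α * (8 * δ / (δ + r ^ (2 + α)) ^ 2) * w r)) ↔
    (2 + α) ^ 2 * (2 - lam) = 8 * (k : ℝ) ^ 2 := by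
  obtain ⟨hδ0, hδ1, hδl⟩ := aux_delta hlam hδ
  have hβ : 0 < 2 + α := by linarith
  have hk0 : (0:ℝ) < k := by exact_mod_cast hk
  obtain ⟨a, ha⟩ : ∃ a : ℝ, (2 + α) * a = 2 * k := ⟨2 * k / (2 + α), by field_simp⟩
  have ha0 : 0 < a := by
    by_contra h
    nlinarith
  have haZ : (2 + α) * a = 2 * ((k : ℤ) : ℝ) := by simpa using ha
  have hT1 : auxT (2 + α) δ 1 = (δ - 1) / (δ + 1) := by simp [auxT]
  have hlam2 : 2 - lam = 2 * ((1 - δ) / (1 + δ)) ^ 2 := by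
    have : lam = 8 * δ / (1 + δ) ^ 2 := by
      rw [eq_div_iff (by positivity)]; exact hδl
    rw [this]; field_simp; ring
  -- the algebraic criterion
  have hcrit : auxg (2 + α) δ a k 1 = 0 ↔ (2 + α) ^ 2 * (2 - lam) = 8 * (k : ℝ) ^ 2 := by
    have hq : 0 < (1 - δ) / (1 + δ) := div_pos (by linarith) (by linarith)
    have e1 : auxg (2 + α) δ a k 1 = a - (1 - δ) / (1 + δ) := by
      simp only [auxg, one_zpow, one_mul, hT1]; field_simp; ring
    rw [e1, hlam2]
    generalize (1 - δ) / (1 + δ) = q at *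
    have e2 : 8 * (k : ℝ) ^ 2 = 2 * ((2 + α) * a) ^ 2 := by rw [ha]; ring
    rw [e2]
    constructor
    · intro h
      have : a = q := by linarith
      rw [this]; ring
    · intro h
      have h3 : (2 + α) ^ 2 * ((q - a) * (q + a)) = 0 := by linear_combination h / 2
      rcases mul_eq_zero.1 h3 with h4 | h4
      · exact absurd h4 (by positivity)
      · rcases mul_eq_zero.1 h4 with h5 | h5 <;> linarith
  rw [← hcrit]
  constructor
  · rintro ⟨w, hc, hd, ⟨r0, hr0, hw0⟩, hz0, hz1, hi, he⟩
    obtain ⟨c, hcW⟩ := aux_wronsk a k k haZ (by simp) hδ0 hd he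
    have hc0 := aux_wzero k hβ hδ0 hi hcW
    subst hc0
    have key : ∃ C, ∀ r ∈ Ioo (0:ℝ) 1, w r = C * auxg (2 + α) δ a k r := by
      by_cases h1 : a = 1
      · have hpos : ∀ r ∈ Ioo (0:ℝ) 1, 0 < auxg (2 + α) δ a k r := by
          intro r hr
          have hs : 0 < r ^ (2 + α) := Real.rpow_pos_of_pos hr.1 _
          have : 1 + auxT (2 + α) δ r = 2 * δ / (δ + r ^ (2 + α)) := by
            unfold auxT; field_simp; ring
          unfold auxg
          rw [h1, this]
          have := hr.1
          positivity
        obtain ⟨C, hC⟩ := const_of_deriv_zero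
          (f := fun r => w r / auxg (2 + α) δ a k r) (fun r hr => by
            have h := (hd r hr).1.hasDerivAt.div (auxg_deriv (β := 2 + α) a k hδ0 hr.1)
              (hpos r hr).ne'
            refine h.congr_deriv ?_
            have e := hcW r hr
            have := hr.1
            have : deriv w r * auxg (2 + α) δ a k r
                - w r * (auxG (2 + α) δ a k r / r) = 0 := by
              field_simp
              linarith
            rw [this, zero_div])
        exact ⟨C, fun r hr => (div_eq_iff (hpos r hr).ne').1 (hC r hr)⟩
      · obtain ⟨d, hdW⟩ := aux_wronsk (-a) (-(k:ℤ)) k (by push_cast; linarith) (by simp) hδ0 hd he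
        have hne : 2 * (k:ℝ) * (1 - a ^ 2) ≠ 0 := by
          have : 1 - a ≠ 0 := fun h => h1 (by linarith)
          have : 1 - a ^ 2 ≠ 0 := by
            have e : 1 - a ^ 2 = (1 - a) * (1 + a) := by ring
            rw [e]; positivity
          positivity
        refine ⟨-d / (2 * (k:ℝ) * (1 - a ^ 2)), fun r hr => ?_⟩
        rw [div_mul_eq_mul_div, eq_div_iff hne]
        have e1 := hcW r hr
        have e2 := hdW r hr
        have hp : r ^ (k:ℤ) * r ^ (-(k:ℤ)) = 1 := by
          rw [← zpow_add₀ hr.1.ne']; simp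
        rw [← e2]
        have e3 : auxG (2 + α) δ (-a) (-(k:ℤ)) r * auxg (2 + α) δ a k r
            - auxG (2 + α) δ a k r * auxg (2 + α) δ (-a) (-(k:ℤ)) r
            = -(2 * (k:ℝ) * (1 - a ^ 2)) := by
          unfold auxG auxg
          push_cast
          generalize auxT (2 + α) δ r = T
          generalize r ^ (k:ℤ) = p at *
          generalize r ^ (-(k:ℤ)) = q at *
          linear_combination (-(2 * (k:ℝ) * (1 - a ^ 2))) * hp - (p * q) * (1 - T ^ 2) * ha
        linear_combination (w r) * e3 + auxg (2 + α) δ (-a) (-(k:ℤ)) r * e1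
    obtain ⟨C, hC⟩ := key
    have hr0' : r0 ∈ Ioo (0:ℝ) 1 := by
      refine ⟨lt_of_le_of_ne hr0.1 ?_, lt_of_le_of_ne hr0.2 ?_⟩
      · rintro rfl; exact hw0 hz0
      · rintro rfl; exact hw0 hz1
    have hCne : C ≠ 0 := by
      rintro rfl
      exact hw0 (by rw [hC r0 hr0']; ring)
    have hEq : EqOn w (fun r => C * auxg (2 + α) δ a k r) (Icc 0 1) := by
      have hcl : closure (Ioo (0:ℝ) 1) = Icc 0 1 := closure_Ioo zero_ne_one
      refine EqOn.of_subset_closure (s := Ioo 0 1) hC hc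
        (continuousOn_const.mul (auxg_cont k hβ hδ0)) Ioo_subset_Icc_self hcl.ge
    have h1 := hEq (x := 1) (by simp)
    rw [hz1] at h1
    rcases mul_eq_zero.1 h1.symm with h | h
    · exact absurd h hCne
    · exact h
  · intro h1
    have hder : ∀ r : ℝ, 0 < r → deriv (auxg (2 + α) δ a k) r = auxG (2 + α) δ a k r / r :=
      fun r hr => (auxg_deriv a k hδ0 hr).deriv
    have hder2 : ∀ r : ℝ, 0 < r → HasDerivAt (deriv (auxg (2 + α) δ a k))
        ((((((k:ℤ):ℝ) ^ 2 - (2 + α) ^ 2 * (1 - auxT (2 + α) δ r ^ 2) / 2)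
          * auxg (2 + α) δ a k r / r) * r - auxG (2 + α) δ a k r * 1) / r ^ 2) r := by
      intro r hr
      have h := (auxG_deriv a k haZ hδ0 hr).div (hasDerivAt_id r) hr.ne'
      refine h.congr_of_eventuallyEq ?_
      filter_upwards [lt_mem_nhds hr] with x hx
      exact hder x hx
    refine ⟨auxg (2 + α) δ a k, auxg_cont k hβ hδ0, ?_, ?_, ?_, h1, ?_, ?_⟩
    · intro r hr
      exact ⟨(auxg_deriv a k hδ0 hr.1).differentiableAt, (hder2 r hr.1).differentiableAt⟩
    · -- nonzero at the point where `r^β = δ`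
      refine ⟨δ ^ (2 + α)⁻¹, ⟨by positivity, Real.rpow_le_one hδ0.le hδ1.le (by positivity)⟩, ?_⟩
      have : (δ ^ (2 + α)⁻¹) ^ (2 + α) = δ := Real.rpow_inv_rpow hδ0.le hβ.ne'
      unfold auxg auxT
      rw [this]
      simp only [sub_self, zero_div, add_zero]
      positivity
    · simp only [auxg, zpow_natCast]
      rw [zero_pow (by omega), zero_mul]
    · have hTc := auxT_cont hβ hδ0
      have hcont : ContinuousOn (fun r : ℝ => r ^ (2 * k - 1) *
          ((k * (a + auxT (2 + α) δ r) - (2 + α) * (1 - auxT (2 + α) δ r ^ 2) / 2) ^ 2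
            + (a + auxT (2 + α) δ r) ^ 2)) (Icc 0 1) := by fun_prop
      have hint := (hcont.integrableOn_compact isCompact_Icc (μ := volume)).mono_set
        (Ioo_subset_Icc_self)
      refine hint.congr_fun (fun r hr => ?_) measurableSet_Ioo
      have h0 := hr.1
      simp only
      rw [hder r h0]
      unfold auxG auxg
      have hp : r ^ (2 * k - 1) = (r ^ (k:ℤ)) ^ 2 / r := by
        rw [eq_div_iff h0.ne', zpow_natCast, ← pow_succ, ← pow_mul]
        congr 1; omega
      rw [hp]
      push_cast
      generalize r ^ (k:ℤ) = p
      field_simp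
    · intro r hr
      have h0 := hr.1
      rw [(hder2 r h0).deriv, hder r h0, auxcoef hδ0 h0]
      push_cast
      field_simp
      ring
end

section
/- Let α > 0, μ > 0, let B₁ be the open unit ball of ℝ², and suppose u is a C² function on the closed unit ball with u(x) > 0 for x ∈ B₁, u(x) = 0 for |x| = 1, and −Δu(x) = μ·|x|^α·e^{u(x)} for all x ∈ B₁. Then 2μ ≤ (2 + α)², and 2π( (2 + α) − √((2+α)² − 2μ) ) ≤ μ·∫_{B₁} |x|^α e^{u(x)} dx ≤ 2π( (2 + α) + √((2+α)² − 2μ) ). -/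
open Set MeasureTheory

noncomputable section

/-- Polar coordinates map. -/
def polarPt (q : ℝ × ℝ) : EuclideanSpace ℝ (Fin 2) :=
  (q.1 * Real.cos q.2) • EuclideanSpace.single 0 (1 : ℝ) +
    (q.1 * Real.sin q.2) • EuclideanSpace.single 1 (1 : ℝ)

lemma polarPt_zero (q : ℝ × ℝ) : polarPt q 0 = q.1 * Real.cos q.2 := by
  simp [polarPt]

lemma polarPt_one (q : ℝ × ℝ) : polarPt q 1 = q.1 * Real.sin q.2 := by
  simp [polarPt]

lemma norm_polarPt (q : ℝ × ℝ) : ‖polarPt q‖ = |q.1| := by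
  rw [EuclideanSpace.norm_eq, ← Real.sqrt_sq_eq_abs]
  congr 1
  simp only [Fin.sum_univ_two, polarPt_zero, polarPt_one, Real.norm_eq_abs, sq_abs]
  nlinarith [Real.sin_sq_add_cos_sq q.2]

lemma continuous_polarPt : Continuous polarPt := by
  unfold polarPt
  fun_prop

lemma contDiff_polarPt : ContDiff ℝ 1 polarPt := by
  unfold polarPt
  fun_prop

lemma fderiv_polarPt_fst (q : ℝ × ℝ) : fderiv ℝ polarPt q (1, 0) =
    Real.cos q.2 • EuclideanSpace.single 0 (1 : ℝ) +
      Real.sin q.2 • EuclideanSpace.single 1 (1 : ℝ) := by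
  have h := (contDiff_polarPt.differentiable (by norm_num) q).hasFDerivAt
  have h2 : HasDerivAt (fun t : ℝ => (t, q.2)) ((1 : ℝ), (0 : ℝ)) q.1 :=
    (hasDerivAt_id _).prodMk (hasDerivAt_const _ _)
  have h3 := h.comp_hasDerivAt_of_eq q.1 h2 rfl
  have h4 : HasDerivAt (fun t : ℝ => polarPt (t, q.2))
      ((1 * Real.cos q.2) • EuclideanSpace.single 0 (1 : ℝ) +
      (1 * Real.sin q.2) • EuclideanSpace.single 1 (1 : ℝ)) q.1 :=
    (((hasDerivAt_id' q.1).mul_const (Real.cos q.2)).smul_const _).add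
      (((hasDerivAt_id' q.1).mul_const (Real.sin q.2)).smul_const _)
  simpa using h3.unique h4

lemma fderiv_polarPt_snd (q : ℝ × ℝ) : fderiv ℝ polarPt q (0, 1) =
    (-(q.1 * Real.sin q.2)) • EuclideanSpace.single 0 (1 : ℝ) +
      (q.1 * Real.cos q.2) • EuclideanSpace.single 1 (1 : ℝ) := by
  have h := (contDiff_polarPt.differentiable (by norm_num) q).hasFDerivAt
  have h2 : HasDerivAt (fun t : ℝ => (q.1, t)) ((0 : ℝ), (1 : ℝ)) q.2 :=
    (hasDerivAt_const _ _).prodMk (hasDerivAt_id _)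
  have h3 := h.comp_hasDerivAt_of_eq q.2 h2 rfl
  have h4 : HasDerivAt (fun t : ℝ => polarPt (q.1, t))
      ((q.1 * -Real.sin q.2) • EuclideanSpace.single 0 (1 : ℝ) +
      (q.1 * Real.cos q.2) • EuclideanSpace.single 1 (1 : ℝ)) q.2 :=
    (((Real.hasDerivAt_cos q.2).const_mul _).smul_const _).add
      (((Real.hasDerivAt_sin q.2).const_mul _).smul_const _)
  simpa using h3.unique h4

/-- Integration over the unit disc in polar coordinates. -/
lemma integral_ball_polar (d : EuclideanSpace ℝ (Fin 2) → ℝ) :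
    ∫ x in Metric.ball (0 : EuclideanSpace ℝ (Fin 2)) 1, d x =
      ∫ q in Ioo (0 : ℝ) 1 ×ˢ Ioo (-Real.pi) Real.pi, q.1 * d (polarPt q) := by
  have e1 := (PiLp.volume_preserving_toLp (Fin 2)).integral_comp
    (MeasurableEquiv.toLp 2 (Fin 2 → ℝ)).measurableEmbedding
    ((Metric.ball (0 : EuclideanSpace ℝ (Fin 2)) 1).indicator d)
  have e2 := ((volume_preserving_finTwoArrow ℝ).symm).integral_comp
    (MeasurableEquiv.finTwoArrow (α := ℝ)).symm.measurableEmbedding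
    (fun y => (Metric.ball (0 : EuclideanSpace ℝ (Fin 2)) 1).indicator d (WithLp.toLp 2 y))
  rw [← integral_indicator measurableSet_ball, ← e1, ← e2, ← integral_comp_polarCoord_symm]
  have hp : ∀ q : ℝ × ℝ, WithLp.toLp 2 (MeasurableEquiv.finTwoArrow.symm (polarCoord.symm q))
      = polarPt q := by
    intro q
    ext i
    fin_cases i
    · simp [polarPt_zero, MeasurableEquiv.finTwoArrow, MeasurableEquiv.piFinTwo]
    · simp [polarPt_one, MeasurableEquiv.finTwoArrow, MeasurableEquiv.piFinTwo]
  have hm : MeasurableSet (Ioo (0 : ℝ) 1 ×ˢ Ioo (-Real.pi) Real.pi) :=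
    measurableSet_Ioo.prod measurableSet_Ioo
  rw [← integral_indicator polarCoord.open_target.measurableSet, ← integral_indicator hm]
  congr 1
  ext q
  simp only [indicator, hp, Metric.mem_ball, dist_zero_right, norm_polarPt, polarCoord_target,
    mem_prod, mem_Ioi, mem_Ioo, smul_eq_mul]
  by_cases h0 : 0 < q.1
  · simp only [abs_of_pos h0, h0, true_and]
    split_ifs <;> simp_all
  · simp [h0]

/-- Divergence theorem on the unit disc. -/
lemma div_disc (A B d : EuclideanSpace ℝ (Fin 2) → ℝ)
    (hA : ContinuousOn A (Metric.closedBall 0 1)) (hB : ContinuousOn B (Metric.closedBall 0 1))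
    (hd : ContinuousOn d (Metric.closedBall 0 1))
    (h : ∀ x ∈ Metric.ball (0 : EuclideanSpace ℝ (Fin 2)) 1, x ≠ 0 →
      ∃ LA LB : EuclideanSpace ℝ (Fin 2) →L[ℝ] ℝ, HasFDerivAt A LA x ∧ HasFDerivAt B LB x ∧
        LA (EuclideanSpace.single 0 1) + LB (EuclideanSpace.single 1 1) = d x) :
    ∫ x in Metric.ball (0 : EuclideanSpace ℝ (Fin 2)) 1, d x =
      ∫ θ in (-Real.pi)..Real.pi,
        (A (polarPt (1, θ)) * Real.cos θ + B (polarPt (1, θ)) * Real.sin θ) := by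
  set G : ℝ × ℝ → ℝ := fun q =>
    q.1 * (A (polarPt q) * Real.cos q.2 + B (polarPt q) * Real.sin q.2) with hG
  set H : ℝ × ℝ → ℝ := fun q =>
    B (polarPt q) * Real.cos q.2 - A (polarPt q) * Real.sin q.2 with hH
  have hpi := Real.pi_pos
  have hmaps : MapsTo polarPt (Icc ((0 : ℝ), -Real.pi) ((1 : ℝ), Real.pi))
      (Metric.closedBall 0 1) := by
    intro q hq
    rw [Icc_prod_eq] at hq
    simp only [Metric.mem_closedBall, dist_zero_right, norm_polarPt]
    rw [abs_le]
    have := hq.1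
    simp only [mem_Icc] at this
    constructor <;> linarith
  have cp := continuous_polarPt.continuousOn (s := Icc ((0 : ℝ), -Real.pi) ((1 : ℝ), Real.pi))
  have cA := hA.comp cp hmaps
  have cB := hB.comp cp hmaps
  have cd := hd.comp cp hmaps
  have cG : ContinuousOn G (Icc ((0 : ℝ), -Real.pi) ((1 : ℝ), Real.pi)) := by
    apply ContinuousOn.mul (by fun_prop)
    exact (cA.mul (by fun_prop)).add (cB.mul (by fun_prop))
  have cH : ContinuousOn H (Icc ((0 : ℝ), -Real.pi) ((1 : ℝ), Real.pi)) :=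
    (cB.mul (by fun_prop)).sub (cA.mul (by fun_prop))
  have key : ∀ q ∈ Ioo (0 : ℝ) 1 ×ˢ Ioo (-Real.pi) Real.pi, DifferentiableAt ℝ G q ∧
      DifferentiableAt ℝ H q ∧
      fderiv ℝ G q (1, 0) + fderiv ℝ H q (0, 1) = q.1 * d (polarPt q) := by
    rintro q ⟨hq, -⟩
    have hq0 := hq.1
    have hn : ‖polarPt q‖ = q.1 := by rw [norm_polarPt, abs_of_pos hq0]
    obtain ⟨LA, LB, h1, h2, h3⟩ := h (polarPt q) (by simpa [hn] using hq.2)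
      (by rw [← norm_ne_zero_iff, hn]; exact hq0.ne')
    have hp := (contDiff_polarPt.differentiable (by norm_num) q).hasFDerivAt
    have a1 := h1.comp q hp
    have b1 := h2.comp q hp
    have hs : HasFDerivAt (fun q : ℝ × ℝ => Real.sin q.2) _ q :=
      (hasFDerivAt_snd (𝕜 := ℝ) (p := q)).sin
    have hc : HasFDerivAt (fun q : ℝ × ℝ => Real.cos q.2) _ q :=
      (hasFDerivAt_snd (𝕜 := ℝ) (p := q)).cos
    have g1 : HasFDerivAt G _ q := (hasFDerivAt_fst (𝕜 := ℝ) (p := q)).mul ((a1.mul hc).add (b1.mul hs))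
    have g2 : HasFDerivAt H _ q := (b1.mul hc).sub (a1.mul hs)
    refine ⟨g1.differentiableAt, g2.differentiableAt, ?_⟩
    rw [g1.fderiv, g2.fderiv, ← h3]
    simp [fderiv_polarPt_fst, fderiv_polarPt_snd]
    have := Real.sin_sq_add_cos_sq q.2
    generalize LA (EuclideanSpace.single 0 1) = a0
    generalize LB (EuclideanSpace.single 0 1) = b0
    generalize LA (EuclideanSpace.single 1 1) = a1
    generalize LB (EuclideanSpace.single 1 1) = b1
    linear_combination q.1 * (a0 + b1) * this
  have hae : (Ioo (0 : ℝ) 1 ×ˢ Ioo (-Real.pi) Real.pi : Set (ℝ × ℝ)) =ᵐ[volume]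
      (Icc ((0 : ℝ), -Real.pi) ((1 : ℝ), Real.pi)) := by
    rw [← Icc_prod_Icc]
    exact Measure.set_prod_ae_eq Ioo_ae_eq_Icc Ioo_ae_eq_Icc
  have hm : MeasurableSet (Ioo (0 : ℝ) 1 ×ˢ Ioo (-Real.pi) Real.pi) :=
    measurableSet_Ioo.prod measurableSet_Ioo
  have hi : IntegrableOn (fun q : ℝ × ℝ => q.1 * d (polarPt q))
      (Icc ((0 : ℝ), -Real.pi) ((1 : ℝ), Real.pi)) :=
    (ContinuousOn.mul (by fun_prop) cd).integrableOn_compact isCompact_Icc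
  have Hi : IntegrableOn (fun q : ℝ × ℝ => fderiv ℝ G q (1, 0) + fderiv ℝ H q (0, 1))
      (Icc ((0 : ℝ), -Real.pi) ((1 : ℝ), Real.pi)) := by
    rw [← integrableOn_congr_set_ae hae] at hi ⊢
    exact hi.congr_fun (fun q hq => (key q hq).2.2.symm) hm
  have main := integral_divergence_prod_Icc_of_hasFDerivAt_of_le G H (fderiv ℝ G) (fderiv ℝ H)
    ((0 : ℝ), -Real.pi) ((1 : ℝ), Real.pi) (by constructor <;> simp <;> linarith) cG cH
    (fun q hq => (key q hq).1.hasFDerivAt) (fun q hq => (key q hq).2.1.hasFDerivAt) Hi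
  rw [← setIntegral_congr_set hae, setIntegral_congr_fun hm (fun q hq => (key q hq).2.2)] at main
  rw [integral_ball_polar, main]
  have hper : ∀ x : ℝ, H (x, Real.pi) = H (x, -Real.pi) := by
    intro x
    have : polarPt (x, Real.pi) = polarPt (x, -Real.pi) := by simp [polarPt]
    simp [hH, this]
  simp only [hper]
  simp [hG]

lemma norm_rpow_deriv (α : ℝ) (x : EuclideanSpace ℝ (Fin 2)) (hx : x ≠ 0) :
    ∃ K : EuclideanSpace ℝ (Fin 2) →L[ℝ] ℝ,
      HasFDerivAt (fun y : EuclideanSpace ℝ (Fin 2) => ‖y‖ ^ α) K x ∧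
      x 0 * K (EuclideanSpace.single 0 1) + x 1 * K (EuclideanSpace.single 1 1) =
        α * ‖x‖ ^ α := by
  have hn : 0 < ‖x‖ := norm_pos_iff.2 hx
  have hdiff : DifferentiableAt ℝ (fun y : EuclideanSpace ℝ (Fin 2) => ‖y‖ ^ α) x := by
    have h1 : DifferentiableAt ℝ (fun y : EuclideanSpace ℝ (Fin 2) => ‖y‖) x :=
      differentiableAt_id.norm ℝ hx
    exact h1.rpow_const (Or.inl hn.ne')
  refine ⟨_, hdiff.hasFDerivAt, ?_⟩
  have h2 : HasDerivAt (fun t : ℝ => t • x) ((1 : ℝ) • x) 1 := (hasDerivAt_id' 1).smul_const x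
  have h3 := hdiff.hasFDerivAt.comp_hasDerivAt_of_eq 1 h2 (by simp)
  have h4 : HasDerivAt (fun t : ℝ => t ^ α * ‖x‖ ^ α) (α * 1 ^ (α - 1) * ‖x‖ ^ α) 1 :=
    (Real.hasDerivAt_rpow_const (Or.inl one_ne_zero)).mul_const _
  have h5 : (fun t : ℝ => t ^ α * ‖x‖ ^ α) =ᶠ[nhds 1]
      ((fun y : EuclideanSpace ℝ (Fin 2) => ‖y‖ ^ α) ∘ fun t : ℝ => t • x) := by
    filter_upwards [lt_mem_nhds (zero_lt_one (α := ℝ))] with t ht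
    simp only [Function.comp, norm_smul, Real.norm_eq_abs, abs_of_pos ht]
    rw [Real.mul_rpow ht.le hn.le]
  have h6 := h3.unique (h4.congr_of_eventuallyEq h5.symm)
  have hx2 : x = x 0 • EuclideanSpace.single 0 (1 : ℝ) + x 1 • EuclideanSpace.single 1 (1 : ℝ) := by
    ext i; fin_cases i <;> simp
  rw [one_smul] at h6
  have h7 := congrArg (fderiv ℝ (fun y : EuclideanSpace ℝ (Fin 2) => ‖y‖ ^ α) x) hx2
  rw [map_add, map_smul, map_smul, smul_eq_mul, smul_eq_mul] at h7
  rw [← h7, h6]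
  simp

/-- The algebra at the end: the quadratic inequality for the mass gives the bounds. -/
lemma mass_bounds (a μ M : ℝ) (h : M ^ 2 ≤ 4 * Real.pi * (a * M - 2 * Real.pi * μ)) :
    2 * μ ≤ a ^ 2 ∧ 2 * Real.pi * (a - Real.sqrt (a ^ 2 - 2 * μ)) ≤ M ∧
      M ≤ 2 * Real.pi * (a + Real.sqrt (a ^ 2 - 2 * μ)) := by
  have hpi := Real.pi_pos
  obtain ⟨m, rfl⟩ : ∃ m, M = 2 * Real.pi * m := ⟨M / (2 * Real.pi), by field_simp⟩
  have h1 : (m - a) ^ 2 ≤ a ^ 2 - 2 * μ := by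
    have : Real.pi ^ 2 * (m - a) ^ 2 ≤ Real.pi ^ 2 * (a ^ 2 - 2 * μ) := by nlinarith
    exact le_of_mul_le_mul_left this (by positivity)
  have h2 := Real.abs_le_sqrt h1
  rw [abs_le] at h2
  refine ⟨by nlinarith [sq_nonneg (m - a)], ?_, ?_⟩
  · exact mul_le_mul_of_nonneg_left (by linarith) (by positivity)
  · exact mul_le_mul_of_nonneg_left (by linarith) (by positivity)

/-- Pohozaev-type a priori bound.  Every positive `C²` solution of
`−Δu = μ|x|^α e^u` in the unit ball with zero boundary values satisfies
`2μ ≤ (2+α)²` and has total mass pinched between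
`2π(2+α ∓ √((2+α)² − 2μ))`. -/
theorem stmt_11 (α : ℝ) (hα : 0 < α) (μ : ℝ) (hμ : 0 < μ)
    (u : EuclideanSpace ℝ (Fin 2) → ℝ)
    (hreg : ContDiffOn ℝ 2 u (Metric.closedBall (0 : EuclideanSpace ℝ (Fin 2)) 1))
    (hpos : ∀ x ∈ Metric.ball (0 : EuclideanSpace ℝ (Fin 2)) 1, 0 < u x)
    (hbc : ∀ x : EuclideanSpace ℝ (Fin 2), ‖x‖ = 1 → u x = 0)
    (hpde : ∀ x ∈ Metric.ball (0 : EuclideanSpace ℝ (Fin 2)) 1,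
      -planeLaplacian u x = μ * ‖x‖ ^ α * Real.exp (u x)) :
    2 * μ ≤ (2 + α) ^ 2 ∧
    2 * Real.pi * ((2 + α) - Real.sqrt ((2 + α) ^ 2 - 2 * μ)) ≤
      μ * ∫ x in Metric.ball (0 : EuclideanSpace ℝ (Fin 2)) 1, ‖x‖ ^ α * Real.exp (u x) ∧
    μ * (∫ x in Metric.ball (0 : EuclideanSpace ℝ (Fin 2)) 1, ‖x‖ ^ α * Real.exp (u x)) ≤
      2 * Real.pi * ((2 + α) + Real.sqrt ((2 + α) ^ 2 - 2 * μ)) := by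
  set C : Set (EuclideanSpace ℝ (Fin 2)) := Metric.closedBall 0 1 with hC
  set e0 : EuclideanSpace ℝ (Fin 2) := EuclideanSpace.single 0 1 with he0
  set e1 : EuclideanSpace ℝ (Fin 2) := EuclideanSpace.single 1 1 with he1
  have hU : UniqueDiffOn ℝ C := by
    refine uniqueDiffOn_convex (convex_closedBall _ _) ⟨0, ?_⟩
    exact Metric.ball_subset_interior_closedBall (by simp)
  set D := fderivWithin ℝ u C with hD
  have cD : ContinuousOn D C := hreg.continuousOn_fderivWithin hU (by norm_num)
  set g : Fin 2 → EuclideanSpace ℝ (Fin 2) → ℝ :=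
    fun i x => D x (EuclideanSpace.single i 1) with hg
  have cg : ∀ i, ContinuousOn (g i) C := fun i => cD.clm_apply continuousOn_const
  have cu : ContinuousOn u C := hreg.continuousOn
  set f : EuclideanSpace ℝ (Fin 2) → ℝ := fun x => μ * ‖x‖ ^ α * Real.exp (u x) with hf
  have cf : ContinuousOn f C := by
    have : Continuous fun x : EuclideanSpace ℝ (Fin 2) => ‖x‖ ^ α :=
      continuous_norm.rpow_const (fun _ => Or.inr hα.le)
    exact (continuousOn_const.mul this.continuousOn).mul cu.rexp
  have hCn : ∀ x ∈ Metric.ball (0 : EuclideanSpace ℝ (Fin 2)) 1, C ∈ nhds x := fun x hx =>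
    Filter.mem_of_superset (Metric.isOpen_ball.mem_nhds hx) Metric.ball_subset_closedBall
  -- interior derivatives
  have hu1 : ∀ x ∈ Metric.ball (0 : EuclideanSpace ℝ (Fin 2)) 1, HasFDerivAt u (D x) x := by
    intro x hx
    have := (hreg.differentiableOn (by norm_num)) x (Metric.ball_subset_closedBall hx)
    exact this.hasFDerivWithinAt.hasFDerivAt (hCn x hx)
  have hD1 : ∀ x ∈ Metric.ball (0 : EuclideanSpace ℝ (Fin 2)) 1, DifferentiableAt ℝ D x := by
    intro x hx
    have h1 : ContDiffOn ℝ 1 D C := hreg.fderivWithin hU (by norm_num)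
    exact (h1.contDiffAt (hCn x hx)).differentiableAt (by norm_num)
  have hg1 : ∀ x ∈ Metric.ball (0 : EuclideanSpace ℝ (Fin 2)) 1, ∀ i,
      ∃ L : EuclideanSpace ℝ (Fin 2) →L[ℝ] ℝ, HasFDerivAt (g i) L x ∧
        ∀ v, L v = fderiv ℝ D x v (EuclideanSpace.single i 1) := by
    intro x hx i
    have h := (hD1 x hx).hasFDerivAt.clm_apply
      (hasFDerivAt_const (EuclideanSpace.single i (1 : ℝ)) x)
    exact ⟨_, h, fun v => by simp⟩
  have hlap : ∀ x ∈ Metric.ball (0 : EuclideanSpace ℝ (Fin 2)) 1,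
      fderiv ℝ D x e0 e0 + fderiv ℝ D x e1 e1 = - f x := by
    intro x hx
    have hi : ∀ i : Fin 2, deriv (deriv (fun t : ℝ => u (x + t • EuclideanSpace.single i (1 : ℝ)))) 0
        = fderiv ℝ D x (EuclideanSpace.single i 1) (EuclideanSpace.single i 1) := by
      intro i
      have hl : ∀ t : ℝ, HasDerivAt (fun t : ℝ => x + t • EuclideanSpace.single i (1 : ℝ))
          (EuclideanSpace.single i 1) t := by
        intro t
        simpa using ((hasDerivAt_id' t).smul_const (EuclideanSpace.single i (1 : ℝ))).const_add x
      have hcont : ContinuousAt (fun t : ℝ => x + t • EuclideanSpace.single i (1 : ℝ)) 0 :=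
        (hl 0).continuousAt
      have hev : ∀ᶠ t : ℝ in nhds 0, x + t • EuclideanSpace.single i (1 : ℝ) ∈
          Metric.ball (0 : EuclideanSpace ℝ (Fin 2)) 1 :=
        hcont.eventually (Metric.isOpen_ball.mem_nhds (by simpa using hx))
      have hd : deriv (fun t : ℝ => u (x + t • EuclideanSpace.single i (1 : ℝ))) =ᶠ[nhds 0]
          fun t => g i (x + t • EuclideanSpace.single i (1 : ℝ)) := by
        filter_upwards [hev] with t ht
        exact ((hu1 _ ht).comp_hasDerivAt t (hl t)).deriv
      rw [hd.deriv_eq]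
      obtain ⟨L, hL, hL2⟩ := hg1 x hx i
      rw [← hL2]
      exact (hL.comp_hasDerivAt_of_eq 0 (hl 0) (by simp)).deriv
    have := hpde x hx
    simp only [planeLaplacian, Fin.sum_univ_two, hi] at this
    linarith
  have hsymm : ∀ x ∈ Metric.ball (0 : EuclideanSpace ℝ (Fin 2)) 1,
      fderiv ℝ D x e0 e1 = fderiv ℝ D x e1 e0 := by
    intro x hx
    refine second_derivative_symmetric_of_eventually (f := u) (f' := D) ?_
      (hD1 x hx).hasFDerivAt e0 e1
    filter_upwards [Metric.isOpen_ball.mem_nhds hx] with y hy using hu1 y hy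
  -- boundary
  have hbd : ∀ θ : ℝ, polarPt (1, θ) ∈ C := by
    intro θ; simp [hC, norm_polarPt]
  have htan : ∀ θ : ℝ, g 1 (polarPt (1, θ)) * Real.cos θ = g 0 (polarPt (1, θ)) * Real.sin θ := by
    intro θ
    have h1 := ((hreg.differentiableOn (by norm_num)) _ (hbd θ)).hasFDerivWithinAt
    have h2 : HasDerivAt (fun t : ℝ => polarPt (1, t)) (fderiv ℝ polarPt (1, θ) (0, 1)) θ :=
      (contDiff_polarPt.differentiable (by norm_num) (1, θ)).hasFDerivAt.comp_hasDerivAt_of_eq θ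
        ((hasDerivAt_const θ (1 : ℝ)).prodMk (hasDerivAt_id' θ)) rfl
    have h3 : HasDerivAt (u ∘ fun t : ℝ => polarPt (1, t)) _ θ :=
      (h1.comp_hasDerivWithinAt θ h2.hasDerivWithinAt (s := univ)
        (fun t _ => hbd t)).hasDerivAt Filter.univ_mem
    have h4 : (u ∘ fun t : ℝ => polarPt (1, t)) = fun _ => 0 := by
      ext t; exact hbc _ (by simp [norm_polarPt])
    rw [h4] at h3
    have h5 := h3.unique (hasDerivAt_const θ (0 : ℝ))
    rw [fderiv_polarPt_snd] at h5
    simp only [map_add, map_smul, smul_eq_mul, one_mul] at h5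
    simp only [hg, hD]
    linarith
  set h : ℝ → ℝ := fun θ =>
    g 0 (polarPt (1, θ)) * Real.cos θ + g 1 (polarPt (1, θ)) * Real.sin θ with hh
  have cgp : ∀ i, Continuous fun θ : ℝ => g i (polarPt (1, θ)) := by
    intro i
    rw [← continuousOn_univ]
    exact (cg i).comp (continuous_polarPt.comp (by fun_prop)).continuousOn (fun t _ => hbd t)
  have ch : Continuous h :=
    ((cgp 0).mul Real.continuous_cos).add ((cgp 1).mul Real.continuous_sin)
  set M := ∫ x in Metric.ball (0 : EuclideanSpace ℝ (Fin 2)) 1, f x with hM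
  have hMeq : μ * ∫ x in Metric.ball (0 : EuclideanSpace ℝ (Fin 2)) 1, ‖x‖ ^ α * Real.exp (u x)
      = M := by
    rw [hM, ← integral_const_mul]
    simp only [hf, mul_assoc]
  -- flux identity
  have id1 : -M = ∫ θ in (-Real.pi)..Real.pi, h θ := by
    rw [hM, ← integral_neg]
    refine div_disc (g 0) (g 1) (fun x => - f x) (cg 0) (cg 1) cf.neg ?_
    intro x hx _
    obtain ⟨P, hP, hP2⟩ := hg1 x hx 0
    obtain ⟨Q, hQ, hQ2⟩ := hg1 x hx 1
    exact ⟨P, Q, hP, hQ, by rw [hP2, hQ2]; exact hlap x hx⟩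
  -- Pohozaev identity
  have id2 : (2 + α) * M = ∫ θ in (-Real.pi)..Real.pi, (1 / 2 * h θ ^ 2 + μ) := by
    have cx : ∀ i : Fin 2, ContinuousOn (fun x : EuclideanSpace ℝ (Fin 2) => x i) C :=
      fun i => (EuclideanSpace.proj (𝕜 := ℝ) i).continuous.continuousOn
    have cw := ((cx 0).mul (cg 0)).add ((cx 1).mul (cg 1))
    have cN := (((cg 0).mul (cg 0)).add ((cg 1).mul (cg 1)))
    have cS := cf.sub (cN.const_smul (1 / 2 : ℝ))
    have hdiv := div_disc
      (fun x => (x 0 * g 0 x + x 1 * g 1 x) * g 0 x +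
        x 0 * (f x - (1 / 2 : ℝ) • (g 0 x * g 0 x + g 1 x * g 1 x)))
      (fun x => (x 0 * g 0 x + x 1 * g 1 x) * g 1 x +
        x 1 * (f x - (1 / 2 : ℝ) • (g 0 x * g 0 x + g 1 x * g 1 x)))
      (fun x => (2 + α) * f x)
      ((cw.mul (cg 0)).add ((cx 0).mul cS)) ((cw.mul (cg 1)).add ((cx 1).mul cS))
      (continuousOn_const.mul cf) ?_
    · rw [integral_const_mul] at hdiv
      rw [hM, hdiv]
      congr 1
      ext θ
      have hs := Real.sin_sq_add_cos_sq θ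
      have ht := htan θ
      have hfb : f (polarPt (1, θ)) = μ := by
        have h1 : ‖polarPt (1, θ)‖ = 1 := by simp [norm_polarPt]
        simp [hf, h1, hbc _ h1]
      simp only [hh, hfb, polarPt_zero, polarPt_one, one_mul, smul_eq_mul]
      generalize g 0 (polarPt (1, θ)) = a at ht ⊢
      generalize g 1 (polarPt (1, θ)) = b at ht ⊢
      generalize Real.cos θ = c at *
      generalize Real.sin θ = s at *
      linear_combination μ * hs - 1 / 2 * (b * c - a * s) * ht
    · intro x hx hx0
      obtain ⟨P, hP, hP2⟩ := hg1 x hx 0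
      obtain ⟨Q, hQ, hQ2⟩ := hg1 x hx 1
      obtain ⟨K, hK, hK2⟩ := norm_rpow_deriv α x hx0
      have hu := hu1 x hx
      have hx0' : HasFDerivAt (fun y : EuclideanSpace ℝ (Fin 2) => y 0)
        (EuclideanSpace.proj (𝕜 := ℝ) (0 : Fin 2)) x := (EuclideanSpace.proj (𝕜 := ℝ) (0 : Fin 2)).hasFDerivAt
      have hx1' : HasFDerivAt (fun y : EuclideanSpace ℝ (Fin 2) => y 1)
        (EuclideanSpace.proj (𝕜 := ℝ) (1 : Fin 2)) x := (EuclideanSpace.proj (𝕜 := ℝ) (1 : Fin 2)).hasFDerivAt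
      have hff : HasFDerivAt f _ x := (hK.const_mul μ).mul hu.exp
      have hw := (hx0'.mul hP).add (hx1'.mul hQ)
      have hN := (hP.mul hP).add (hQ.mul hQ)
      have hS := hff.sub (hN.const_smul (1 / 2 : ℝ))
      refine ⟨_, _, (hw.mul hP).add (hx0'.mul hS), (hw.mul hQ).add (hx1'.mul hS), ?_⟩
      have l1 := hlap x hx
      have l2 := hsymm x hx
      rw [← he0, ← he1] at hK2 ⊢
      have g0 : g 0 x = D x e0 := rfl
      have g1 : g 1 x = D x e1 := rfl
      have p00 : EuclideanSpace.proj (𝕜 := ℝ) (0 : Fin 2) e0 = (1 : ℝ) := by simp [he0]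
      have p01 : EuclideanSpace.proj (𝕜 := ℝ) (1 : Fin 2) e0 = (0 : ℝ) := by simp [he0]
      have p10 : EuclideanSpace.proj (𝕜 := ℝ) (0 : Fin 2) e1 = (0 : ℝ) := by simp [he1]
      have p11 : EuclideanSpace.proj (𝕜 := ℝ) (1 : Fin 2) e1 = (1 : ℝ) := by simp [he1]
      simp only [add_apply, sub_apply,
        smul_apply, smul_eq_mul, hP2, hQ2, ← he0, ← he1, g0, g1,
        p00, p01, p10, p11, l2, Pi.add_apply, Pi.mul_apply]
      have l3 : fderiv ℝ D x e0 e0 = - f x - fderiv ℝ D x e1 e1 := by linarith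
      rw [l3]
      simp only [hf]
      generalize Real.exp (u x) = E at *
      linear_combination μ * E * hK2
  -- Cauchy-Schwarz
  have hpi := Real.pi_pos
  have cs : M ^ 2 ≤ 4 * Real.pi * ((2 + α) * M - 2 * Real.pi * μ) := by
    have i1 : IntervalIntegrable h volume (-Real.pi) Real.pi := ch.intervalIntegrable _ _
    have i2 : IntervalIntegrable (fun θ => h θ ^ 2) volume (-Real.pi) Real.pi :=
      (ch.pow 2).intervalIntegrable _ _
    rw [intervalIntegral.integral_add (i2.const_mul _) (by simp),
      intervalIntegral.integral_const_mul, intervalIntegral.integral_const, smul_eq_mul] at id2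
    have h0 : 0 ≤ ∫ θ in (-Real.pi)..Real.pi, (2 * Real.pi * h θ + M) ^ 2 :=
      intervalIntegral.integral_nonneg (by linarith) (fun _ _ => sq_nonneg _)
    have h1 : ∫ θ in (-Real.pi)..Real.pi, (2 * Real.pi * h θ + M) ^ 2 =
        ∫ θ in (-Real.pi)..Real.pi,
          ((2 * Real.pi) ^ 2 * h θ ^ 2 + 4 * Real.pi * M * h θ + M ^ 2) := by
      congr 1; ext θ; ring
    rw [h1, intervalIntegral.integral_add ((i2.const_mul _).add (i1.const_mul _)) (by simp),
      intervalIntegral.integral_add (i2.const_mul _) (i1.const_mul _),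
      intervalIntegral.integral_const_mul, intervalIntegral.integral_const_mul,
      intervalIntegral.integral_const, smul_eq_mul, ← id1] at h0
    generalize (∫ θ in (-Real.pi)..Real.pi, h θ ^ 2) = J at *
    have h2 : 0 ≤ 2 * Real.pi * (2 * Real.pi * J - M ^ 2) := by linarith
    have h3 := nonneg_of_mul_nonneg_right h2 (by positivity)
    have h4 : J = 2 * ((2 + α) * M - 2 * Real.pi * μ) := by linarith
    rw [h4] at h3
    linarith
  rw [hMeq]
  exact mass_bounds (2 + α) μ M cs

end
end

section
/- Let α > 0 and 0 < μ < (2+α)²/2, and set δ^± = ( (2+α)² − μ ± (2+α)√((2+α)² − 2μ) )/μ and u_±(x) = log( 2δ^±(2+α)² / (μ(δ^± + |x|^{2+α})²) ). If u is a C² function on the closed unit ball of ℝ² with u > 0 in the open ball B₁, u = 0 on the boundary |x| = 1, and −Δu = μ|x|^α e^u in B₁, then μ·∫_{B₁} |x|^α e^{u_+(x)} dx ≤ μ·∫_{B₁} |x|^α e^{u(x)} dx ≤ μ·∫_{B₁} |x|^α e^{u_-(x)} dx. -/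
open Set MeasureTheory

noncomputable section

/-- Divergence theorem on the polar box. -/
lemma div_box (f g h : ℝ × ℝ → ℝ)
    (hf : ContinuousOn f (Icc 0 1 ×ˢ Icc (-Real.pi) Real.pi))
    (hg : ContinuousOn g (Icc 0 1 ×ˢ Icc (-Real.pi) Real.pi))
    (hh : ContinuousOn h (Icc 0 1 ×ˢ Icc (-Real.pi) Real.pi))
    (hdf : ∀ r ∈ Ioo (0 : ℝ) 1, ∀ t, DifferentiableAt ℝ f (r, t))
    (hdg : ∀ r ∈ Ioo (0 : ℝ) 1, ∀ t, DifferentiableAt ℝ g (r, t))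
    (hd : ∀ r ∈ Ioo (0 : ℝ) 1, ∀ t, ∃ a b, HasDerivAt (fun s => f (s, t)) a r ∧
      HasDerivAt (fun s => g (r, s)) b t ∧ a + b = h (r, t))
    (hper : ∀ r, g (r, Real.pi) = g (r, -Real.pi)) (h0 : ∀ t, f (0, t) = 0) :
    ∫ r in (0 : ℝ)..1, ∫ t in (-Real.pi)..Real.pi, h (r, t) =
      ∫ t in (-Real.pi)..Real.pi, f (1, t) := by
  classical
  have hpi := Real.pi_pos
  have hle : -Real.pi ≤ Real.pi := by linarith
  set I : Set (ℝ × ℝ) := Ioo 0 1 ×ˢ Ioo (-Real.pi) Real.pi with hI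
  let f' : ℝ × ℝ → ℝ × ℝ →L[ℝ] ℝ := fun x =>
    if x ∈ I then fderiv ℝ f x else h x • ContinuousLinearMap.fst ℝ ℝ ℝ
  let g' : ℝ × ℝ → ℝ × ℝ →L[ℝ] ℝ := fun x => if x ∈ I then fderiv ℝ g x else 0
  have key : ∀ x, f' x (1, 0) + g' x (0, 1) = h x := by
    rintro ⟨r, t⟩
    by_cases hx : (r, t) ∈ I
    · simp only [f', g', hx, if_true]
      obtain ⟨a, b, ha, hb, hab⟩ := hd r hx.1 t
      have e1 : fderiv ℝ f (r, t) (1, 0) = a := by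
        have c : HasDerivAt (fun s : ℝ => ((s, t) : ℝ × ℝ)) (1, 0) r :=
          (hasDerivAt_id r).prodMk (hasDerivAt_const r t)
        exact ((hdf r hx.1 t).hasFDerivAt.comp_hasDerivAt r c).unique ha
      have e2 : fderiv ℝ g (r, t) (0, 1) = b := by
        have c : HasDerivAt (fun s : ℝ => ((r, s) : ℝ × ℝ)) (0, 1) t :=
          (hasDerivAt_const t r).prodMk (hasDerivAt_id t)
        exact ((hdg r hx.1 t).hasFDerivAt.comp_hasDerivAt t c).unique hb
      rw [e1, e2, hab]
    · simp [f', g', hx]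
  have main := integral2_divergence_prod_of_hasFDerivAt f g f' g' 0 (-Real.pi) 1 Real.pi
    (by rwa [uIcc_of_le zero_le_one, uIcc_of_le hle])
    (by rwa [uIcc_of_le zero_le_one, uIcc_of_le hle])
    (by
      rw [min_eq_left zero_le_one, max_eq_right zero_le_one, min_eq_left hle, max_eq_right hle]
      rintro ⟨r, t⟩ hx
      have hx' : (r, t) ∈ I := hx
      simp only [f', hx', if_true]
      exact (hdf r hx'.1 t).hasFDerivAt)
    (by
      rw [min_eq_left zero_le_one, max_eq_right zero_le_one, min_eq_left hle, max_eq_right hle]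
      rintro ⟨r, t⟩ hx
      have hx' : (r, t) ∈ I := hx
      simp only [g', hx', if_true]
      exact (hdg r hx'.1 t).hasFDerivAt)
    (by
      simp only [key]
      rw [uIcc_of_le zero_le_one, uIcc_of_le hle]
      exact hh.integrableOn_compact (isCompact_Icc.prod isCompact_Icc))
  simp only [key, hper, h0] at main
  rw [main]; simp

abbrev E2 := EuclideanSpace ℝ (Fin 2)

def PP (t : ℝ) : E2 := !₂[Real.cos t, Real.sin t]
def QQ (t : ℝ) : E2 := !₂[-Real.sin t, Real.cos t]

lemma hasDerivAt_mk {a b : ℝ → ℝ} {a' b' t : ℝ} (ha : HasDerivAt a a' t) (hb : HasDerivAt b b' t) :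
    HasDerivAt (fun s => (!₂[a s, b s] : E2)) !₂[a', b'] t := by
  have : HasDerivAt (fun s => ![a s, b s]) ![a', b'] t := by
    rw [hasDerivAt_pi]
    intro i; fin_cases i
    · simpa using ha
    · simpa using hb
  exact ((EuclideanSpace.equiv (Fin 2) ℝ).symm.toContinuousLinearMap.hasFDerivAt).comp_hasDerivAt t
    this

lemma hasDerivAt_PP (t : ℝ) : HasDerivAt PP (QQ t) t :=
  hasDerivAt_mk (Real.hasDerivAt_cos t) (Real.hasDerivAt_sin t)

lemma hasDerivAt_QQ (t : ℝ) : HasDerivAt QQ (-PP t) t := by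
  have := hasDerivAt_mk (Real.hasDerivAt_sin t).neg (Real.hasDerivAt_cos t)
  convert! this using 1
  ext i; fin_cases i <;> simp [PP]

lemma norm_PP (t : ℝ) : ‖PP t‖ = 1 := by
  simp [PP, EuclideanSpace.norm_eq]

lemma norm_smul_PP {r : ℝ} (hr : 0 ≤ r) (t : ℝ) : ‖r • PP t‖ = r := by
  rw [norm_smul, norm_PP, mul_one, Real.norm_of_nonneg hr]

lemma PP_per : PP Real.pi = PP (-Real.pi) := by simp [PP]
lemma QQ_per : QQ Real.pi = QQ (-Real.pi) := by simp [QQ]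

lemma PP_eq (t : ℝ) : PP t = Real.cos t • EuclideanSpace.single 0 (1:ℝ) +
    Real.sin t • EuclideanSpace.single 1 (1:ℝ) := by
  ext i; fin_cases i <;> simp [PP]
lemma QQ_eq (t : ℝ) : QQ t = -Real.sin t • EuclideanSpace.single 0 (1:ℝ) +
    Real.cos t • EuclideanSpace.single 1 (1:ℝ) := by
  ext i; fin_cases i <;> simp [QQ]

lemma trace_rot (L : E2 →L[ℝ] E2 →L[ℝ] ℝ) (t : ℝ) :
    L (PP t) (PP t) + L (QQ t) (QQ t) =
      ∑ i : Fin 2, L (EuclideanSpace.single i 1) (EuclideanSpace.single i 1) := by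
  rw [PP_eq, QQ_eq]
  simp only [Fin.sum_univ_two, map_add, map_smul, add_apply, smul_apply,
    smul_eq_mul]
  linear_combination (L (EuclideanSpace.single 0 1) (EuclideanSpace.single 0 1) +
    L (EuclideanSpace.single 1 1) (EuclideanSpace.single 1 1)) * Real.sin_sq_add_cos_sq t

lemma polar_int (F : E2 → ℝ)
    (hF : ContinuousOn (fun p : ℝ × ℝ => p.1 * F (p.1 • PP p.2))
      (Icc 0 1 ×ˢ Icc (-Real.pi) Real.pi)) :
    ∫ x in Metric.ball (0 : E2) 1, F x =
      ∫ r in (0 : ℝ)..1, ∫ t in (-Real.pi)..Real.pi, r * F (r • PP t) := by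
  have hpi := Real.pi_pos
  have hle : -Real.pi ≤ Real.pi := by linarith
  have e1 : ∫ x in Metric.ball (0 : E2) 1, F x =
      ∫ z : ℝ × ℝ, (Metric.ball (0 : E2) 1).indicator F !₂[z.1, z.2] := by
    rw [← integral_indicator Metric.isOpen_ball.measurableSet]
    rw [← (PiLp.volume_preserving_toLp (Fin 2)).integral_comp
      (MeasurableEquiv.toLp 2 (Fin 2 → ℝ)).measurableEmbedding]
    rw [← ((volume_preserving_finTwoArrow ℝ).symm).integral_comp
      (MeasurableEquiv.finTwoArrow (α := ℝ)).symm.measurableEmbedding]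
    rfl
  rw [e1, ← integral_comp_polarCoord_symm]
  have e2 : ∀ p ∈ polarCoord.target, p.1 • (Metric.ball (0 : E2) 1).indicator F
        !₂[(polarCoord.symm p).1, (polarCoord.symm p).2] =
      (Ioo (0:ℝ) 1 ×ˢ Ioo (-Real.pi) Real.pi).indicator (fun p => p.1 * F (p.1 • PP p.2)) p := by
    rintro ⟨r, t⟩ ⟨hr, ht⟩
    have hr : 0 < r := hr
    have : (!₂[(polarCoord.symm (r,t)).1, (polarCoord.symm (r,t)).2] : E2) = r • PP t := by
      ext i; fin_cases i <;> simp [PP]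
    rw [this]
    by_cases h1 : r < 1
    · rw [indicator_of_mem, indicator_of_mem]
      · rfl
      · exact ⟨⟨hr, h1⟩, ht⟩
      · simpa [norm_smul_PP hr.le] using h1
    · rw [indicator_of_notMem, indicator_of_notMem]
      · simp
      · rintro ⟨h, _⟩; exact h1 h.2
      · simpa [norm_smul_PP hr.le] using h1
  rw [setIntegral_congr_fun polarCoord.open_target.measurableSet e2,
    setIntegral_indicator (measurableSet_Ioo.prod measurableSet_Ioo)]
  have e3 : polarCoord.target ∩ Ioo (0:ℝ) 1 ×ˢ Ioo (-Real.pi) Real.pi =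
      Ioo (0:ℝ) 1 ×ˢ Ioo (-Real.pi) Real.pi := by
    apply inter_eq_self_of_subset_right
    rintro ⟨r, t⟩ ⟨hr, ht⟩
    exact ⟨hr.1, ht⟩
  rw [e3]
  have hint : IntegrableOn (fun p : ℝ × ℝ => p.1 * F (p.1 • PP p.2))
      (Ioo (0:ℝ) 1 ×ˢ Ioo (-Real.pi) Real.pi) (volume.prod volume) :=
    (hF.integrableOn_compact (isCompact_Icc.prod isCompact_Icc)).mono_set
      (prod_mono Ioo_subset_Icc_self Ioo_subset_Icc_self)
  rw [Measure.volume_eq_prod, setIntegral_prod _ hint]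
  simp only [intervalIntegral.integral_of_le zero_le_one, intervalIntegral.integral_of_le hle,
    integral_Ioc_eq_integral_Ioo]

lemma cs (p : ℝ → ℝ) (hp : ContinuousOn p (Icc (-Real.pi) Real.pi)) :
    (∫ t in (-Real.pi)..Real.pi, p t) ^ 2 ≤ 2 * Real.pi * ∫ t in (-Real.pi)..Real.pi, p t ^ 2 := by
  have hpi := Real.pi_pos
  have hle : -Real.pi ≤ Real.pi := by linarith
  rw [← uIcc_of_le hle] at hp
  set m := (∫ t in (-Real.pi)..Real.pi, p t) with hm
  have h : 0 ≤ ∫ t in (-Real.pi)..Real.pi, (2 * Real.pi * p t - m) ^ 2 :=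
    intervalIntegral.integral_nonneg hle (fun _ _ => sq_nonneg _)
  have i1 : IntervalIntegrable (fun t => p t ^ 2) volume (-Real.pi) Real.pi :=
    (hp.pow 2).intervalIntegrable
  have i2 : IntervalIntegrable p volume (-Real.pi) Real.pi := hp.intervalIntegrable
  have e : ∫ t in (-Real.pi)..Real.pi, (2 * Real.pi * p t - m) ^ 2 =
      (2*Real.pi)^2 * (∫ t in (-Real.pi)..Real.pi, p t ^ 2) - (4 * Real.pi * m) * m
        + 2 * Real.pi * m^2 := by
    have : ∀ t, (2 * Real.pi * p t - m) ^ 2 =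
      (2*Real.pi)^2 * p t ^ 2 - (4 * Real.pi * m) * p t + m ^ 2 := by intro t; ring
    simp only [this]
    rw [intervalIntegral.integral_add ((i1.const_mul _).sub (i2.const_mul _)) (by simp),
      intervalIntegral.integral_sub (i1.const_mul _) (i2.const_mul _),
      intervalIntegral.integral_const_mul, intervalIntegral.integral_const_mul]
    simp only [intervalIntegral.integral_const, smul_eq_mul]
    rw [← hm]; ring
  rw [e] at h
  have : 0 ≤ 2 * Real.pi * (2 * Real.pi * (∫ t in (-Real.pi)..Real.pi, p t ^ 2) - m ^ 2) := by
    nlinarith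
  have := nonneg_of_mul_nonneg_right this (by positivity)
  linarith

lemma radial_mass (a δ μ : ℝ) (ha : 2 < a) (hδ : 0 < δ) (hμ : 0 < μ)
    (v : E2 → ℝ) (hv : ∀ x, v x = Real.log (2 * δ * a ^ 2 / (μ * (δ + ‖x‖ ^ a) ^ 2))) :
    μ * ∫ x in Metric.ball (0 : E2) 1, ‖x‖ ^ (a - 2) * Real.exp (v x) =
      4 * Real.pi * a / (1 + δ) := by
  have hden : ∀ r : ℝ, 0 ≤ r → 0 < δ + r ^ a := fun r hr => by
    have := Real.rpow_nonneg hr a; linarith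
  have hexp : ∀ x, Real.exp (v x) = 2 * δ * a ^ 2 / (μ * (δ + ‖x‖ ^ a) ^ 2) := fun x => by
    rw [hv, Real.exp_log]
    have := hden ‖x‖ (norm_nonneg _)
    positivity
  have hcont : ContinuousOn (fun r : ℝ =>
      r * (r ^ (a - 2) * (2 * δ * a ^ 2 / (μ * (δ + r ^ a) ^ 2)))) (Icc 0 1) := by
    apply continuousOn_id.mul
    apply ((Real.continuous_rpow_const (by linarith)).continuousOn).mul
    apply continuousOn_const.div
    · exact continuousOn_const.mul ((continuousOn_const.add
        (Real.continuous_rpow_const (by linarith)).continuousOn).pow 2)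
    · intro r hr
      have := hden r hr.1
      positivity
  have hpt : ∀ r : ℝ, 0 ≤ r → ∀ t, r * (‖r • PP t‖ ^ (a - 2) * Real.exp (v (r • PP t))) =
      r * (r ^ (a - 2) * (2 * δ * a ^ 2 / (μ * (δ + r ^ a) ^ 2))) := by
    intro r hr t
    rw [hexp, norm_smul_PP hr]
  rw [polar_int]
  · have e1 : ∫ r in (0 : ℝ)..1, ∫ t in (-Real.pi)..Real.pi,
        r * (‖r • PP t‖ ^ (a - 2) * Real.exp (v (r • PP t))) =
        ∫ r in (0 : ℝ)..1, 2 * Real.pi *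
          (r * (r ^ (a - 2) * (2 * δ * a ^ 2 / (μ * (δ + r ^ a) ^ 2)))) := by
      apply intervalIntegral.integral_congr
      intro r hr
      rw [uIcc_of_le zero_le_one] at hr
      simp only [hpt r hr.1, intervalIntegral.integral_const, smul_eq_mul]
      ring
    rw [e1, intervalIntegral.integral_const_mul]
    have e2 := intervalIntegral.integral_eq_sub_of_hasDerivAt_of_le (a := 0) (b := 1) zero_le_one
      (f := fun r : ℝ => - (2 * δ * a / μ) / (δ + r ^ a))
      (f' := fun r => r * (r ^ (a - 2) * (2 * δ * a ^ 2 / (μ * (δ + r ^ a) ^ 2))))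
      (by
        apply continuousOn_const.div
        · exact (continuousOn_const.add
            (Real.continuous_rpow_const (by linarith)).continuousOn)
        · intro r hr
          exact (hden r hr.1).ne')
      (by
        intro r hr
        have h1 := hden r hr.1.le
        have h2 := ((Real.hasDerivAt_rpow_const (p := a) (Or.inl hr.1.ne')).const_add δ)
        have h3 := (hasDerivAt_const r (-(2 * δ * a / μ))).div h2 h1.ne'
        convert! h3 using 1
        have : r ^ (a - 1) = r * r ^ (a - 2) := by
          rw [show a - 1 = 1 + (a - 2) by ring, Real.rpow_add hr.1, Real.rpow_one]
        rw [this]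
        field_simp
        ring)
      (by
        apply ContinuousOn.intervalIntegrable
        rwa [uIcc_of_le zero_le_one])
    rw [e2, Real.one_rpow, Real.zero_rpow (by linarith)]
    field_simp
    ring
  · refine ContinuousOn.congr (f := (fun r : ℝ =>
      r * (r ^ (a - 2) * (2 * δ * a ^ 2 / (μ * (δ + r ^ a) ^ 2)))) ∘ Prod.fst) ?_ ?_
    · exact hcont.comp continuousOn_fst (fun p hp => hp.1)
    · rintro ⟨r, t⟩ hp
      exact hpt r hp.1.1 t

lemma clm_curve {G : E2 → E2 →L[ℝ] ℝ} {L : E2 →L[ℝ] E2 →L[ℝ] ℝ} {X V : ℝ → E2} {X' V' : E2} {s : ℝ}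
    (h : HasFDerivAt G L (X s)) (hX : HasDerivAt X X' s) (hV : HasDerivAt V V' s) :
    HasDerivAt (fun s : ℝ => G (X s) (V s)) (L X' (V s) + G (X s) V') s := by
  have h1 := h.comp_hasDerivAt s hX
  have h2 := h1.clm_apply hV
  exact h2

set_option maxHeartbeats 2000000 in
lemma pohozaev (α : ℝ) (hα : 0 < α) (μ : ℝ) (u : E2 → ℝ)
    (hreg : ContDiffOn ℝ 2 u (Metric.closedBall (0 : E2) 1))
    (hbc : ∀ x : E2, ‖x‖ = 1 → u x = 0)
    (hpde : ∀ x ∈ Metric.ball (0 : E2) 1,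
      -planeLaplacian u x = μ * ‖x‖ ^ α * Real.exp (u x)) :
    ∃ p : ℝ → ℝ, ContinuousOn p (Icc (-Real.pi) Real.pi) ∧
      (∫ t in (-Real.pi)..Real.pi, p t) =
        -(μ * ∫ x in Metric.ball (0 : E2) 1, ‖x‖ ^ α * Real.exp (u x)) ∧
      (∫ t in (-Real.pi)..Real.pi, p t ^ 2) / 2 + 2 * Real.pi * μ +
        (2 + α) * (∫ t in (-Real.pi)..Real.pi, p t) = 0 := by
  have hpi := Real.pi_pos
  have hle : -Real.pi ≤ Real.pi := by linarith
  set K := Metric.closedBall (0 : E2) 1 with hK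
  have hU : UniqueDiffOn ℝ K := uniqueDiffOn_convex (convex_closedBall _ _)
    (by rw [hK, interior_closedBall _ one_ne_zero]; exact ⟨0, by simp⟩)
  obtain ⟨G, hG⟩ : ∃ G : E2 → E2 →L[ℝ] ℝ, G = fderivWithin ℝ u K := ⟨_, rfl⟩
  have hG1 : ContDiffOn ℝ 1 G K := by
    rw [hG]; exact hreg.fderivWithin hU (by norm_num [one_add_one_eq_two])
  have hGc : ContinuousOn G K := hG1.continuousOn
  have huc : ContinuousOn u K := hreg.continuousOn
  have hKn : ∀ x ∈ Metric.ball (0 : E2) 1, K ∈ nhds x := fun x hx =>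
    Filter.mem_of_superset (Metric.isOpen_ball.mem_nhds hx) Metric.ball_subset_closedBall
  have huW : ∀ x ∈ K, HasFDerivWithinAt u (G x) K x := fun x hx => by
    rw [hG]; exact (hreg.differentiableOn (by norm_num) x hx).hasFDerivWithinAt
  have hud : ∀ x ∈ Metric.ball (0 : E2) 1, HasFDerivAt u (G x) x := fun x hx =>
    (huW x (Metric.ball_subset_closedBall hx)).hasFDerivAt (hKn x hx)
  have hGd : ∀ x ∈ Metric.ball (0 : E2) 1, HasFDerivAt G (fderiv ℝ G x) x := fun x hx =>
    ((hG1.differentiableOn (by norm_num) x (Metric.ball_subset_closedBall hx)).differentiableAt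
      (hKn x hx)).hasFDerivAt
  have hsymm : ∀ x ∈ Metric.ball (0 : E2) 1, ∀ v w, fderiv ℝ G x v w = fderiv ℝ G x w v := by
    intro x hx v w
    refine second_derivative_symmetric_of_eventually (f := u) ?_ (hGd x hx) v w
    filter_upwards [Metric.isOpen_ball.mem_nhds hx] with y hy using hud y hy
  have hlap : ∀ x ∈ Metric.ball (0 : E2) 1, planeLaplacian u x =
      ∑ i : Fin 2, fderiv ℝ G x (EuclideanSpace.single i 1) (EuclideanSpace.single i 1) := by
    intro x hx
    unfold planeLaplacian
    refine Finset.sum_congr rfl fun i _ => ?_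
    set e : E2 := EuclideanSpace.single i 1
    have hline : ∀ t : ℝ, HasDerivAt (fun t : ℝ => x + t • e) e t := fun t => by
      simpa using ((hasDerivAt_id t).smul_const e).const_add x
    have hc : Continuous (fun t : ℝ => x + t • e) := by fun_prop
    have hev : ∀ᶠ t : ℝ in nhds 0, x + t • e ∈ Metric.ball (0 : E2) 1 :=
      hc.continuousAt.eventually (Metric.isOpen_ball.mem_nhds (by simpa using hx))
    have h1 : deriv (fun t : ℝ => u (x + t • e)) =ᶠ[nhds 0] fun t => G (x + t • e) e := by
      filter_upwards [hev] with t ht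
      exact ((hud _ ht).comp_hasDerivAt t (hline t)).deriv
    rw [h1.deriv_eq]
    have h2 : HasFDerivAt G (fderiv ℝ G x) (x + (0:ℝ) • e) := by simpa using hGd x hx
    have h3 := (clm_curve (X := fun t : ℝ => x + t • e) h2 (hline 0) (hasDerivAt_const (0:ℝ) e)).deriv
    rwa [map_zero, add_zero] at h3
  -- the polar functions
  have hmemK : ∀ r ∈ Icc (0:ℝ) 1, ∀ t, r • PP t ∈ K := by
    intro r hr t
    rw [hK, mem_closedBall_zero_iff, norm_smul_PP hr.1]; exact hr.2
  have hmemB : ∀ r ∈ Ioo (0:ℝ) 1, ∀ t, r • PP t ∈ Metric.ball (0:E2) 1 := by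
    intro r hr t
    rw [mem_ball_zero_iff, norm_smul_PP hr.1.le]; exact hr.2
  have hPd : Differentiable ℝ PP := fun t => (hasDerivAt_PP t).differentiableAt
  have hQd : Differentiable ℝ QQ := fun t => (hasDerivAt_QQ t).differentiableAt
  have hPc := hPd.continuous
  have hQc := hQd.continuous
  set S : Set (ℝ × ℝ) := Icc 0 1 ×ˢ Icc (-Real.pi) Real.pi with hS
  have hXc : ContinuousOn (fun z : ℝ × ℝ => z.1 • PP z.2) S := by fun_prop
  have hXm : MapsTo (fun z : ℝ × ℝ => z.1 • PP z.2) S K := fun z hz => hmemK _ hz.1 _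
  have hpc : ContinuousOn (fun z : ℝ × ℝ => G (z.1 • PP z.2) (PP z.2)) S :=
    (hGc.comp hXc hXm).clm_apply (by fun_prop)
  have hqc : ContinuousOn (fun z : ℝ × ℝ => G (z.1 • PP z.2) (QQ z.2)) S :=
    (hGc.comp hXc hXm).clm_apply (by fun_prop)
  have huuc : ContinuousOn (fun z : ℝ × ℝ => u (z.1 • PP z.2)) S := huc.comp hXc hXm
  have hXd : Differentiable ℝ (fun z : ℝ × ℝ => z.1 • PP z.2) := by fun_prop
  have hGGd : ∀ r ∈ Ioo (0:ℝ) 1, ∀ t,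
      DifferentiableAt ℝ (fun z : ℝ × ℝ => G (z.1 • PP z.2)) (r, t) := fun r hr t =>
    ((hGd _ (hmemB r hr t)).differentiableAt).comp (r, t) (hXd (r, t))
  have hpd : ∀ r ∈ Ioo (0:ℝ) 1, ∀ t,
      DifferentiableAt ℝ (fun z : ℝ × ℝ => G (z.1 • PP z.2) (PP z.2)) (r, t) := fun r hr t =>
    (hGGd r hr t).clm_apply (by fun_prop)
  have hqd : ∀ r ∈ Ioo (0:ℝ) 1, ∀ t,
      DifferentiableAt ℝ (fun z : ℝ × ℝ => G (z.1 • PP z.2) (QQ z.2)) (r, t) := fun r hr t =>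
    (hGGd r hr t).clm_apply (by fun_prop)
  have huud : ∀ r ∈ Ioo (0:ℝ) 1, ∀ t,
      DifferentiableAt ℝ (fun z : ℝ × ℝ => u (z.1 • PP z.2)) (r, t) := fun r hr t =>
    ((hud _ (hmemB r hr t)).differentiableAt).comp (r, t) (hXd (r, t))
  -- section derivatives
  have hXr : ∀ r t : ℝ, HasDerivAt (fun s : ℝ => s • PP t) (PP t) r := fun r t => by
    simpa using (hasDerivAt_id r).smul_const (PP t)
  have hXt : ∀ r t : ℝ, HasDerivAt (fun s : ℝ => r • PP s) (r • QQ t) t := fun r t =>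
    (hasDerivAt_PP t).const_smul r
  have dpr : ∀ r ∈ Ioo (0:ℝ) 1, ∀ t, HasDerivAt (fun s : ℝ => G (s • PP t) (PP t))
      (fderiv ℝ G (r • PP t) (PP t) (PP t)) r := fun r hr t => by
    have hg := hGd (r • PP t) (hmemB r hr t)
    have h := clm_curve (X := fun s : ℝ => s • PP t) hg (hXr r t) (hasDerivAt_const r (PP t))
    rwa [map_zero, add_zero] at h
  have dqr : ∀ r ∈ Ioo (0:ℝ) 1, ∀ t, HasDerivAt (fun s : ℝ => G (s • PP t) (QQ t))
      (fderiv ℝ G (r • PP t) (PP t) (QQ t)) r := fun r hr t => by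
    have hg := hGd (r • PP t) (hmemB r hr t)
    have h := clm_curve (X := fun s : ℝ => s • PP t) hg (hXr r t) (hasDerivAt_const r (QQ t))
    rwa [map_zero, add_zero] at h
  have dpt : ∀ r ∈ Ioo (0:ℝ) 1, ∀ t, HasDerivAt (fun s : ℝ => G (r • PP s) (PP s))
      (r * fderiv ℝ G (r • PP t) (QQ t) (PP t) + G (r • PP t) (QQ t)) t := fun r hr t => by
    have hg := hGd (r • PP t) (hmemB r hr t)
    have h := clm_curve (X := fun s : ℝ => r • PP s) hg (hXt r t) (hasDerivAt_PP t)
    rwa [map_smul] at h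
  have dqt : ∀ r ∈ Ioo (0:ℝ) 1, ∀ t, HasDerivAt (fun s : ℝ => G (r • PP s) (QQ s))
      (r * fderiv ℝ G (r • PP t) (QQ t) (QQ t) + -G (r • PP t) (PP t)) t := fun r hr t => by
    have hg := hGd (r • PP t) (hmemB r hr t)
    have h := clm_curve (X := fun s : ℝ => r • PP s) hg (hXt r t) (hasDerivAt_QQ t)
    rwa [map_smul, map_neg] at h
  have dur : ∀ r ∈ Ioo (0:ℝ) 1, ∀ t, HasDerivAt (fun s : ℝ => u (s • PP t))
      (G (r • PP t) (PP t)) r := fun r hr t =>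
    (hud (r • PP t) (hmemB r hr t)).comp_hasDerivAt r (hXr r t)
  have hL : ∀ r ∈ Ioo (0:ℝ) 1, ∀ t, fderiv ℝ G (r • PP t) (PP t) (PP t) +
      fderiv ℝ G (r • PP t) (QQ t) (QQ t) = -(μ * r ^ α * Real.exp (u (r • PP t))) := by
    intro r hr t
    have := hpde _ (hmemB r hr t)
    rw [norm_smul_PP hr.1.le] at this
    rw [trace_rot, ← hlap _ (hmemB r hr t), ← this, neg_neg]
  have hra : ContinuousOn (fun z : ℝ × ℝ => z.1 ^ α) S :=
    ((Real.continuous_rpow_const hα.le).comp continuous_fst).continuousOn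
  have hra2 : ContinuousOn (fun z : ℝ × ℝ => z.1 ^ (2 + α)) S :=
    ((Real.continuous_rpow_const (by linarith)).comp continuous_fst).continuousOn
  have hf1 : ContinuousOn (fun z : ℝ × ℝ => z.1) S := continuousOn_fst
  have hra2d : ∀ r ∈ Ioo (0:ℝ) 1, HasDerivAt (fun s : ℝ => s ^ (2 + α))
      ((2 + α) * (r * r ^ α)) r := fun r hr => by
    have h := Real.hasDerivAt_rpow_const (p := 2 + α) (Or.inl hr.1.ne')
    rwa [show 2 + α - 1 = 1 + α by ring, Real.rpow_add hr.1, Real.rpow_one] at h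
  have hra2e : ∀ r ∈ Ioo (0:ℝ) 1, r ^ (2 + α) = r ^ 2 * r ^ α := fun r hr => by
    rw [Real.rpow_add hr.1, Real.rpow_two]
  -- boundary
  have hq1 : ∀ t, G ((1:ℝ) • PP t) (QQ t) = 0 := by
    intro t
    have h1 := (huW _ (hmemK 1 (by norm_num) t)).comp_hasDerivAt_of_eq (x := t) (f := PP)
      (hasDerivAt_PP t) (Filter.Eventually.of_forall fun s => by
        have := hmemK 1 (by norm_num) s
        rwa [one_smul] at this) (one_smul ℝ (PP t))
    have h2 : HasDerivAt (fun _ : ℝ => (0:ℝ)) (G ((1:ℝ) • PP t) (QQ t)) t :=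
      h1.congr_of_eventuallyEq
        (Filter.Eventually.of_forall fun s => (hbc (PP s) (norm_PP s)).symm)
    exact HasDerivAt.unique h2 (hasDerivAt_const t (0:ℝ))
  have hu1 : ∀ t, u ((1:ℝ) • PP t) = 0 := fun t => hbc _ (by simp [norm_PP])
  have hp1c : ContinuousOn (fun t => G ((1:ℝ) • PP t) (PP t)) (Icc (-Real.pi) Real.pi) :=
    hpc.comp (f := fun t : ℝ => ((1:ℝ), t)) (by fun_prop)
      (fun t ht => ⟨by simp, ht⟩)
  -- first divergence identity
  have D1 := div_box (fun z => z.1 * G (z.1 • PP z.2) (PP z.2))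
    (fun z => G (z.1 • PP z.2) (QQ z.2))
    (fun z => -μ * (z.1 * (z.1 ^ α * Real.exp (u (z.1 • PP z.2)))))
    (hf1.mul hpc) hqc
    (continuousOn_const.mul (hf1.mul (hra.mul huuc.rexp)))
    (fun r hr t => differentiableAt_fst.mul (hpd r hr t)) hqd
    (fun r hr t => ⟨_, _, (hasDerivAt_id r).mul (dpr r hr t), dqt r hr t, by
      have := hL r hr t
      simp only [id]
      linear_combination r * this⟩)
    (fun r => by simp only [PP_per, QQ_per]) (fun t => by simp)
  have D2 := div_box (fun z => z.1 ^ 2 * (G (z.1 • PP z.2) (PP z.2) ^ 2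
        - G (z.1 • PP z.2) (QQ z.2) ^ 2) / 2 + μ * (z.1 ^ (2 + α) * Real.exp (u (z.1 • PP z.2)))
        + (2 + α) * (z.1 * G (z.1 • PP z.2) (PP z.2)))
    (fun z => G (z.1 • PP z.2) (QQ z.2) * (z.1 * G (z.1 • PP z.2) (PP z.2) + (2 + α)))
    (fun z => 0)
    (((((hf1.pow 2).mul ((hpc.pow 2).sub (hqc.pow 2))).div_const 2).add
      (continuousOn_const.mul (hra2.mul huuc.rexp))).add (continuousOn_const.mul (hf1.mul hpc)))
    (hqc.mul ((hf1.mul hpc).add continuousOn_const)) continuousOn_const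
    (fun r hr t => by
      have h1 := hpd r hr t
      have h2 := hqd r hr t
      have h3 := (huud r hr t).exp
      have h4 : DifferentiableAt ℝ (fun z : ℝ × ℝ => z.1 ^ (2 + α)) (r, t) :=
        DifferentiableAt.rpow_const differentiableAt_fst (Or.inl hr.1.ne')
      have h5 : DifferentiableAt ℝ (fun z : ℝ × ℝ => z.1) (r, t) := differentiableAt_fst
      have k1 := ((h5.pow 2).mul ((h1.pow 2).sub (h2.pow 2))).mul_const (2:ℝ)⁻¹
      have k2 := (h4.mul h3).const_mul μ
      have k3 := (h5.mul h1).const_mul (2 + α)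
      simp only [div_eq_mul_inv]
      exact (k1.add k2).add k3)
    (fun r hr t => (hqd r hr t).mul ((differentiableAt_fst.mul (hpd r hr t)).add_const _))
    (fun r hr t => by
      have h1 := dpr r hr t
      have h2 := dqr r hr t
      have h3 := (dur r hr t).exp
      have h4 := hra2d r hr
      have h5 := hasDerivAt_id' r
      refine ⟨_, _, ((((h5.pow 2).mul ((h1.pow 2).sub (h2.pow 2))).div_const 2).add
        ((h4.mul h3).const_mul μ)).add ((h5.mul h1).const_mul (2 + α)),
        (dqt r hr t).mul (((dpt r hr t).const_mul r).add_const (2 + α)), ?_⟩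
      have e1 := hL r hr t
      have e2 := hsymm _ (hmemB r hr t) (PP t) (QQ t)
      simp only [Pi.pow_apply, Pi.sub_apply, hra2e r hr, e2]
      push_cast
      linear_combination (r ^ 2 * G (r • PP t) (PP t) + (2 + α) * r) * e1)
    (fun r => by simp only [PP_per, QQ_per])
    (fun t => by
      rw [Real.zero_rpow (by linarith)]; simp)
  refine ⟨fun t => G ((1:ℝ) • PP t) (PP t), hp1c, ?_, ?_⟩
  · have := polar_int (fun x => ‖x‖ ^ α * Real.exp (u x)) (by
      refine ContinuousOn.congr (hf1.mul (hra.mul huuc.rexp)) ?_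
      rintro ⟨r, t⟩ hz
      simp only [norm_smul_PP hz.1.1]
      rfl)
    simp only [one_mul] at D1
    rw [← D1, this]
    simp only [intervalIntegral.integral_const_mul]
    rw [neg_mul]
    congr 2
    apply intervalIntegral.integral_congr
    intro r hr
    rw [uIcc_of_le zero_le_one] at hr
    simp only [norm_smul_PP hr.1, intervalIntegral.integral_const_mul]
  · simp only [hq1, hu1, Real.one_rpow, Real.exp_zero] at D2
    rw [← uIcc_of_le hle] at hp1c
    have i1 : IntervalIntegrable (fun t => G ((1:ℝ) • PP t) (PP t) ^ 2) volume
      (-Real.pi) Real.pi := (hp1c.pow 2).intervalIntegrable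
    have i2 := hp1c.intervalIntegrable (μ := volume)
    have e : ∀ t, (1:ℝ) ^ 2 * (G ((1:ℝ) • PP t) (PP t) ^ 2 - 0 ^ 2) / 2 + μ * (1 * 1)
        + (2 + α) * (1 * G ((1:ℝ) • PP t) (PP t)) =
        2⁻¹ * G ((1:ℝ) • PP t) (PP t) ^ 2 + μ + (2 + α) * G ((1:ℝ) • PP t) (PP t) := by
      intro t; ring
    simp only [e] at D2
    rw [intervalIntegral.integral_add ((i1.const_mul _).add (by simp)) (i2.const_mul _),
      intervalIntegral.integral_add (i1.const_mul _) (by simp),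
      intervalIntegral.integral_const_mul, intervalIntegral.integral_const_mul] at D2
    simp only [intervalIntegral.integral_const, smul_eq_mul, intervalIntegral.integral_zero,
      mul_zero] at D2
    linear_combination -D2

/-- every positive `C²` solution of `−Δu = μ|x|^α e^u` in the unit ball
with zero boundary data has total mass between those of the minimal radial solution
`u₊` and the non-minimal radial solution `u₋`. -/
theorem stmt_12 (α : ℝ) (hα : 0 < α) (μ : ℝ) (hμ : 0 < μ ∧ μ < (2 + α) ^ 2 / 2)
    (δp δm : ℝ)
    (hδp : δp = ((2 + α) ^ 2 - μ + (2 + α) * Real.sqrt ((2 + α) ^ 2 - 2 * μ)) / μ)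
    (hδm : δm = ((2 + α) ^ 2 - μ - (2 + α) * Real.sqrt ((2 + α) ^ 2 - 2 * μ)) / μ)
    (up um : EuclideanSpace ℝ (Fin 2) → ℝ)
    (hup : ∀ x, up x = Real.log (2 * δp * (2 + α) ^ 2 / (μ * (δp + ‖x‖ ^ (2 + α)) ^ 2)))
    (hum : ∀ x, um x = Real.log (2 * δm * (2 + α) ^ 2 / (μ * (δm + ‖x‖ ^ (2 + α)) ^ 2)))
    (u : EuclideanSpace ℝ (Fin 2) → ℝ)
    (hreg : ContDiffOn ℝ 2 u (Metric.closedBall (0 : EuclideanSpace ℝ (Fin 2)) 1))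
    (hpos : ∀ x ∈ Metric.ball (0 : EuclideanSpace ℝ (Fin 2)) 1, 0 < u x)
    (hbc : ∀ x : EuclideanSpace ℝ (Fin 2), ‖x‖ = 1 → u x = 0)
    (hpde : ∀ x ∈ Metric.ball (0 : EuclideanSpace ℝ (Fin 2)) 1,
      -planeLaplacian u x = μ * ‖x‖ ^ α * Real.exp (u x)) :
    μ * (∫ x in Metric.ball (0 : EuclideanSpace ℝ (Fin 2)) 1, ‖x‖ ^ α * Real.exp (up x)) ≤
      μ * ∫ x in Metric.ball (0 : EuclideanSpace ℝ (Fin 2)) 1, ‖x‖ ^ α * Real.exp (u x) ∧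
    μ * (∫ x in Metric.ball (0 : EuclideanSpace ℝ (Fin 2)) 1, ‖x‖ ^ α * Real.exp (u x)) ≤
      μ * ∫ x in Metric.ball (0 : EuclideanSpace ℝ (Fin 2)) 1, ‖x‖ ^ α * Real.exp (um x) := by


  obtain ⟨hμ0, hμ1⟩ := hμ
  have hpi := Real.pi_pos
  have hS2 := Real.sq_sqrt (show (0:ℝ) ≤ (2 + α) ^ 2 - 2 * μ by linarith)
  have hS0 := Real.sqrt_nonneg ((2 + α) ^ 2 - 2 * μ)
  set S := Real.sqrt ((2 + α) ^ 2 - 2 * μ) with hS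
  have hSa : S < 2 + α := by nlinarith
  have hp1 : 1 + δp = (2 + α) * ((2 + α) + S) / μ := by rw [hδp]; field_simp; ring
  have hm1 : 1 + δm = (2 + α) * ((2 + α) - S) / μ := by rw [hδm]; field_simp; ring
  have hδp0 : 0 < δp := by
    rw [hδp]; apply div_pos _ hμ0
    nlinarith [mul_nonneg (show 0 ≤ 2 + α by linarith) hS0]
  have hδm0 : 0 < δm := by
    rw [hδm]; apply div_pos _ hμ0
    have : 0 < ((2 + α) - S) ^ 2 := by have : 0 < 2 + α - S := by linarith
                                       positivity
    nlinarith
  have mp := radial_mass (2 + α) δp μ (by linarith) hδp0 hμ0 up hup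
  have mm := radial_mass (2 + α) δm μ (by linarith) hδm0 hμ0 um hum
  rw [show 2 + α - 2 = α by ring] at mp mm
  rw [mp, mm]
  have vp : 4 * Real.pi * (2 + α) / (1 + δp) = 2 * Real.pi * ((2 + α) - S) := by
    rw [div_eq_iff (by positivity), hp1]; field_simp; linear_combination 2 * hS2
  have vm : 4 * Real.pi * (2 + α) / (1 + δm) = 2 * Real.pi * ((2 + α) + S) := by
    rw [div_eq_iff (by positivity), hm1]; field_simp; linear_combination 2 * hS2
  rw [vp, vm]
  obtain ⟨p, hpc, h1, h2⟩ := pohozaev α hα μ u hreg hbc hpde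
  have h3 := cs p hpc
  set M := μ * ∫ x in Metric.ball (0 : EuclideanSpace ℝ (Fin 2)) 1, ‖x‖ ^ α * Real.exp (u x)
  rw [h1] at h2 h3
  have h4 : (∫ t in (-Real.pi)..Real.pi, p t ^ 2) = 2 * ((2 + α) * M - 2 * Real.pi * μ) := by
    linarith
  rw [h4] at h3
  have h5 : (M - 2 * Real.pi * (2 + α)) ^ 2 ≤ (2 * Real.pi * S) ^ 2 := by
    have : (2 * Real.pi * S) ^ 2 = 4 * Real.pi ^ 2 * ((2 + α) ^ 2 - 2 * μ) := by
      rw [← hS2]; ring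
    rw [this]; linarith
  have h6 := abs_le_of_sq_le_sq' h5 (by positivity)
  constructor <;> linarith [h6.1, h6.2]

end
end
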